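/- arXiv:2510.26134 — 4 statements merged into one kernel-verified Lean document; each statement's English description precedes it below -/
import Mathlib

section
/- Let w ≥ 1 be an integer and ε ∈ (0,1]. Suppose the finite poset P is the disjoint union of {x}, D and U, where D is a nonempty order ideal of P and U is a nonempty filter of P. Let A = max(D) (the maximal elements of D) and B = min(U) (the minimal elements of U), and assume |A| ≤ w, |B| ≤ w, and ℙ(a ≺ x ≺ b) ≥ ε for all a ∈ A and b ∈ B. Then ℙ(A ≺ x ≺ B) ≥ ε^{w²}, where {A ≺ x ≺ B} is the event that f(a) < f(x) < f(b) for all a ∈ A and b ∈ B. -/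
open Finset

section Defs
variable (α : Type*) [Fintype α] [PartialOrder α]

/-- Linear extensions of a finite poset `α` with `n` elements: order-preserving
bijections to `Fin n` (representing the target `{1,…,n}`). -/
def LinExt : Type _ :=
  {f : α ≃ Fin (Fintype.card α) // ∀ x y : α, x < y → f x < f y}

instance : Finite (LinExt α) := by unfold LinExt; infer_instance

noncomputable instance : Fintype (LinExt α) := Fintype.ofFinite _

end Defs

section Defs2
variable {α : Type*} [Fintype α] [PartialOrder α]

/-- the uniform probability `ℙ(E)` of an event `E` on linear extensions -/
noncomputable def Pr (E : LinExt α → Prop) : ℝ :=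
  (Nat.card {f : LinExt α // E f} : ℝ) / (Nat.card (LinExt α) : ℝ)

/-- the value `f(x) ∈ {1,…,n}` of a linear extension at `x` -/
def val (f : LinExt α) (x : α) : ℕ := (f.1 x : ℕ) + 1

/-- `ℙ(x ≺ y)`, the probability that `x` precedes `y` in a uniform linear extension -/
noncomputable def prLT (x y : α) : ℝ := Pr (fun f => val f x < val f y)

/-- the expectation `𝔼 f(x)` for `f` uniform on `E(P)` -/
noncomputable def expec (x : α) : ℝ :=
  (∑ f : LinExt α, (val f x : ℝ)) / (Nat.card (LinExt α) : ℝ)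

/-- the variance `Var(f(x))` for `f` uniform on `E(P)` -/
noncomputable def variance (x : α) : ℝ :=
  (∑ f : LinExt α, ((val f x : ℝ) - expec x) ^ 2) / (Nat.card (LinExt α) : ℝ)

/-- the standard deviation `σ(x)` of `f(x)` -/
noncomputable def sigma (x : α) : ℝ := Real.sqrt (variance x)

/-- `π(x)`: the number of elements of the poset incomparable to `x` -/
noncomputable def piVal (x : α) : ℕ := Nat.card {y : α // ¬ x ≤ y ∧ ¬ y ≤ x}

/-- `q(x) = max_{k ∈ {1,…,n}} ℙ(f(x) = k)` -/
noncomputable def qVal (x : α) : ℝ :=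
  ⨆ k : Fin (Fintype.card α), Pr (fun f => val f x = (k : ℕ) + 1)

end Defs2

section OrderPreservingMaps

variable {β : Type*}

/-- The relation `R` together with `s < x` for `s ∈ S` and `x < t` for `t ∈ T`. -/
def separating (R : β → β → Prop) (x : β) (S T : Set β) (y z : β) : Prop :=
  R y z ∨ (y ∈ S ∧ z = x) ∨ (y = x ∧ z ∈ T)

open Classical in
/-- Coordinates relative to the value at `x`, with that value itself negated. -/
noncomputable def relativeTo (x : β) (φ : β → ℤ) (y : β) : ℤ := if y = x then -φ x else φ y - φ x

lemma relativeTo_involutive (x : β) : Function.Involutive (relativeTo x) := by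
  intro φ
  funext y
  by_cases h : y = x <;> simp [relativeTo, h]

variable [Fintype β]

open Classical in
/-- The maps `φ : β → {0, …, N - 1}` with `φ y < φ z` whenever `R y z`. -/
noncomputable def strictMaps (R : β → β → Prop) (N : ℕ) : Finset (β → ℤ) :=
  {φ ∈ Fintype.piFinset fun _ => Finset.Ico 0 (N : ℤ) | ∀ y z, R y z → φ y < φ z}

lemma mem_strictMaps {R : β → β → Prop} {N : ℕ} {φ : β → ℤ} :
    φ ∈ strictMaps R N ↔ (∀ y, 0 ≤ φ y ∧ φ y < N) ∧ ∀ y z, R y z → φ y < φ z := by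
  simp [strictMaps]

/-- The bijections from `β` to an initial segment of `ℕ` that respect the relation `R`. -/
abbrev StrictNumbering (R : β → β → Prop) : Type _ :=
  {f : β ≃ Fin (Fintype.card β) // ∀ y z, R y z → f y < f z}

open Classical in
/-- An injective strict map is a numbering followed by an increasing enumeration of its range. -/
lemma card_injective_strictMaps (R : β → β → Prop) (N : ℕ) :
    #{φ ∈ strictMaps R N | Function.Injective φ} =
      Nat.card (StrictNumbering R) * N.choose (Fintype.card β) := by
  have hbox : #(Finset.powersetCard (Fintype.card β) (Finset.Ico 0 (N : ℤ))) =
      N.choose (Fintype.card β) := by simp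
  rw [← hbox, Nat.card_eq_fintype_card, ← Finset.card_univ, ← Finset.card_product]
  symm
  have hcard {p : StrictNumbering R × Finset ℤ}
      (hp : p ∈ univ ×ˢ Finset.powersetCard (Fintype.card β) (Finset.Ico 0 (N : ℤ))) :
      #p.2 = Fintype.card β :=
    (Finset.mem_powersetCard.1 (Finset.mem_product.1 hp).2).2
  refine Finset.card_bij (fun p hp y => p.2.orderEmbOfFin (hcard hp) (p.1.1 y)) ?_ ?_ ?_
  · intro p hp
    have hsub := (Finset.mem_powersetCard.1 (Finset.mem_product.1 hp).2).1
    refine Finset.mem_filter.2 ⟨mem_strictMaps.2 ⟨fun y => ?_, fun y z hyz => ?_⟩, ?_⟩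
    · exact Finset.mem_Ico.1 (hsub (Finset.orderEmbOfFin_mem p.2 (hcard hp) (p.1.1 y)))
    · exact (p.2.orderEmbOfFin (hcard hp)).strictMono (p.1.2 y z hyz)
    · exact (p.2.orderEmbOfFin (hcard hp)).injective.comp p.1.1.injective
  · rintro ⟨f, s⟩ hp ⟨g, t⟩ hq h
    have range_eq (p : StrictNumbering R × Finset ℤ) (hp : #p.2 = Fintype.card β) :
        Set.range (fun y => p.2.orderEmbOfFin hp (p.1.1 y)) = p.2 :=
      (p.1.1.surjective.range_comp _).trans (Finset.range_orderEmbOfFin p.2 hp)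
    have hst : s = t := by
      apply Finset.coe_injective
      rw [← range_eq (f, s) (hcard hp), ← range_eq (g, t) (hcard hq)]
      exact congrArg Set.range h
    subst hst
    have hfg : f = g := Subtype.ext <| Equiv.ext fun y =>
      (s.orderEmbOfFin (hcard hp)).injective (congrFun h y)
    rw [hfg]
  · intro φ hφ
    obtain ⟨hφ, hinj⟩ := Finset.mem_filter.1 hφ
    obtain ⟨hbd, hR⟩ := mem_strictMaps.1 hφ
    have hs : #(univ.image φ) = Fintype.card β := Finset.card_image_of_injective _ hinj
    let e := (univ.image φ).orderIsoOfFin hs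
    let f : β → Fin (Fintype.card β) :=
      fun y => e.symm ⟨φ y, Finset.mem_image_of_mem φ (Finset.mem_univ y)⟩
    have hf : Function.Bijective f := by
      refine (Fintype.bijective_iff_injective_and_card f).2 ⟨fun y z h => ?_, by simp⟩
      exact hinj (congrArg Subtype.val (e.symm.injective h))
    refine ⟨(⟨Equiv.ofBijective f hf, fun y z hyz => ?_⟩, univ.image φ), ?_, ?_⟩
    · exact e.symm.strictMono (Subtype.mk_lt_mk.2 (hR y z hyz))
    · simp only [Finset.mem_product, Finset.mem_univ, Finset.mem_powersetCard, true_and]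
      refine ⟨fun k hk => ?_, hs⟩
      obtain ⟨y, -, rfl⟩ := Finset.mem_image.1 hk
      exact Finset.mem_Ico.2 (hbd y)
    · funext y
      exact congrArg Subtype.val (e.apply_symm_apply _)

lemma le_card_strictMaps (R : β → β → Prop) (N : ℕ) :
    Nat.card (StrictNumbering R) * N.choose (Fintype.card β) ≤ #(strictMaps R N) := by
  classical
  rw [← card_injective_strictMaps]
  exact Finset.card_filter_le _ _

lemma card_strictMaps_add_le (R : β → β → Prop) (N : ℕ) :
    #(strictMaps R N) + (Fintype.card β).factorial * N.choose (Fintype.card β) ≤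
      Nat.card (StrictNumbering R) * N.choose (Fintype.card β) + N ^ Fintype.card β := by
  classical
  let R₀ : β → β → Prop := fun _ _ => False
  have hsub : strictMaps R N ⊆ strictMaps R₀ N := fun φ hφ =>
    mem_strictMaps.2 ⟨(mem_strictMaps.1 hφ).1, fun _ _ h => h.elim⟩
  have hall : #(strictMaps R₀ N) = N ^ Fintype.card β := by
    simp [strictMaps, R₀]
  have hperm : Nat.card (StrictNumbering R₀) = (Fintype.card β).factorial := by
    have : Nat.card (StrictNumbering R₀) = Nat.card (β ≃ Fin (Fintype.card β)) :=
      Nat.card_congr (Equiv.subtypeUnivEquiv fun f y z h => h.elim)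
    rw [this, Nat.card_eq_fintype_card, Fintype.card_equiv (Fintype.equivFin β)]
  have hR := Finset.card_filter_add_card_filter_not (s := strictMaps R N) Function.Injective
  have h₀ := Finset.card_filter_add_card_filter_not (s := strictMaps R₀ N) Function.Injective
  have hle := Finset.card_le_card
    (Finset.filter_subset_filter (fun φ => ¬ Function.Injective φ) hsub)
  rw [card_injective_strictMaps] at hR h₀
  rw [hperm] at h₀
  omega

open Filter Topology in
/-- A product inequality between the numbers of strict maps into every interval passes to
numbers of bijective numberings. -/
lemma card_numbering_mul_le {R₁ R₂ R₃ R₄ : β → β → Prop}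
    (h : ∀ N, #(strictMaps R₁ N) * #(strictMaps R₂ N) ≤
      #(strictMaps R₃ N) * #(strictMaps R₄ N)) :
    Nat.card (StrictNumbering R₁) * Nat.card (StrictNumbering R₂) ≤
      Nat.card (StrictNumbering R₃) * Nat.card (StrictNumbering R₄) := by
  set n := Fintype.card β with hn
  let r : ℕ → ℝ := fun N => (N : ℝ) ^ n / N.choose n - n.factorial
  have hr : Tendsto r atTop (𝓝 0) := by
    have hequiv := (isEquivalent_choose n).symm
    rw [Asymptotics.isEquivalent_iff_tendsto_one] at hequiv
    · have := (hequiv.const_mul (n.factorial : ℝ)).sub_const (n.factorial : ℝ)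
      rw [mul_one, sub_self] at this
      refine this.congr fun N => ?_
      simp only [r, Pi.div_apply]
      field_simp
    · filter_upwards [eventually_ge_atTop n] with N hN
      exact_mod_cast (Nat.choose_pos hN).ne'
  have hlim : Tendsto (fun N => ((Nat.card (StrictNumbering R₃) : ℝ) + r N) *
      (Nat.card (StrictNumbering R₄) + r N)) atTop
      (𝓝 (Nat.card (StrictNumbering R₃) * Nat.card (StrictNumbering R₄))) := by
    simpa using (hr.const_add (Nat.card (StrictNumbering R₃) : ℝ)).mul
      (hr.const_add (Nat.card (StrictNumbering R₄) : ℝ))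
  rw [← Nat.cast_le (α := ℝ)]
  push_cast
  refine ge_of_tendsto hlim ?_
  filter_upwards [eventually_ge_atTop n] with N hN
  have hC : (0 : ℝ) < N.choose n := by exact_mod_cast Nat.choose_pos hN
  have lower (R : β → β → Prop) :
      (Nat.card (StrictNumbering R) : ℝ) ≤ #(strictMaps R N) / N.choose n := by
    rw [le_div_iff₀ hC]
    exact_mod_cast le_card_strictMaps R N
  have upper (R : β → β → Prop) :
      (#(strictMaps R N) : ℝ) / N.choose n ≤ Nat.card (StrictNumbering R) + r N := by
    have := card_strictMaps_add_le R N
    rw [← hn, ← Nat.cast_le (α := ℝ)] at this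
    push_cast at this
    simp only [r]
    rw [div_le_iff₀ hC, add_mul, sub_mul, div_mul_cancel₀ _ hC.ne']
    linarith
  calc (Nat.card (StrictNumbering R₁) : ℝ) * Nat.card (StrictNumbering R₂)
      ≤ (#(strictMaps R₁ N) / N.choose n) * (#(strictMaps R₂ N) / N.choose n) := by
        gcongr <;> exact lower _
    _ ≤ (#(strictMaps R₃ N) / N.choose n) * (#(strictMaps R₄ N) / N.choose n) := by
        rw [div_mul_div_comm, div_mul_div_comm]
        refine div_le_div_of_nonneg_right ?_ (by positivity)
        exact_mod_cast h N
    _ ≤ _ := mul_le_mul (upper R₃) (upper R₄) (by positivity)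
        (le_trans (by positivity) (upper R₃))

open scoped FinsetFamily in
/-- Shepp's correlation inequality: in the coordinates `relativeTo x` the strict maps form a
distributive lattice, and lying above `S` and below `T` become opposite monotone events. -/
lemma card_strictMaps_separating_mul_le (R : β → β → Prop) (x : β) (S S' T T' : Set β) (N : ℕ) :
    #(strictMaps (separating R x S T) N) * #(strictMaps (separating R x S' T') N) ≤
      #(strictMaps (separating R x (S ∪ S') (T ∩ T')) N) *
        #(strictMaps (separating R x (S ∩ S') (T ∪ T')) N) := by
  classical
  let F (S T : Set β) : Finset (β → ℤ) := (strictMaps (separating R x S T) N).image (relativeTo x)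
  have card_F (S T : Set β) : #(F S T) = #(strictMaps (separating R x S T) N) :=
    Finset.card_image_of_injective _ (relativeTo_involutive x).injective
  have mem_F (S T : Set β) (φ : β → ℤ) :
      φ ∈ F S T ↔ relativeTo x φ ∈ strictMaps (separating R x S T) N :=
    ⟨fun h => by
      obtain ⟨ψ, hψ, rfl⟩ := Finset.mem_image.1 h
      rwa [relativeTo_involutive x ψ],
     fun h => Finset.mem_image.2 ⟨_, h, relativeTo_involutive x φ⟩⟩
  have hinf : F S T ⊼ F S' T' ⊆ F (S ∪ S') (T ∩ T') := by
    rw [Finset.infs_subset_iff]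
    intro φ hφ ψ hψ
    rw [mem_F, mem_strictMaps] at hφ hψ ⊢
    refine ⟨fun y => ?_, fun y z hyz => ?_⟩
    · have := hφ.1 y; have := hψ.1 y; have := hφ.1 x; have := hψ.1 x
      simp only [relativeTo, Pi.inf_apply] at *
      split_ifs at * <;> omega
    · have := hφ.2 y z; have := hψ.2 y z
      simp only [separating, relativeTo, Pi.inf_apply, Set.mem_union, Set.mem_inter_iff] at *
      grind
  have hsup : F S T ⊻ F S' T' ⊆ F (S ∩ S') (T ∪ T') := by
    rw [Finset.sups_subset_iff]
    intro φ hφ ψ hψ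
    rw [mem_F, mem_strictMaps] at hφ hψ ⊢
    refine ⟨fun y => ?_, fun y z hyz => ?_⟩
    · have := hφ.1 y; have := hψ.1 y; have := hφ.1 x; have := hψ.1 x
      simp only [relativeTo, Pi.sup_apply] at *
      split_ifs at * <;> omega
    · have := hφ.2 y z; have := hψ.2 y z
      simp only [separating, relativeTo, Pi.sup_apply, Set.mem_union, Set.mem_inter_iff] at *
      grind
  simp only [← card_F]
  exact (Finset.le_card_infs_mul_card_sups _ _).trans
    (Nat.mul_le_mul (Finset.card_le_card hinf) (Finset.card_le_card hsup))

end OrderPreservingMaps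

section Separation

variable {β : Type*} [Fintype β] [PartialOrder β]

/-- The probability that a uniform linear extension puts `x` above all of `S` and below all
of `T`. -/
noncomputable def separationProb (x : β) (S T : Set β) : ℝ :=
  Pr fun f => (∀ a ∈ S, val f a < val f x) ∧ ∀ b ∈ T, val f x < val f b

lemma separationProb_nonneg (x : β) (S T : Set β) : 0 ≤ separationProb x S T := by
  unfold separationProb Pr
  positivity

lemma separationProb_le_one (x : β) (S T : Set β) : separationProb x S T ≤ 1 :=
  div_le_one_of_le₀ (by exact_mod_cast Finite.card_subtype_le _) (by positivity)

lemma separationProb_eq (x : β) (S T : Set β) :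
    separationProb x S T =
      Nat.card (StrictNumbering (separating (· < ·) x S T)) / Nat.card (LinExt β) := by
  unfold separationProb Pr
  congr 2
  refine Nat.card_congr ((Equiv.subtypeSubtypeEquivSubtypeInter
    (fun f : β ≃ Fin (Fintype.card β) => ∀ y z, y < z → f y < f z)
    (fun f => (∀ a ∈ S, (f a : ℕ) + 1 < f x + 1) ∧ ∀ b ∈ T, (f x : ℕ) + 1 < f b + 1)).trans
    (Equiv.subtypeEquivRight fun f => ?_))
  simp only [separating, add_lt_add_iff_right, Fin.val_fin_lt]
  grind

lemma separationProb_mul_le (x : β) (S S' T T' : Set β) :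
    separationProb x S T * separationProb x S' T' ≤
      separationProb x (S ∪ S') (T ∩ T') * separationProb x (S ∩ S') (T ∪ T') := by
  simp only [separationProb_eq, div_mul_div_comm]
  refine div_le_div_of_nonneg_right ?_ (by positivity)
  exact_mod_cast card_numbering_mul_le (card_strictMaps_separating_mul_le (· < ·) x S S' T T')

lemma pow_ncard_le_of_mul_le_union {α : Type*} {g : Set α → ℝ} {δ : ℝ} (hδ : 0 ≤ δ)
    (hmul : ∀ S S', g S * g S' ≤ g (S ∪ S')) {A : Set α} (hA : A.Finite) (hne : A.Nonempty)
    (hg : ∀ a ∈ A, δ ≤ g {a}) : δ ^ A.ncard ≤ g A := by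
  lift A to Finset α using hA
  rw [Set.ncard_coe_finset]
  rw [Finset.coe_nonempty] at hne
  induction hne using Finset.Nonempty.cons_induction with
  | singleton a => simpa using hg a
  | cons a s ha hs ih =>
    rw [Finset.card_cons, pow_succ', Finset.coe_cons, Set.insert_eq]
    have hga : δ ≤ g {a} := hg a (by simp)
    refine le_trans ?_ (hmul {a} s)
    exact mul_le_mul hga (ih fun b hb => hg b (by simp_all)) (by positivity) (hδ.trans hga)

end Separation

/-- if `P = {x} ⊔ D ⊔ U` with `D` a nonempty ideal and `U` a nonempty filter,
`A = max(D)`, `B = min(U)`, `|A|,|B| ≤ w`, and `ℙ(a ≺ x ≺ b) ≥ ε` for all `a ∈ A`, `b ∈ B`,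
then `ℙ(A ≺ x ≺ B) ≥ ε^{w²}`. -/
theorem stmt_12 (w : ℕ) (hw : 1 ≤ w) (ε : ℝ) (hε0 : 0 < ε) (hε1 : ε ≤ 1)
    (β : Type) [Fintype β] [PartialOrder β] (x : β) (D U : Set β)
    (hxD : x ∉ D) (hxU : x ∉ U) (hDU : Disjoint D U)
    (hcover : ∀ y : β, y = x ∨ y ∈ D ∨ y ∈ U)
    (hDne : D.Nonempty) (hUne : U.Nonempty)
    (hideal : ∀ y z : β, y < z → z ∈ D → y ∈ D)
    (hfilter : ∀ y z : β, z < y → z ∈ U → y ∈ U)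
    (A B : Set β)
    (hA : A = {a ∈ D | ∀ a' ∈ D, a ≤ a' → a = a'})
    (hB : B = {b ∈ U | ∀ b' ∈ U, b' ≤ b → b' = b})
    (hAcard : A.ncard ≤ w) (hBcard : B.ncard ≤ w)
    (hprob : ∀ a ∈ A, ∀ b ∈ B,
      ε ≤ Pr (fun f => val f a < val f x ∧ val f x < val f b)) :
    ε ^ (w ^ 2) ≤
      Pr (fun f => (∀ a ∈ A, val f a < val f x) ∧ (∀ b ∈ B, val f x < val f b)) := by
  have hAne : A.Nonempty := by
    obtain ⟨a, ha⟩ := D.toFinite.exists_maximal hDne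
    exact ⟨a, hA ▸ ⟨ha.1, fun a' ha' h => le_antisymm h (ha.2 ha' h)⟩⟩
  have hBne : B.Nonempty := by
    obtain ⟨b, hb⟩ := U.toFinite.exists_minimal hUne
    exact ⟨b, hB ▸ ⟨hb.1, fun b' hb' h => le_antisymm h (hb.2 hb' h)⟩⟩
  have hrow (a : β) (ha : a ∈ A) : ε ^ B.ncard ≤ separationProb x {a} B := by
    refine pow_ncard_le_of_mul_le_union hε0.le (fun T T' => ?_) B.toFinite hBne fun b hb => ?_
    · refine (separationProb_mul_le x {a} {a} T T').trans ?_
      rw [Set.union_self, Set.inter_self]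
      exact mul_le_of_le_one_left (separationProb_nonneg _ _ _) (separationProb_le_one _ _ _)
    · simpa [separationProb] using hprob a ha b hb
  have hall : (ε ^ B.ncard) ^ A.ncard ≤ separationProb x A B := by
    refine pow_ncard_le_of_mul_le_union (g := fun S => separationProb x S B) (by positivity)
      (fun S S' => ?_) A.toFinite hAne hrow
    refine (separationProb_mul_le x S S' B B).trans ?_
    rw [Set.union_self, Set.inter_self]
    exact mul_le_of_le_one_right (separationProb_nonneg _ _ _) (separationProb_le_one _ _ _)
  refine le_trans ?_ hall
  rw [← pow_mul, sq]
  exact pow_le_pow_of_le_one hε0.le hε1 (Nat.mul_le_mul hBcard hAcard)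
end

section
/- If P is a finite poset of width 2 and x ∈ P is incomparable to at least one element of P, then δ_x ≥ 1/2 − q(x). -/
open Finset

section LinearExtensions
variable {α : Type*} [Fintype α] [PartialOrder α]

theorem LinExt.nonempty : Nonempty (LinExt α) := by
  classical
  let _ : Fintype (LinearExtension α) := ‹Fintype α›
  have e : LinearExtension α ≃o Fin (Fintype.card α) :=
    (Fintype.orderIsoFinOfCardEq (LinearExtension α) rfl).symm
  refine ⟨⟨e.toEquiv, fun x y h => ?_⟩⟩
  have hle : (toLinearExtension x : LinearExtension α) ≤ toLinearExtension y :=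
    toLinearExtension.monotone h.le
  have hne : (toLinearExtension x : LinearExtension α) ≠ toLinearExtension y := h.ne
  exact e.strictMono (lt_of_le_of_ne hle hne)

theorem Pr_nonneg (E : LinExt α → Prop) : 0 ≤ Pr E := by
  unfold Pr; positivity

theorem Pr_mono {E F : LinExt α → Prop} (h : ∀ f, E f → F f) : Pr E ≤ Pr F := by
  unfold Pr
  gcongr
  exact Nat.card_le_card_of_injective (Subtype.map id h)
    (Subtype.map_injective h Function.injective_id)

theorem Pr_or_le (E F : LinExt α → Prop) : Pr (fun f => E f ∨ F f) ≤ Pr E + Pr F := by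
  classical
  unfold Pr
  rw [← add_div]
  gcongr
  norm_cast
  simp only [Nat.card_eq_fintype_card]
  exact Fintype.card_subtype_or _ _

theorem Pr_true : Pr (fun _ : LinExt α => True) = 1 := by
  have : Nonempty (LinExt α) := LinExt.nonempty
  have h : Nat.card {f : LinExt α // True} = Nat.card (LinExt α) :=
    Nat.card_congr (Equiv.subtypeUnivEquiv fun _ => trivial)
  have h0 : (Nat.card (LinExt α) : ℝ) ≠ 0 := by exact_mod_cast Nat.card_pos.ne'
  unfold Pr
  rw [h, div_self h0]

theorem one_le_prLT_add_prLT {x y : α} (hxy : x ≠ y) : 1 ≤ prLT x y + prLT y x := by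
  rw [← Pr_true (α := α)]
  refine (Pr_mono fun f _ => ?_).trans (Pr_or_le _ _)
  have h : (f.1 x : ℕ) ≠ f.1 y := fun h => hxy (f.1.injective (Fin.ext h))
  unfold _root_.val
  omega

theorem LinExt.val_lt_val {f : LinExt α} {x y : α} (h : x < y) : val f x < val f y :=
  Nat.succ_lt_succ (f.2 x y h)

theorem LinExt.val_le_val {f : LinExt α} {x y : α} (h : x ≤ y) : val f x ≤ val f y := by
  rcases h.eq_or_lt with rfl | h
  · exact le_rfl
  · exact (LinExt.val_lt_val h).le

/-- The position of an element is determined by the set of elements preceding it. -/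
theorem LinExt.apply_eq_of_forall_val_lt_iff {f g : LinExt α} {x : α}
    (h : ∀ w, val f w < val f x ↔ val g w < val g x) : f.1 x = g.1 x := by
  classical
  have key : ∀ f : LinExt α,
      (univ.filter fun w => val f w < val f x).card = (f.1 x : ℕ) := by
    intro f
    rw [← Fin.card_Iio (f.1 x), ← Finset.card_map f.1.toEmbedding]
    congr 1
    ext k
    simp only [mem_map, mem_filter, mem_univ, true_and, Equiv.coe_toEmbedding, mem_Iio, _root_.val,
      add_lt_add_iff_right, Fin.val_fin_lt]
    exact ⟨by rintro ⟨w, hw, rfl⟩; exact hw, fun hk => ⟨f.1.symm k, by simpa using hk, by simp⟩⟩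
  apply Fin.ext
  rw [← key f, ← key g]
  congr 1
  ext w
  simp [h w]

/-- An event fixing the set of elements preceding `x` has probability at most `q(x)`. -/
theorem Pr_le_qVal {x : α} {E : LinExt α → Prop} (S : α → Prop)
    (hE : ∀ f, E f → ∀ w, val f w < val f x ↔ S w) : Pr E ≤ qVal x := by
  have hb : BddAbove (Set.range fun k : Fin (Fintype.card α) =>
      Pr (fun f => val f x = (k : ℕ) + 1)) := (Set.finite_range _).bddAbove
  obtain ⟨g₀⟩ := LinExt.nonempty (α := α)
  obtain ⟨k, hk⟩ : ∃ k : Fin (Fintype.card α), ∀ f, E f → f.1 x = k := by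
    by_cases h : ∃ g, E g
    · obtain ⟨g, hg⟩ := h
      exact ⟨g.1 x, fun f hf => LinExt.apply_eq_of_forall_val_lt_iff fun w =>
        (hE f hf w).trans (hE g hg w).symm⟩
    · exact ⟨g₀.1 x, fun f hf => (h ⟨f, hf⟩).elim⟩
  refine le_trans (Pr_mono fun f hf => ?_) (le_ciSup hb k)
  simp [_root_.val, hk f hf]

end LinearExtensions

/-- if `P` has width 2 and `x` is incomparable to at least one element,
then `δ_x ≥ 1/2 - q(x)`. -/
theorem stmt_13 (β : Type) [Fintype β] [PartialOrder β]
    (hwle : ∀ A : Finset β, IsAntichain (· ≤ ·) (A : Set β) → A.card ≤ 2)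
    (hwge : ∃ A : Finset β, IsAntichain (· ≤ ·) (A : Set β) ∧ A.card = 2)
    (x : β) (hinc : ∃ y : β, ¬ x ≤ y ∧ ¬ y ≤ x) :
    ∃ y : β, y ≠ x ∧ 1 / 2 - qVal x ≤ min (prLT x y) (prLT y x) := by
  classical
  have chain : ∀ y z : β, ¬ x ≤ y → ¬ y ≤ x → ¬ x ≤ z → ¬ z ≤ x → y ≤ z ∨ z ≤ y := by
    intro y z h1 h2 h3 h4
    by_contra! h
    have hA := hwle {x, y, z} (by
      intro a ha b hb hab
      simp only [coe_insert, coe_singleton, Set.mem_insert_iff, Set.mem_singleton_iff] at ha hb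
      rcases ha with rfl | rfl | rfl <;> rcases hb with rfl | rfl | rfl <;> simp_all)
    rw [card_eq_three.2 ⟨x, y, z, fun h => h1 h.le, fun h => h3 h.le, fun h' => h.1 h'.le, rfl⟩]
      at hA
    omega
  have least : ∀ D : Finset β, (∀ z ∈ D, ¬ x ≤ z ∧ ¬ z ≤ x) → D.Nonempty →
      ∃ y ∈ D, ∀ z ∈ D, y ≤ z := by
    intro D hD hne
    obtain ⟨y, hy⟩ := D.exists_minimal hne
    refine ⟨y, hy.prop, fun z hz => ?_⟩
    rcases chain y z (hD y hy.prop).1 (hD y hy.prop).2 (hD z hz).1 (hD z hz).2 with h | h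
    · exact h
    · exact hy.le_of_le hz h
  have hx_lt : ∀ f : LinExt β, ∀ w, x ≤ w → ¬ val f w < val f x := fun f w h =>
    (LinExt.val_le_val h).not_gt
  have hlt_x : ∀ f : LinExt β, ∀ w, w < x → val f w < val f x := fun f w h =>
    LinExt.val_lt_val h
  by_cases hA : ∃ y, (¬ x ≤ y ∧ ¬ y ≤ x) ∧ 1 / 2 ≤ prLT y x
  · obtain ⟨y, hy⟩ := (univ.filter fun y => (¬ x ≤ y ∧ ¬ y ≤ x) ∧ 1 / 2 ≤ prLT y x).exists_maximal
      (by obtain ⟨y, hy⟩ := hA; exact ⟨y, by simpa using hy⟩)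
    obtain ⟨⟨hy1, hy2⟩, hyp⟩ := (mem_filter.1 hy.prop).2
    set U : LinExt β → Prop :=
      fun f => ∃ z, (¬ x ≤ z ∧ ¬ z ≤ x) ∧ y < z ∧ val f z < val f x with hU
    have hUp : Pr U ≤ 1 / 2 := by
      by_cases hD : (univ.filter fun z => (¬ x ≤ z ∧ ¬ z ≤ x) ∧ y < z).Nonempty
      · obtain ⟨z, hz, hmin⟩ := least _ (fun z hz => (mem_filter.1 hz).2.1) hD
        have hz' := (mem_filter.1 hz).2
        have h1 : Pr U ≤ prLT z x := Pr_mono fun f ⟨w, hw, hyw, hf⟩ =>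
          (LinExt.val_le_val (hmin w (by simp [hw, hyw]))).trans_lt hf
        refine h1.trans (le_of_not_ge fun h => ?_)
        exact hz'.2.not_ge (hy.le_of_ge (mem_filter.2 ⟨mem_univ _, hz'.1, h⟩) hz'.2.le)
      · have h1 : Pr U ≤ Pr (fun _ : LinExt β => False) := Pr_mono fun f ⟨w, hw, hyw, hf⟩ =>
          hD ⟨w, by simp [hw, hyw]⟩
        have h2 : Pr (fun _ : LinExt β => False) = 0 := by simp [Pr]
        linarith
    have hBq : Pr (fun f : LinExt β => val f y < val f x ∧ ¬ U f) ≤ qVal x := by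
      refine Pr_le_qVal (fun w => w < x ∨ (¬ x ≤ w ∧ ¬ w ≤ x) ∧ w ≤ y) fun f ⟨hf, hfU⟩ w => ?_
      constructor
      · intro hw
        by_cases hwx : w ≤ x
        · exact Or.inl (hwx.lt_of_ne (by rintro rfl; exact lt_irrefl _ hw))
        · have hxw : ¬ x ≤ w := fun h => hx_lt f w h hw
          refine Or.inr ⟨⟨hxw, hwx⟩, ?_⟩
          by_contra hwy
          have hyw := (chain w y hxw hwx hy1 hy2).resolve_left hwy
          exact hfU ⟨w, ⟨hxw, hwx⟩, lt_of_le_not_ge hyw hwy, hw⟩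
      · rintro (h | ⟨-, h⟩)
        · exact hlt_x f w h
        · exact (LinExt.val_le_val h).trans_lt hf
    have hsplit : prLT y x ≤ Pr (fun f : LinExt β => val f y < val f x ∧ ¬ U f) + Pr U :=
      (Pr_mono fun f hf => by by_cases h : U f <;> simp [h, hf]).trans (Pr_or_le _ _)
    have hyx : y ≠ x := fun h => hy2 h.le
    have hq := (Pr_nonneg _).trans hBq
    have hone := one_le_prLT_add_prLT hyx
    exact ⟨y, hyx, le_min (by linarith) (by linarith)⟩
  · push Not at hA
    obtain ⟨y, hyC, hmin⟩ := least (univ.filter fun y => ¬ x ≤ y ∧ ¬ y ≤ x)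
      (fun z hz => (mem_filter.1 hz).2) (by obtain ⟨y, hy⟩ := hinc; exact ⟨y, by simpa using hy⟩)
    have hy := (mem_filter.1 hyC).2
    have hyx : y ≠ x := fun h => hy.2 h.le
    have hq : prLT x y ≤ qVal x := by
      refine Pr_le_qVal (fun w => w < x) fun f hf w => ⟨fun hw => ?_, hlt_x f w⟩
      by_cases hwx : w ≤ x
      · exact hwx.lt_of_ne (by rintro rfl; exact lt_irrefl _ hw)
      · have hxw : ¬ x ≤ w := fun h => hx_lt f w h hw
        have := LinExt.val_le_val (f := f) (hmin w (by simp [hxw, hwx]))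
        omega
    have hone := one_le_prLT_add_prLT hyx
    have hp := hA y hy
    have h0 : 0 ≤ prLT x y := Pr_nonneg _
    have h0' : 0 ≤ prLT y x := Pr_nonneg _
    exact ⟨y, hyx, le_min (by linarith) (by linarith)⟩
end

section
/- For every μ > 0 and every real L there exists K such that: for every finite poset P, if (A,B) is a maximal μ-pair in P with |B| ≥ max{μ|A|, K}, then Σ_{x∈A} σ(x)² ≥ L·|A|. -/
open Finset

/-- an incomparable pair of subsets of a poset -/
def IncompPair {β : Type} [Fintype β] [PartialOrder β] (A B : Finset β) : Prop :=
  Disjoint A B ∧ ∀ a ∈ A, ∀ b ∈ B, ¬ a ≤ b ∧ ¬ b ≤ a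

section SwapFamilies

variable {α : Type*}

/-- Exchange the positions `t` and `t + 1` in a placement `f`. -/
def transpose (t : ℤ) (f : α → ℤ) : α → ℤ := fun a => Equiv.swap t (t + 1) (f a)

/-- Position `t` is occupied by an element of `E`; negative positions count as occupied by `E`. -/
def IsLow (E : Set α) (f : α → ℤ) (t : ℤ) : Prop := t < 0 ∨ ∃ e ∈ E, f e = t

open Classical in
/-- The indicator of `IsLow`. -/
noncomputable def letter (E : Set α) (f : α → ℤ) (t : ℤ) : ℝ := if IsLow E f t then 1 else 0

open Classical in
/-- The indicator that `t`, `t + 1` are occupied by `E` and `Eᶜ` in this order and that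
exchanging them leaves `Ω`. -/
noncomputable def blocked (Ω : Finset (α → ℤ)) (E : Set α) (f : α → ℤ) (t : ℤ) : ℝ :=
  if IsLow E f t ∧ ¬ IsLow E f (t + 1) ∧ transpose t f ∉ Ω then 1 else 0

/-- A family of bijective placements of `α` on `{0, …, n - 1}` which is closed under moving an
element of `E` one step down past an element of `Eᶜ`. -/
structure SwapFamily (Ω : Finset (α → ℤ)) (E : Set α) (n : ℤ) : Prop where
  pos : 0 < n
  inj : ∀ f ∈ Ω, Function.Injective f
  exists_apply_eq_iff : ∀ f ∈ Ω, ∀ t, (∃ a, f a = t) ↔ 0 ≤ t ∧ t < n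
  swap : ∀ f ∈ Ω, ∀ c, c ∉ E → ∀ e ∈ E, f e = f c + 1 → transpose (f c) f ∈ Ω

theorem transpose_transpose (t : ℤ) (f : α → ℤ) : transpose t (transpose t f) = f := by
  funext a; simp [transpose]

theorem transpose_apply_of_ne {t : ℤ} {f : α → ℤ} {a : α} (h₁ : f a ≠ t) (h₂ : f a ≠ t + 1) :
    transpose t f a = f a := Equiv.swap_apply_of_ne_of_ne h₁ h₂

theorem isLow_transpose {E : Set α} {f : α → ℤ} {t : ℤ} (ht : 0 ≤ t) (s : ℤ) :
    IsLow E (transpose t f) s ↔ IsLow E f (Equiv.swap t (t + 1) s) := by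
  have h : Equiv.swap t (t + 1) s < 0 ↔ s < 0 := by
    rw [Equiv.swap_apply_def]; split_ifs <;> omega
  unfold IsLow
  rw [h]
  refine or_congr Iff.rfl (exists_congr fun e => and_congr Iff.rfl ?_)
  exact Equiv.swap_apply_eq_iff

theorem letter_nonneg (E : Set α) (f : α → ℤ) (t : ℤ) : 0 ≤ letter E f t := by
  unfold letter; split_ifs <;> norm_num

theorem letter_le_one (E : Set α) (f : α → ℤ) (t : ℤ) : letter E f t ≤ 1 := by
  unfold letter; split_ifs <;> norm_num

theorem letter_congr {E : Set α} {f g : α → ℤ} {s t : ℤ} (h : IsLow E f s ↔ IsLow E g t) :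
    letter E f s = letter E g t := by
  unfold letter
  by_cases hs : IsLow E f s
  · rw [if_pos hs, if_pos (h.1 hs)]
  · rw [if_neg hs, if_neg (mt h.2 hs)]

variable {Ω : Finset (α → ℤ)} {E : Set α} {n : ℤ}

theorem blocked_nonneg (f : α → ℤ) (t : ℤ) : 0 ≤ blocked Ω E f t := by
  unfold blocked; split_ifs <;> norm_num

theorem blocked_le_one (f : α → ℤ) (t : ℤ) : blocked Ω E f t ≤ 1 := by
  unfold blocked; split_ifs <;> norm_num

namespace SwapFamily

theorem transpose_mem (hΩ : SwapFamily Ω E n) {f : α → ℤ} (hf : f ∈ Ω) {t : ℤ}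
    (h₁ : ¬ IsLow E f t) (h₂ : IsLow E f (t + 1)) : 0 ≤ t ∧ transpose t f ∈ Ω := by
  unfold IsLow at h₁ h₂
  push Not at h₁
  obtain ⟨h₀, h₁⟩ := h₁
  obtain h₂ | ⟨e, he, h₂⟩ := h₂
  · omega
  have := (hΩ.exists_apply_eq_iff f hf (t + 1)).1 ⟨e, h₂⟩
  obtain ⟨c, hc⟩ := (hΩ.exists_apply_eq_iff f hf t).2 ⟨h₀, by omega⟩
  refine ⟨h₀, hc ▸ hΩ.swap f hf c (fun h => h₁ c h hc) e he (by omega)⟩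

theorem nonneg_of_transpose_mem (hΩ : SwapFamily Ω E n) {f : α → ℤ} (hf : f ∈ Ω) {t : ℤ}
    (h₂ : ¬ IsLow E f (t + 1)) (h : transpose t f ∈ Ω) : 0 ≤ t := by
  by_contra! ht
  have h0 : t + 1 = 0 := by
    unfold IsLow at h₂
    push Not at h₂
    omega
  obtain ⟨a, ha⟩ := (hΩ.exists_apply_eq_iff f hf 0).2 ⟨le_rfl, hΩ.pos⟩
  have h3 := (hΩ.exists_apply_eq_iff _ h (transpose t f a)).1 ⟨a, rfl⟩
  have : transpose t f a = t := by
    unfold transpose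
    rw [ha, ← h0, Equiv.swap_apply_right]
  omega

open Classical in
theorem sum_exchange (hΩ : SwapFamily Ω E n) (p q : (α → ℤ) → ℤ) (F : (α → ℤ) → ℝ)
    (hp : ∀ f ∈ Ω, q (transpose (p f) f) = p f) (hq : ∀ f ∈ Ω, p (transpose (q f) f) = q f) :
    ∑ f ∈ Ω with (¬ IsLow E f (p f) ∧ IsLow E f (p f + 1)), F (transpose (p f) f) =
      ∑ f ∈ Ω with (IsLow E f (q f) ∧ ¬ IsLow E f (q f + 1) ∧ transpose (q f) f ∈ Ω), F f := by
  refine Finset.sum_nbij' (fun f => transpose (p f) f) (fun f => transpose (q f) f) ?_ ?_ ?_ ?_ ?_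
  · intro f hf
    rw [Finset.mem_filter] at hf ⊢
    obtain ⟨hf, h₁, h₂⟩ := hf
    obtain ⟨h₀, hm⟩ := hΩ.transpose_mem hf h₁ h₂
    rw [hp f hf, transpose_transpose, isLow_transpose h₀, isLow_transpose h₀,
      Equiv.swap_apply_left, Equiv.swap_apply_right]
    exact ⟨hm, h₂, h₁, hf⟩
  · intro f hf
    rw [Finset.mem_filter] at hf ⊢
    obtain ⟨hf, h₁, h₂, hm⟩ := hf
    have h₀ := hΩ.nonneg_of_transpose_mem hf h₂ hm
    rw [hq f hf, isLow_transpose h₀, isLow_transpose h₀,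
      Equiv.swap_apply_left, Equiv.swap_apply_right]
    exact ⟨hm, h₂, h₁⟩
  · intro f hf
    rw [Finset.mem_filter] at hf
    simp only [hp f hf.1, transpose_transpose]
  · intro f hf
    rw [Finset.mem_filter] at hf
    simp only [hq f hf.1, transpose_transpose]
  · intro f _; rfl

/-- Summing an invariant function against the discrepancy of the letters at two adjacent
positions only sees the blocked placements. -/
theorem sum_mul_letter_sub (hΩ : SwapFamily Ω E n) (p : (α → ℤ) → ℤ) (F : (α → ℤ) → ℝ)
    (hp : ∀ f ∈ Ω, p (transpose (p f) f) = p f)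
    (hF : ∀ f ∈ Ω, 0 ≤ p f → F (transpose (p f) f) = F f) :
    ∑ f ∈ Ω, F f * (letter E f (p f) - letter E f (p f + 1) - blocked Ω E f (p f)) = 0 := by
  classical
  have key := hΩ.sum_exchange p p F hp hp
  rw [Finset.sum_congr (g := F) rfl (fun f hf => by
    rw [Finset.mem_filter] at hf
    exact hF f hf.1 (hΩ.transpose_mem hf.1 hf.2.1 hf.2.2).1), Finset.sum_filter,
    Finset.sum_filter, ← sub_eq_zero, ← Finset.sum_sub_distrib] at key
  rw [← neg_eq_zero, ← Finset.sum_neg_distrib, ← key]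
  refine Finset.sum_congr rfl fun f _ => ?_
  unfold letter blocked
  by_cases h₁ : IsLow E f (p f) <;> by_cases h₂ : IsLow E f (p f + 1) <;>
    by_cases h₃ : transpose (p f) f ∈ Ω <;> simp [h₁, h₂, h₃]

theorem nonneg (hΩ : SwapFamily Ω E n) {f : α → ℤ} (hf : f ∈ Ω) (a : α) : 0 ≤ f a :=
  ((hΩ.exists_apply_eq_iff f hf _).1 ⟨a, rfl⟩).1

theorem lt (hΩ : SwapFamily Ω E n) {f : α → ℤ} (hf : f ∈ Ω) (a : α) : f a < n :=
  ((hΩ.exists_apply_eq_iff f hf _).1 ⟨a, rfl⟩).2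

theorem not_isLow (hΩ : SwapFamily Ω E n) {f : α → ℤ} (hf : f ∈ Ω) {x : α} (hx : x ∉ E) :
    ¬ IsLow E f (f x) := by
  rintro (h | ⟨e, he, h⟩)
  · exact absurd (hΩ.nonneg hf x) (not_le.2 h)
  · exact hx (hΩ.inj f hf h ▸ he)

/-- Moving `x` one step up past an element of `E`. -/
theorem sum_mul_letter_pred (hΩ : SwapFamily Ω E n) {x : α} (hx : x ∉ E) (F : (α → ℤ) → ℝ) :
    ∑ f ∈ Ω, F f * (letter E f (f x - 1) - blocked Ω E f (f x - 1)) =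
      ∑ f ∈ Ω, F (transpose (f x) f) * letter E f (f x + 1) := by
  classical
  have key := hΩ.sum_exchange (fun f => f x) (fun f => f x - 1) F
    (fun f hf => by simp [transpose]) (fun f hf => by
      have := Equiv.swap_apply_right (f x - 1) (f x - 1 + 1)
      simp only [transpose]
      rw [sub_add_cancel] at this ⊢
      exact this)
  rw [Finset.sum_filter, Finset.sum_filter] at key
  refine Eq.trans (Finset.sum_congr rfl fun f hf => ?_)
    (key.symm.trans (Finset.sum_congr rfl fun f hf => ?_))
  · have := hΩ.not_isLow hf hx
    unfold letter blocked
    rw [sub_add_cancel]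
    by_cases h₁ : IsLow E f (f x - 1) <;>
      by_cases h₃ : transpose (f x - 1) f ∈ Ω <;> simp [h₁, this, h₃]
  · have := hΩ.not_isLow hf hx
    unfold letter
    by_cases h₁ : IsLow E f (f x + 1) <;> simp [h₁, this]

/-- The total blocking probability over all positions is at most one. -/
theorem sum_sum_blocked_le (hΩ : SwapFamily Ω E n) (A : Finset α) (s : ℤ) :
    ∑ x ∈ A, ∑ f ∈ Ω, blocked Ω E f (f x + s) ≤ Ω.card := by
  classical
  obtain ⟨N, hN⟩ : ∃ N : ℕ, n = N := ⟨n.toNat, by have := hΩ.pos; omega⟩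
  have h₁ : ∀ f ∈ Ω, ∑ x ∈ A, blocked Ω E f (f x + s) ≤
      ∑ i ∈ Finset.range (N + 1), blocked Ω E f ((i : ℤ) - 1) := by
    intro f hf
    rw [← Finset.sum_image (s := A) (g := fun x => f x + s) (f := fun t => blocked Ω E f t)
      (fun a _ b _ h => hΩ.inj f hf (by simpa using h)),
      ← Finset.sum_image (s := Finset.range (N + 1)) (g := fun i : ℕ => (i : ℤ) - 1)
      (f := fun t => blocked Ω E f t) (fun a _ b _ h => by simpa using h)]
    rw [← Finset.sum_filter_ne_zero]
    refine Finset.sum_le_sum_of_subset_of_nonneg (fun t ht => ?_) fun t _ _ => blocked_nonneg f t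
    replace ht := (Finset.mem_filter.1 ht).2
    have h2 : IsLow E f t ∧ ¬ IsLow E f (t + 1) := by
      by_contra hc
      exact ht (if_neg (fun h => hc ⟨h.1, h.2.1⟩))
    rw [Finset.mem_image]
    have h3 : 0 ≤ t + 1 := by
      by_contra h
      exact h2.2 (Or.inl (by omega))
    refine ⟨(t + 1).toNat, ?_, by omega⟩
    rw [Finset.mem_range]
    rcases h2.1 with h | ⟨e, -, h⟩
    · omega
    · have := hΩ.lt hf e
      omega
  rw [Finset.sum_comm]
  refine (Finset.sum_le_sum h₁).trans ?_
  rw [Finset.sum_comm]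
  have h₂ : ∀ i : ℕ, ∑ f ∈ Ω, blocked Ω E f ((i : ℤ) - 1) =
      ∑ f ∈ Ω, letter E f ((i : ℤ) - 1) - ∑ f ∈ Ω, letter E f (((i + 1 : ℕ) : ℤ) - 1) := by
    intro i
    have := hΩ.sum_mul_letter_sub (fun _ => (i : ℤ) - 1) (fun _ => 1) (fun _ _ => rfl)
      (fun _ _ _ => rfl)
    simp only [one_mul, Finset.sum_sub_distrib] at this
    push_cast
    rw [show (i : ℤ) + 1 - 1 = (i : ℤ) - 1 + 1 by ring]
    linarith
  simp only [h₂]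
  rw [Finset.sum_range_sub' (fun i : ℕ => ∑ f ∈ Ω, letter E f ((i : ℤ) - 1))]
  have h₃ : ∑ f ∈ Ω, letter E f (((0 : ℕ) : ℤ) - 1) ≤ Ω.card := by
    refine (Finset.sum_le_sum fun f _ => letter_le_one E f _).trans ?_
    simp
  have h₄ : 0 ≤ ∑ f ∈ Ω, letter E f (((N + 1 : ℕ) : ℤ) - 1) :=
    Finset.sum_nonneg fun f _ => letter_nonneg E f _
  linarith

end SwapFamily

/-- The `k`-th position relative to `x`, skipping the position of `x` itself. -/
def skip (k : ℤ) : ℤ := if 1 ≤ k then k else k - 1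

/-- The letter at the `k`-th position relative to `x`. -/
noncomputable def near (E : Set α) (x : α) (k : ℤ) (f : α → ℤ) : ℝ := letter E f (f x + skip k)

/-- The indicator of being blocked at the `k`-th position relative to `x`. -/
noncomputable def nearBlocked (Ω : Finset (α → ℤ)) (E : Set α) (x : α) (k : ℤ) (f : α → ℤ) : ℝ :=
  blocked Ω E f (f x + skip k)

/-- The discrepancy of two adjacent letters near `x`, corrected by the blocked placements. -/
noncomputable def defect (Ω : Finset (α → ℤ)) (E : Set α) (x : α) (k : ℤ) (f : α → ℤ) : ℝ :=
  near E x k f - near E x (k + 1) f - nearBlocked Ω E x k f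

theorem skip_add_one {k : ℤ} (hk : k ≠ 0) : skip (k + 1) = skip k + 1 := by
  unfold skip; split_ifs <;> omega

theorem skip_ne_zero (k : ℤ) : skip k ≠ 0 := by
  unfold skip; split_ifs <;> omega

theorem skip_injective : Function.Injective skip := by
  intro i j h
  unfold skip at h
  split_ifs at h <;> omega

theorem near_nonneg (x : α) (k : ℤ) (f : α → ℤ) : 0 ≤ near E x k f := letter_nonneg _ _ _

theorem near_le_one (x : α) (k : ℤ) (f : α → ℤ) : near E x k f ≤ 1 := letter_le_one _ _ _

theorem nearBlocked_nonneg (x : α) (k : ℤ) (f : α → ℤ) : 0 ≤ nearBlocked Ω E x k f :=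
  blocked_nonneg _ _

theorem nearBlocked_le_one (x : α) (k : ℤ) (f : α → ℤ) : nearBlocked Ω E x k f ≤ 1 :=
  blocked_le_one _ _

theorem transpose_skip_apply {k : ℤ} (hk : k ≠ 0) (x : α) (f : α → ℤ) :
    transpose (f x + skip k) f x = f x := by
  have h₁ := skip_ne_zero k
  have h₂ := skip_ne_zero (k + 1)
  rw [skip_add_one hk] at h₂
  exact transpose_apply_of_ne (by omega) (by omega)

theorem near_transpose_skip {i k : ℤ} (hk : k ≠ 0) (h₁ : i ≠ k) (h₂ : i ≠ k + 1) {x : α}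
    {f : α → ℤ} (h : 0 ≤ f x + skip k) :
    near E x i (transpose (f x + skip k) f) = near E x i f := by
  unfold near
  rw [transpose_skip_apply hk]
  refine letter_congr ((isLow_transpose h _).trans ?_)
  have h₁ := skip_injective.ne h₁
  have h₂ := skip_injective.ne h₂
  rw [skip_add_one hk] at h₂
  rw [Equiv.swap_apply_of_ne_of_ne (by omega) (by omega)]

theorem near_transpose_self {i : ℤ} (hi : i ≠ 0) {x : α} {f : α → ℤ} (h : 0 ≤ f x) :
    near E x i (transpose (f x) f) = near E x (i + 1) f := by
  unfold near
  have h₀ : transpose (f x) f x = f x + 1 := Equiv.swap_apply_left _ _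
  rw [h₀]
  refine letter_congr ((isLow_transpose h _).trans ?_)
  have h₁ := skip_ne_zero i
  have h₂ := skip_ne_zero (i + 1)
  rw [skip_add_one hi] at h₂ ⊢
  rw [Equiv.swap_apply_of_ne_of_ne (by omega) (by omega), add_assoc, add_comm 1]

namespace SwapFamily

theorem sum_mul_near_sub (hΩ : SwapFamily Ω E n) {k : ℤ} (hk : k ≠ 0) (x : α) (F : (α → ℤ) → ℝ)
    (hF : ∀ f ∈ Ω, 0 ≤ f x + skip k → F (transpose (f x + skip k) f) = F f) :
    ∑ f ∈ Ω, F f * (near E x k f - near E x (k + 1) f - nearBlocked Ω E x k f) = 0 := by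
  have := hΩ.sum_mul_letter_sub (fun f => f x + skip k) F
    (fun f _ => by rw [transpose_skip_apply hk]) hF
  simpa only [near, nearBlocked, skip_add_one hk, add_assoc] using this

theorem sum_mul_near_zero (hΩ : SwapFamily Ω E n) {x : α} (hx : x ∉ E) (F : (α → ℤ) → ℝ) :
    ∑ f ∈ Ω, F f * (near E x 0 f - nearBlocked Ω E x 0 f) =
      ∑ f ∈ Ω, F (transpose (f x) f) * near E x 1 f :=
  hΩ.sum_mul_letter_pred hx F

theorem abs_sum_mul_near_sub_le (hΩ : SwapFamily Ω E n) {i k : ℤ} (hk : k ≠ 0) (h₁ : i ≠ k)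
    (h₂ : i ≠ k + 1) (x : α) :
    |∑ f ∈ Ω, near E x i f * near E x k f - ∑ f ∈ Ω, near E x i f * near E x (k + 1) f| ≤
      ∑ f ∈ Ω, nearBlocked Ω E x k f := by
  have h := hΩ.sum_mul_near_sub hk x (near E x i) fun f _ hf => near_transpose_skip hk h₁ h₂ hf
  simp only [mul_sub, Finset.sum_sub_distrib] at h
  have h0 : 0 ≤ ∑ f ∈ Ω, near E x i f * nearBlocked Ω E x k f :=
    Finset.sum_nonneg fun f _ => mul_nonneg (near_nonneg _ _ _) (nearBlocked_nonneg _ _ _)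
  have h1 : ∑ f ∈ Ω, near E x i f * nearBlocked Ω E x k f ≤ ∑ f ∈ Ω, nearBlocked Ω E x k f :=
    Finset.sum_le_sum fun f _ =>
      mul_le_of_le_one_left (nearBlocked_nonneg _ _ _) (near_le_one _ _ _)
  rw [abs_le]
  constructor <;> linarith

theorem abs_sum_mul_near_zero_sub_le (hΩ : SwapFamily Ω E n) {i : ℤ} (hi : i ≠ 0)
    {x : α} (hx : x ∉ E) :
    |∑ f ∈ Ω, near E x i f * near E x 0 f - ∑ f ∈ Ω, near E x (i + 1) f * near E x 1 f| ≤
      ∑ f ∈ Ω, nearBlocked Ω E x 0 f := by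
  have h := hΩ.sum_mul_near_zero hx (near E x i)
  have h' : ∑ f ∈ Ω, near E x i (transpose (f x) f) * near E x 1 f =
      ∑ f ∈ Ω, near E x (i + 1) f * near E x 1 f :=
    Finset.sum_congr rfl fun f hf => by rw [near_transpose_self hi (hΩ.nonneg hf x)]
  rw [← h', ← h]
  simp only [mul_sub, Finset.sum_sub_distrib]
  have h0 : 0 ≤ ∑ f ∈ Ω, near E x i f * nearBlocked Ω E x 0 f :=
    Finset.sum_nonneg fun f _ => mul_nonneg (near_nonneg _ _ _) (nearBlocked_nonneg _ _ _)
  have h1 : ∑ f ∈ Ω, near E x i f * nearBlocked Ω E x 0 f ≤ ∑ f ∈ Ω, nearBlocked Ω E x 0 f :=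
    Finset.sum_le_sum fun f _ =>
      mul_le_of_le_one_left (nearBlocked_nonneg _ _ _) (near_le_one _ _ _)
  rw [abs_le]
  constructor <;> linarith

/-- Moving one of two letters near `x` by one position hardly changes their correlation. -/
theorem abs_sum_near_mul_near_succ_le (hΩ : SwapFamily Ω E n) {x : α} (hx : x ∉ E) {i k : ℤ}
    (h₁ : i ≠ k) (h₂ : i ≠ k + 1) {η : ℝ} (hi : ∑ f ∈ Ω, nearBlocked Ω E x i f ≤ η)
    (hk : ∑ f ∈ Ω, nearBlocked Ω E x k f ≤ η) :
    |∑ f ∈ Ω, near E x i f * near E x k f - ∑ f ∈ Ω, near E x i f * near E x (k + 1) f| ≤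
      2 * η := by
  have h0 : 0 ≤ ∑ f ∈ Ω, nearBlocked Ω E x k f :=
    Finset.sum_nonneg fun f _ => nearBlocked_nonneg _ _ _
  by_cases hk0 : k = 0
  · subst hk0
    have a1 := hΩ.abs_sum_mul_near_zero_sub_le h₁ hx
    have a2 := hΩ.abs_sum_mul_near_sub_le (i := 1) h₁ (by omega) (by omega) x
    simp only [zero_add, mul_comm (near E x 1 _)] at a2 ⊢
    rw [abs_le] at a1 a2 ⊢
    constructor <;> linarith
  · have := hΩ.abs_sum_mul_near_sub_le hk0 h₁ h₂ x
    linarith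

/-- Correlations of pairs of letters near `x` are almost constant. -/
theorem abs_sum_near_mul_near_sub_le (hΩ : SwapFamily Ω E n) {x : α} (hx : x ∉ E) {w : ℕ}
    {η : ℝ} (hη : ∀ k : ℤ, -w ≤ k → k ≤ w + 1 → ∑ f ∈ Ω, nearBlocked Ω E x k f ≤ η)
    {i j : ℤ} (hi : -w ≤ i) (hi' : i ≤ w) (hj : -w ≤ j) (hj' : j ≤ w) (hij : i ≠ j) :
    |∑ f ∈ Ω, near E x i f * near E x j f - ∑ f ∈ Ω, near E x w f * near E x (w + 1) f| ≤
      (8 * w + 2) * η := by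
  wlog hlt : i < j generalizing i j
  · have := this hj hj' hi hi' hij.symm (by omega)
    simpa only [mul_comm (near E x j _)] using this
  have η0 : 0 ≤ η := (Finset.sum_nonneg fun f _ => nearBlocked_nonneg x 0 f).trans
    (hη 0 (by omega) (by omega))
  have up : ∀ d : ℕ, j + d ≤ w + 1 → |∑ f ∈ Ω, near E x i f * near E x j f -
      ∑ f ∈ Ω, near E x i f * near E x (j + d) f| ≤ d * (2 * η) := by
    intro d
    induction d with
    | zero => intro; simp
    | succ d ih =>
      intro hd
      push_cast at hd ⊢
      have h := ih (by omega)
      have h' := hΩ.abs_sum_near_mul_near_succ_le hx (i := i) (k := j + d) (by omega) (by omega)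
        (hη i (by omega) (by omega)) (hη _ (by omega) (by omega))
      rw [← add_assoc]
      refine (abs_sub_le _ _ _).trans ((add_le_add h h').trans_eq (by ring))
  have up' : ∀ d : ℕ, i + d ≤ w → |∑ f ∈ Ω, near E x i f * near E x (w + 1) f -
      ∑ f ∈ Ω, near E x (i + d) f * near E x (w + 1) f| ≤ d * (2 * η) := by
    intro d
    induction d with
    | zero => intro; simp
    | succ d ih =>
      intro hd
      push_cast at hd ⊢
      have h := ih (by omega)
      have h' := hΩ.abs_sum_near_mul_near_succ_le hx (i := w + 1) (k := i + d) (by omega)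
        (by omega) (hη _ (by omega) (by omega)) (hη _ (by omega) (by omega))
      simp only [mul_comm (near E x (w + 1) _)] at h'
      rw [← add_assoc]
      refine (abs_sub_le _ _ _).trans ((add_le_add h h').trans_eq (by ring))
  obtain ⟨d, hd⟩ : ∃ d : ℕ, j + d = w + 1 := ⟨(w + 1 - j).toNat, by omega⟩
  obtain ⟨e, he⟩ : ∃ e : ℕ, i + e = w := ⟨(w - i).toNat, by omega⟩
  have h1 := up d hd.le
  have h2 := up' e he.le
  rw [hd] at h1
  rw [he] at h2
  refine (abs_sub_le _ _ _).trans ((add_le_add h1 h2).trans ?_)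
  have : (d : ℝ) + e ≤ 4 * w + 1 := by
    have : d + e ≤ 4 * w + 1 := by omega
    exact_mod_cast this
  nlinarith

theorem sum_sub_mul_defect (hΩ : SwapFamily Ω E n) {x : α} (hx : x ∉ E) (h : ℝ) (k : ℤ) :
    ∑ f ∈ Ω, ((f x : ℝ) - h) * defect Ω E x k f =
      if k = 0 then ∑ f ∈ Ω, near E x 1 f else 0 := by
  split_ifs with hk
  · subst hk
    have := hΩ.sum_mul_near_zero hx fun f => (f x : ℝ) - h
    have h₀ : ∀ f : α → ℤ, transpose (f x) f x = f x + 1 := fun f => Equiv.swap_apply_left _ _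
    simp only [h₀] at this
    push_cast at this
    rw [← sub_eq_zero, ← Finset.sum_sub_distrib] at this ⊢
    rw [← this]
    refine Finset.sum_congr rfl fun f _ => ?_
    simp only [defect, zero_add]
    ring
  · exact hΩ.sum_mul_near_sub hk x _ fun f _ _ => by rw [transpose_skip_apply hk]

theorem sum_defect (x : α) (w : ℕ) (f : α → ℤ) :
    ∑ k ∈ Finset.range w, ∑ i ∈ Finset.range (2 * k + 1), defect Ω E x (i - k) f =
      ∑ k ∈ Finset.range w, (near E x (-k) f - near E x (k + 1) f) -
        ∑ k ∈ Finset.range w, ∑ i ∈ Finset.range (2 * k + 1), nearBlocked Ω E x (i - k) f := by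
  rw [← Finset.sum_sub_distrib]
  refine Finset.sum_congr rfl fun k _ => ?_
  have := Finset.sum_range_sub' (fun i : ℕ => near E x ((i : ℤ) - k) f) (2 * k + 1)
  unfold defect
  rw [Finset.sum_sub_distrib, Finset.sum_congr rfl fun i _ => by
    rw [show (i : ℤ) - k + 1 = ((i + 1 : ℕ) : ℤ) - k by push_cast; ring], this]
  congr 4 <;> push_cast <;> ring

theorem sum_sum_near_sub_sq_le (hΩ : SwapFamily Ω E n) {x : α} (hx : x ∉ E) {w : ℕ}
    {η : ℝ} (hη : ∀ k : ℤ, -w ≤ k → k ≤ w + 1 → ∑ f ∈ Ω, nearBlocked Ω E x k f ≤ η) :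
    ∑ f ∈ Ω, (∑ k ∈ Finset.range w, (near E x (-k) f - near E x (k + 1) f)) ^ 2 ≤
      w * Ω.card + w ^ 2 * (4 * ((8 * w + 2) * η)) := by
  have η0 : 0 ≤ η := (Finset.sum_nonneg fun f _ => nearBlocked_nonneg x 0 f).trans
    (hη 0 (by omega) (by omega))
  simp only [sq, Finset.sum_mul_sum]
  rw [Finset.sum_comm]
  have key : ∀ i ∈ Finset.range w, ∀ j ∈ Finset.range w,
      ∑ f ∈ Ω, (near E x (-i) f - near E x (i + 1) f) * (near E x (-j) f - near E x (j + 1) f) ≤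
        (if i = j then (Ω.card : ℝ) else 0) + 4 * ((8 * w + 2) * η) := by
    intro i hi j hj
    rw [Finset.mem_range] at hi hj
    split_ifs with hij
    · have : ∑ f ∈ Ω, (near E x (-i) f - near E x (i + 1) f) *
          (near E x (-j) f - near E x (j + 1) f) ≤ ∑ f ∈ Ω, 1 := by
        refine Finset.sum_le_sum fun f _ => ?_
        subst hij
        have a1 := near_nonneg (E := E) x (-i) f
        have a2 := near_nonneg (E := E) x (i + 1) f
        have a3 := near_le_one (E := E) x (-i) f
        have a4 := near_le_one (E := E) x (i + 1) f
        nlinarith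
      have h2 : 0 ≤ 4 * ((8 * w + 2) * η) := by positivity
      simp only [Finset.sum_const, nsmul_eq_mul, mul_one] at this
      linarith
    · have b1 := hΩ.abs_sum_near_mul_near_sub_le hx hη (i := -i) (j := -j)
        (by omega) (by omega) (by omega) (by omega) (by omega)
      have b2 := hΩ.abs_sum_near_mul_near_sub_le hx hη (i := -i) (j := j + 1)
        (by omega) (by omega) (by omega) (by omega) (by omega)
      have b3 := hΩ.abs_sum_near_mul_near_sub_le hx hη (i := i + 1) (j := -j)
        (by omega) (by omega) (by omega) (by omega) (by omega)
      have b4 := hΩ.abs_sum_near_mul_near_sub_le hx hη (i := i + 1) (j := j + 1)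
        (by omega) (by omega) (by omega) (by omega) (by omega)
      simp only [mul_sub, sub_mul, Finset.sum_sub_distrib]
      rw [abs_le] at b1 b2 b3 b4
      linarith
  have := Finset.sum_le_sum fun i hi => Finset.sum_le_sum fun j hj => key i hi j hj
  refine le_trans (le_of_eq ?_) (this.trans (le_of_eq ?_))
  · exact Finset.sum_congr rfl fun i _ => Finset.sum_comm
  · simp only [Finset.sum_add_distrib, Finset.sum_ite_eq, Finset.sum_const, Finset.card_range,
      nsmul_eq_mul]
    rw [Finset.sum_ite_of_true (fun i hi => hi)]
    simp only [Finset.sum_const, Finset.card_range, nsmul_eq_mul]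
    ring

theorem sum_sum_nearBlocked_sq_le {x : α} {w : ℕ}
    {η : ℝ} (hη : ∀ k : ℤ, -w ≤ k → k ≤ w + 1 → ∑ f ∈ Ω, nearBlocked Ω E x k f ≤ η) :
    ∑ f ∈ Ω, (∑ k ∈ Finset.range w, ∑ i ∈ Finset.range (2 * k + 1),
      nearBlocked Ω E x (i - k) f) ^ 2 ≤ w ^ 4 * η := by
  have hw : ∑ k ∈ Finset.range w, ((2 * k + 1 : ℕ) : ℝ) = w ^ 2 := by
    clear hη
    induction w with
    | zero => simp
    | succ w ih => rw [Finset.sum_range_succ, ih]; push_cast; ring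
  have h1 : ∀ f ∈ Ω, (∑ k ∈ Finset.range w, ∑ i ∈ Finset.range (2 * k + 1),
      nearBlocked Ω E x (i - k) f) ^ 2 ≤ w ^ 2 * ∑ k ∈ Finset.range w,
        ∑ i ∈ Finset.range (2 * k + 1), nearBlocked Ω E x (i - k) f := by
    intro f _
    rw [sq]
    refine mul_le_mul_of_nonneg_right ?_ (Finset.sum_nonneg fun k _ => Finset.sum_nonneg
      fun i _ => nearBlocked_nonneg _ _ _)
    rw [← hw]
    refine Finset.sum_le_sum fun k _ => ?_
    refine (Finset.sum_le_sum fun i _ => nearBlocked_le_one _ _ _).trans ?_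
    simp
  refine (Finset.sum_le_sum h1).trans ?_
  rw [← Finset.mul_sum, show (w : ℝ) ^ 4 * η = w ^ 2 * (w ^ 2 * η) by ring]
  refine mul_le_mul_of_nonneg_left ?_ (by positivity)
  rw [← hw, Finset.sum_mul, Finset.sum_comm]
  refine Finset.sum_le_sum fun k hk => ?_
  rw [Finset.mem_range] at hk
  rw [Finset.sum_comm, ← nsmul_eq_mul, ← Finset.card_range (2 * k + 1), ← Finset.sum_const]
  rw [Finset.card_range]
  refine Finset.sum_le_sum fun i hi => ?_
  rw [Finset.mem_range] at hi
  exact hη _ (by omega) (by omega)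

/-- If few placements are blocked near `x`, the position of `x` fluctuates. -/
theorem le_sum_sub_sq (hΩ : SwapFamily Ω E n) {x : α} (hx : x ∉ E) {w : ℕ} (hw : 0 < w)
    (hη : ∀ k : ℤ, -w ≤ k → k ≤ w + 1 →
      50 * (w : ℝ) ^ 3 * ∑ f ∈ Ω, nearBlocked Ω E x k f ≤ (Ω.card : ℝ))
    {ε : ℝ} (hε : 0 ≤ ε) (h₁ : ε * Ω.card ≤ ∑ f ∈ Ω, near E x 1 f) (h : ℝ) :
    w * ε ^ 2 / 4 * Ω.card ≤ ∑ f ∈ Ω, ((f x : ℝ) - h) ^ 2 := by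
  obtain hN | hN := Nat.eq_zero_or_pos Ω.card
  · rw [hN]
    simpa using Finset.sum_nonneg fun f _ => sq_nonneg ((f x : ℝ) - h)
  have hN' : (0 : ℝ) < Ω.card := by exact_mod_cast hN
  have hw' : (1 : ℝ) ≤ w := by exact_mod_cast hw
  set N : ℝ := (Ω.card : ℝ) with hNdef
  obtain ⟨η, hηdef⟩ : ∃ η, η = N / (50 * (w : ℝ) ^ 3) := ⟨_, rfl⟩
  have hη' : ∀ k : ℤ, -w ≤ k → k ≤ w + 1 → ∑ f ∈ Ω, nearBlocked Ω E x k f ≤ η := by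
    intro k h1 h2
    rw [hηdef, le_div_iff₀ (by positivity), mul_comm]
    exact hη k h1 h2
  have hη1 : 50 * (w : ℝ) ^ 3 * η = N := by rw [hηdef]; field_simp
  have hη0 : 0 ≤ η := by rw [hηdef]; positivity
  set S : (α → ℤ) → ℝ := fun f => ∑ k ∈ Finset.range w, (near E x (-k) f - near E x (k + 1) f)
  set R : (α → ℤ) → ℝ := fun f =>
    ∑ k ∈ Finset.range w, ∑ i ∈ Finset.range (2 * k + 1), nearBlocked Ω E x (i - k) f
  have hS := hΩ.sum_sum_near_sub_sq_le hx hη'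
  have hR := sum_sum_nearBlocked_sq_le hη'
  have hD : ∑ f ∈ Ω, (S f - R f) ^ 2 ≤ 4 * w * N := by
    have : ∑ f ∈ Ω, (S f - R f) ^ 2 ≤ 2 * ∑ f ∈ Ω, S f ^ 2 + 2 * ∑ f ∈ Ω, R f ^ 2 := by
      rw [Finset.mul_sum, Finset.mul_sum, ← Finset.sum_add_distrib]
      exact Finset.sum_le_sum fun f _ => by nlinarith [sq_nonneg (S f + R f)]
    have e1 : (w : ℝ) ^ 2 * (4 * ((8 * w + 2) * η)) ≤ 40 * w ^ 3 * η * w := by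
      have : (8 * (w : ℝ) + 2) ≤ 10 * (w * w) := by nlinarith
      calc (w : ℝ) ^ 2 * (4 * ((8 * w + 2) * η)) = 4 * w ^ 2 * η * (8 * w + 2) := by ring
        _ ≤ 4 * w ^ 2 * η * (10 * (w * w)) := by gcongr
        _ = _ := by ring
    have e2 : (w : ℝ) ^ 4 * η = w ^ 3 * η * w := by ring
    have e3 : 50 * (w : ℝ) ^ 3 * η * w = w * N := by rw [hη1]; ring
    have e4 : 0 ≤ (w : ℝ) ^ 3 * η * w := by positivity
    nlinarith
  have hC : ∑ f ∈ Ω, ((f x : ℝ) - h) * (S f - R f) = w * ∑ f ∈ Ω, near E x 1 f := by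
    have : ∀ f, S f - R f =
        ∑ k ∈ Finset.range w, ∑ i ∈ Finset.range (2 * k + 1), defect Ω E x (i - k) f :=
      fun f => (sum_defect x w f).symm
    simp only [this, Finset.mul_sum]
    rw [Finset.sum_comm]
    have h2 : ∀ k ∈ Finset.range w, ∑ f ∈ Ω, ∑ i ∈ Finset.range (2 * k + 1),
        ((f x : ℝ) - h) * defect Ω E x (i - k) f = ∑ f ∈ Ω, near E x 1 f := by
      intro k _
      rw [Finset.sum_comm]
      simp only [hΩ.sum_sub_mul_defect hx, sub_eq_zero, Nat.cast_inj]
      rw [Finset.sum_ite_eq', if_pos]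
      rw [Finset.mem_range]
      omega
    rw [Finset.sum_congr rfl h2, Finset.sum_const, Finset.card_range, nsmul_eq_mul,
      Finset.mul_sum]
  have hCS := Finset.sum_mul_sq_le_sq_mul_sq Ω (fun f => (f x : ℝ) - h) (fun f => S f - R f)
  rw [hC] at hCS
  set V := ∑ f ∈ Ω, ((f x : ℝ) - h) ^ 2
  have hV : 0 ≤ V := Finset.sum_nonneg fun f _ => sq_nonneg _
  have h5 : (w * (ε * N)) ^ 2 ≤ V * (4 * w * N) := by
    refine le_trans ?_ (hCS.trans (mul_le_mul_of_nonneg_left hD hV))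
    gcongr
  have h6 : (w * N) * (w * ε ^ 2 / 4 * N) ≤ (w * N) * V := by nlinarith
  exact le_of_mul_le_mul_left h6 (by positivity)

end SwapFamily

/-- The indicator that at least half of `B` is placed above `x`. -/
noncomputable def aboveInd (B : Finset α) (x : α) (f : α → ℤ) : ℝ :=
  if B.card ≤ 2 * (B.filter fun b => f x < f b).card then 1 else 0

theorem aboveInd_nonneg (B : Finset α) (x : α) (f : α → ℤ) : 0 ≤ aboveInd B x f := by
  unfold aboveInd; split_ifs <;> norm_num

theorem aboveInd_le_one (B : Finset α) (x : α) (f : α → ℤ) : aboveInd B x f ≤ 1 := by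
  unfold aboveInd; split_ifs <;> norm_num

theorem aboveInd_transpose {k : ℤ} (hk : 1 ≤ k) (B : Finset α) (x : α) (f : α → ℤ) :
    aboveInd B x (transpose (f x + skip k) f) = aboveInd B x f := by
  have hs : skip k = k := if_pos hk
  unfold aboveInd
  rw [transpose_skip_apply (by omega)]
  have : ∀ b, f x < transpose (f x + skip k) f b ↔ f x < f b := by
    intro b
    rw [hs]
    unfold transpose
    rw [Equiv.swap_apply_def]
    split_ifs <;> omega
  simp only [this]

/-- The product of the letters at the `s` positions directly above `x`. -/
noncomputable def runInd (E : Set α) (x : α) (s : ℕ) (f : α → ℤ) : ℝ :=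
  ∏ k ∈ Finset.range s, near E x (k + 1) f

theorem runInd_nonneg (x : α) (s : ℕ) (f : α → ℤ) : 0 ≤ runInd E x s f :=
  Finset.prod_nonneg fun _ _ => near_nonneg _ _ _

theorem runInd_le_one (x : α) (s : ℕ) (f : α → ℤ) : runInd E x s f ≤ 1 :=
  Finset.prod_le_one (fun _ _ => near_nonneg _ _ _) fun _ _ => near_le_one _ _ _

theorem one_sub_sum_le_runInd (x : α) (s : ℕ) (f : α → ℤ) :
    1 - ∑ k ∈ Finset.range s, (1 - near E x (k + 1) f) ≤ runInd E x s f := by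
  induction s with
  | zero => simp [runInd]
  | succ s ih =>
    have h1 : runInd E x (s + 1) f = runInd E x s f * near E x (s + 1) f :=
      Finset.prod_range_succ _ _
    have h2 := near_nonneg (E := E) x (s + 1) f
    have h3 := near_le_one (E := E) x (s + 1) f
    have h4 := runInd_le_one (E := E) x s f
    rw [Finset.sum_range_succ, h1]
    nlinarith

namespace SwapFamily

theorem min_le_sum_near (hΩ : SwapFamily Ω E n) {x : α} {U B : Finset α}
    (hU : ∀ c, c ∉ E → c ∈ U) (hBE : ∀ b ∈ B, b ∈ E) (hB : 0 < B.card) {C : ℝ}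
    {f : α → ℤ} (hf : f ∈ Ω) (hC : ∀ t : ℤ, B.card ≤ 4 * (B.filter fun b => t < f b).card →
      ((U.filter fun c => f c ≤ t).card : ℝ) ≤ C)
    (hfx : B.card ≤ 2 * (B.filter fun b => f x < f b).card) (T : ℕ) :
    min ((B.card : ℝ) / 4) (T - C) ≤ ∑ k ∈ Finset.range T, near E x (k + 1) f := by
  classical
  have hnear : ∀ k : ℕ, near E x (k + 1) f = if IsLow E f (f x + (k + 1)) then 1 else 0 := by
    intro k
    unfold near letter
    rw [show skip ((k : ℤ) + 1) = k + 1 from if_pos (by omega)]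
  simp only [hnear]
  rw [Finset.sum_boole]
  by_cases ht : B.card ≤ 4 * (B.filter fun b => f x + T < f b).card
  · refine (min_le_right _ _).trans ?_
    have hcard := Finset.card_filter_add_card_filter_not (s := Finset.range T)
      (fun k : ℕ => IsLow E f (f x + (k + 1)))
    rw [Finset.card_range] at hcard
    obtain ⟨b, hb⟩ : (B.filter fun b => f x + T < f b).Nonempty := by
      rw [← Finset.card_pos]; omega
    rw [Finset.mem_filter] at hb
    have hbn := hΩ.lt hf b
    have hx0 := hΩ.nonneg hf x
    have hle : ((Finset.range T).filter fun k : ℕ => ¬ IsLow E f (f x + (k + 1))).card ≤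
        (U.filter fun c => f c ≤ f x + T).card := by
      refine Finset.card_le_card_of_surjOn (fun c => (f c - f x - 1).toNat) ?_
      intro k hk
      rw [Finset.mem_coe, Finset.mem_filter, Finset.mem_range] at hk
      obtain ⟨c, hc⟩ := (hΩ.exists_apply_eq_iff f hf (f x + (k + 1))).2 ⟨by omega, by omega⟩
      refine ⟨c, ?_, ?_⟩
      · rw [Finset.mem_coe, Finset.mem_filter]
        exact ⟨hU c fun hcE => hk.2 (Or.inr ⟨c, hcE, hc⟩), by omega⟩
      · show (f c - f x - 1).toNat = k
        omega
    have h1 := hC _ ht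
    have h2 : ((((Finset.range T).filter fun k : ℕ => ¬ IsLow E f (f x + (k + 1))).card : ℕ) : ℝ) ≤
      (U.filter fun c => f c ≤ f x + T).card := by exact_mod_cast hle
    have h3 : ((((Finset.range T).filter fun k : ℕ => IsLow E f (f x + (k + 1))).card : ℕ) : ℝ) +
      ((Finset.range T).filter fun k : ℕ => ¬ IsLow E f (f x + (k + 1))).card = T := by
      exact_mod_cast hcard
    linarith
  · refine (min_le_left _ _).trans ?_
    have hle : ((B.filter fun b => f x < f b) \ (B.filter fun b => f x + T < f b)).card ≤
        ((Finset.range T).filter fun k : ℕ => IsLow E f (f x + (k + 1))).card := by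
      refine Finset.card_le_card_of_injOn (fun b => (f b - f x - 1).toNat) ?_ ?_
      · intro b hb
        rw [Finset.mem_coe, Finset.mem_sdiff, Finset.mem_filter, Finset.mem_filter] at hb
        have h1 : f b ≤ f x + T := by
          by_contra h
          exact hb.2 ⟨hb.1.1, by omega⟩
        have h2 := hb.1.2
        rw [Finset.mem_coe, Finset.mem_filter, Finset.mem_range]
        dsimp only
        exact ⟨by omega, Or.inr ⟨b, hBE b hb.1.1, by omega⟩⟩
      · intro b hb c hc h
        rw [Finset.mem_coe, Finset.mem_sdiff, Finset.mem_filter] at hb hc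
        have h1 := hb.1.2
        have h2 := hc.1.2
        replace h : (f b - f x - 1).toNat = (f c - f x - 1).toNat := h
        exact hΩ.inj f hf (by omega)
    have h1 := Finset.le_card_sdiff (B.filter fun b => f x + T < f b)
      (B.filter fun b => f x < f b)
    have h2 : B.card ≤ 4 * ((Finset.range T).filter fun k : ℕ =>
      IsLow E f (f x + (k + 1))).card := by omega
    have h3 : (B.card : ℝ) ≤ 4 * ((Finset.range T).filter fun k : ℕ =>
      IsLow E f (f x + (k + 1))).card := by exact_mod_cast h2
    linarith

theorem antitone_sum_aboveInd_mul_near (hΩ : SwapFamily Ω E n) (x : α) (B : Finset α) :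
    Antitone fun k : ℕ => ∑ f ∈ Ω, aboveInd B x f * near E x (k + 1) f := by
  refine antitone_nat_of_succ_le fun k => ?_
  have := hΩ.sum_mul_near_sub (k := k + 1) (by omega) x (aboveInd B x)
    fun f _ _ => aboveInd_transpose (by omega) B x f
  simp only [mul_sub, Finset.sum_sub_distrib] at this
  have h0 : 0 ≤ ∑ f ∈ Ω, aboveInd B x f * nearBlocked Ω E x (k + 1) f :=
    Finset.sum_nonneg fun f _ => mul_nonneg (aboveInd_nonneg _ _ _) (nearBlocked_nonneg _ _ _)
  push_cast
  linarith

theorem min_mul_sum_aboveInd_le (hΩ : SwapFamily Ω E n) (x : α) {U B : Finset α}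
    (hU : ∀ c, c ∉ E → c ∈ U) (hBE : ∀ b ∈ B, b ∈ E) (hB : 0 < B.card) {C : ℝ}
    (hC : ∀ f ∈ Ω, ∀ t : ℤ, B.card ≤ 4 * (B.filter fun b => t < f b).card →
      ((U.filter fun c => f c ≤ t).card : ℝ) ≤ C) (T : ℕ) :
    min ((B.card : ℝ) / 4) (T - C) * ∑ f ∈ Ω, aboveInd B x f ≤
      ∑ k ∈ Finset.range T, ∑ f ∈ Ω, aboveInd B x f * near E x (k + 1) f := by
  rw [Finset.sum_comm, Finset.mul_sum]
  refine Finset.sum_le_sum fun f hf => ?_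
  rw [← Finset.mul_sum, mul_comm]
  unfold aboveInd
  split_ifs with h
  · simpa using hΩ.min_le_sum_near hU hBE hB hf (hC f hf) h T
  · simp

/-- The letter directly above `x` is often in `E`. -/
theorem min_mul_sum_aboveInd_le_mul_sum_near (hΩ : SwapFamily Ω E n) (x : α) {U B : Finset α}
    (hU : ∀ c, c ∉ E → c ∈ U) (hBE : ∀ b ∈ B, b ∈ E) (hB : 0 < B.card) {C : ℝ}
    (hC : ∀ f ∈ Ω, ∀ t : ℤ, B.card ≤ 4 * (B.filter fun b => t < f b).card →
      ((U.filter fun c => f c ≤ t).card : ℝ) ≤ C) (T : ℕ) :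
    min ((B.card : ℝ) / 4) (T - C) * ∑ f ∈ Ω, aboveInd B x f ≤ T * ∑ f ∈ Ω, near E x 1 f := by
  refine (hΩ.min_mul_sum_aboveInd_le x hU hBE hB hC T).trans ?_
  have h : ∀ k ∈ Finset.range T, ∑ f ∈ Ω, aboveInd B x f * near E x (k + 1) f ≤
      ∑ f ∈ Ω, near E x 1 f := by
    intro k _
    refine (hΩ.antitone_sum_aboveInd_mul_near x B (Nat.zero_le k)).trans ?_
    simp only [Nat.cast_zero, zero_add]
    exact Finset.sum_le_sum fun f _ =>
      mul_le_of_le_one_left (near_nonneg _ _ _) (aboveInd_le_one _ _ _)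
  simpa using Finset.sum_le_sum h

theorem sum_runInd_mul_le (hΩ : SwapFamily Ω E n) {x : α} (hx : x ∉ E) (s : ℕ) (φ : ℤ → ℝ)
    (hφ : ∀ t, 0 ≤ φ t) :
    ∑ f ∈ Ω, runInd E x s f * φ (f x + s) ≤ ∑ f ∈ Ω, φ (f x) := by
  induction s with
  | zero => simp [runInd]
  | succ s ih =>
    refine le_trans ?_ ih
    have h := hΩ.sum_mul_near_zero hx fun f => runInd E x s f * φ (f x + s)
    have h' : ∑ f ∈ Ω, runInd E x (s + 1) f * φ (f x + (s + 1 : ℕ)) =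
        ∑ f ∈ Ω, runInd E x s (transpose (f x) f) * φ (transpose (f x) f x + s) *
          near E x 1 f := by
      refine Finset.sum_congr rfl fun f hf => ?_
      have h₀ : transpose (f x) f x = f x + 1 := Equiv.swap_apply_left _ _
      rw [h₀]
      unfold runInd
      rw [Finset.prod_range_succ']
      have : ∀ k ∈ Finset.range s, near E x (((k + 1 : ℕ) : ℤ) + 1) f =
          near E x (k + 1) (transpose (f x) f) := by
        intro k _
        rw [near_transpose_self (by omega) (hΩ.nonneg hf x)]
        push_cast
        rfl
      rw [Finset.prod_congr rfl this]
      push_cast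
      rw [show f x + ((s : ℤ) + 1) = f x + 1 + s by ring]
      ring
    rw [h', ← h]
    refine Finset.sum_le_sum fun f _ => mul_le_of_le_one_right
      (mul_nonneg (runInd_nonneg _ _ _) (hφ _)) ?_
    have := near_le_one (E := E) x 0 f
    have := nearBlocked_nonneg (Ω := Ω) (E := E) x 0 f
    linarith

/-- If `B` is much larger than the part of `Eᶜ` that precedes it, `x` is often followed by a long
run of elements of `E`, so its position fluctuates. -/
theorem sq_le_sum_sub_sq (hΩ : SwapFamily Ω E n) {x : α} (hx : x ∉ E) {U B : Finset α}
    (hU : ∀ c, c ∉ E → c ∈ U) (hBE : ∀ b ∈ B, b ∈ E) (hB : 0 < B.card) {C : ℝ} (hC0 : 0 < C)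
    (hC : ∀ f ∈ Ω, ∀ t : ℤ, B.card ≤ 4 * (B.filter fun b => t < f b).card →
      ((U.filter fun c => f c ≤ t).card : ℝ) ≤ C) {s T : ℕ} (hsT : s ≤ T)
    (hT : 4 * (T : ℝ) ≤ B.card) (hsC : 4 * s * C ≤ T - s)
    (hhalf : (Ω.card : ℝ) / 2 ≤ ∑ f ∈ Ω, aboveInd B x f) (h : ℝ) :
    (s : ℝ) ^ 2 / 16 * Ω.card ≤ ∑ f ∈ Ω, ((f x : ℝ) - h) ^ 2 := by
  obtain ⟨I, hI⟩ : ∃ I, I = ∑ f ∈ Ω, aboveInd B x f := ⟨_, rfl⟩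
  set G : ℕ → ℝ := fun k => ∑ f ∈ Ω, aboveInd B x f * near E x (k + 1) f with hG
  have hanti : Antitone G := hΩ.antitone_sum_aboveInd_mul_near x B
  have hIN : I ≤ Ω.card := by
    rw [hI]
    refine (Finset.sum_le_sum fun f _ => aboveInd_le_one _ _ _).trans ?_
    simp
  have h1 := hΩ.min_mul_sum_aboveInd_le x hU hBE hB hC T
  rw [min_eq_right (by linarith), ← hI] at h1
  have hGI : ∀ k, G k ≤ I := fun k => by
    rw [hI]
    exact Finset.sum_le_sum fun f _ =>
      mul_le_of_le_one_right (aboveInd_nonneg _ _ _) (near_le_one _ _ _)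
  have h2 : ∑ k ∈ Finset.range T, G k ≤ s * I + (T - s) * G s := by
    rw [← Finset.sum_range_add_sum_Ico _ hsT]
    refine add_le_add ?_ ?_
    · simpa using Finset.sum_le_sum fun k (_ : k ∈ Finset.range s) => hGI k
    · have := Finset.sum_le_sum fun k (hk : k ∈ Finset.Ico s T) =>
        hanti (Finset.mem_Ico.1 hk).1
      simpa [Nat.cast_sub hsT] using this
  have h3 : ((T : ℝ) - s) * (I - G s) ≤ C * I := by linarith
  have h4 : s * (I - G s) ≤ Ω.card / 4 := by
    have h5 : 0 ≤ I - G s := sub_nonneg.2 (hGI s)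
    have : C * (4 * (s * (I - G s))) ≤ C * Ω.card := by nlinarith
    have := le_of_mul_le_mul_left this hC0
    linarith
  have h5 : ∑ k ∈ Finset.range s, (I - G k) ≤ s * (I - G s) := by
    have := Finset.sum_le_sum fun k (hk : k ∈ Finset.range s) =>
      sub_le_sub_left (hanti (Finset.mem_range.1 hk).le) I
    rw [mul_sub]
    simpa [mul_sub] using this
  have h6 : I - ∑ k ∈ Finset.range s, (I - G k) ≤ ∑ f ∈ Ω, runInd E x s f := by
    have : ∀ k, I - G k = ∑ f ∈ Ω, aboveInd B x f * (1 - near E x (k + 1) f) := by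
      intro k
      simp only [hI, hG, mul_sub, mul_one, Finset.sum_sub_distrib]
    simp only [this]
    rw [Finset.sum_comm, hI, ← Finset.sum_sub_distrib]
    refine Finset.sum_le_sum fun f _ => ?_
    rw [← Finset.mul_sum, ← mul_one_sub]
    exact (mul_le_mul_of_nonneg_left (one_sub_sum_le_runInd x s f) (aboveInd_nonneg _ _ _)).trans
      (mul_le_of_le_one_left (runInd_nonneg _ _ _) (aboveInd_le_one _ _ _))
  have h7 : (Ω.card : ℝ) / 4 ≤ ∑ f ∈ Ω, runInd E x s f := by linarith
  have h8 := hΩ.sum_runInd_mul_le hx s (fun t => ((t : ℝ) - h) ^ 2) fun t => sq_nonneg _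
  have h9 : ∑ f ∈ Ω, runInd E x s f * ((f x : ℝ) - h) ^ 2 ≤ ∑ f ∈ Ω, ((f x : ℝ) - h) ^ 2 :=
    Finset.sum_le_sum fun f _ => mul_le_of_le_one_left (sq_nonneg _) (runInd_le_one _ _ _)
  have h10 : ∑ f ∈ Ω, runInd E x s f * (s ^ 2 / 2) ≤
      ∑ f ∈ Ω, runInd E x s f * (((f x + s : ℤ) : ℝ) - h) ^ 2 +
        ∑ f ∈ Ω, runInd E x s f * ((f x : ℝ) - h) ^ 2 := by
    rw [← Finset.sum_add_distrib]
    refine Finset.sum_le_sum fun f _ => ?_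
    rw [← mul_add]
    refine mul_le_mul_of_nonneg_left ?_ (runInd_nonneg _ _ _)
    push_cast
    nlinarith [sq_nonneg (2 * ((f x : ℝ) - h) + s)]
  rw [← Finset.sum_mul] at h10
  have h11 : (s : ℝ) ^ 2 / 2 * (Ω.card / 4) ≤ s ^ 2 / 2 * ∑ f ∈ Ω, runInd E x s f := by gcongr
  linarith

end SwapFamily

/-- A swap family adapted to a pair `(A, B)`, in which the elements `x` of `A` have variance `v x`
and at most `C` elements of `Eᶜ` precede a quarter of `B`. -/
structure PairFamily (Ω : Finset (α → ℤ)) (E : Set α) (A B : Finset α) (C : ℝ) (v : α → ℝ) :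
    Prop where
  nonempty : Ω.Nonempty
  swapFamily : ∃ n, SwapFamily Ω E n
  notMem : ∀ x ∈ A, x ∉ E
  mem : ∀ b ∈ B, b ∈ E
  card_le : ∃ U : Finset α, (∀ c, c ∉ E → c ∈ U) ∧ ∀ f ∈ Ω, ∀ t : ℤ,
    B.card ≤ 4 * (B.filter fun b => t < f b).card → ((U.filter fun c => f c ≤ t).card : ℝ) ≤ C
  sum_sub_sq : ∀ x ∈ A, ∃ h : ℝ, ∑ f ∈ Ω, ((f x : ℝ) - h) ^ 2 = v x * Ω.card

/-- Few placements are blocked near `x`. -/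
def RarelyBlocked (Ω : Finset (α → ℤ)) (E : Set α) (w : ℕ) (x : α) : Prop :=
  ∀ k : ℤ, -w ≤ k → k ≤ w + 1 →
    50 * (w : ℝ) ^ 3 * ∑ f ∈ Ω, nearBlocked Ω E x k f ≤ (Ω.card : ℝ)

namespace PairFamily

variable {A B : Finset α} {C : ℝ} {v : α → ℝ}

theorem card_pos (hΩ : PairFamily Ω E A B C v) : (0 : ℝ) < Ω.card := by
  exact_mod_cast hΩ.nonempty.card_pos

open Classical in
theorem card_not_rarelyBlocked_le (hΩ : PairFamily Ω E A B C v) {w : ℕ} (hw : 0 < w) :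
    ((A.filter fun x => ¬ RarelyBlocked Ω E w x).card : ℝ) ≤ 200 * w ^ 4 := by
  obtain ⟨n, hS⟩ := hΩ.swapFamily
  have hN := hΩ.card_pos
  have hw1 : (1 : ℝ) ≤ w := by exact_mod_cast hw
  have h1 : ∑ x ∈ A.filter fun x => ¬ RarelyBlocked Ω E w x, (Ω.card : ℝ) ≤
      ∑ x ∈ A, ∑ k ∈ Finset.Icc (-w : ℤ) (w + 1),
        50 * (w : ℝ) ^ 3 * ∑ f ∈ Ω, nearBlocked Ω E x k f := by
    have h0 : ∀ x, ∀ k ∈ Finset.Icc (-w : ℤ) (w + 1),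
        0 ≤ 50 * (w : ℝ) ^ 3 * ∑ f ∈ Ω, nearBlocked Ω E x k f := fun x k _ =>
      mul_nonneg (by positivity) (Finset.sum_nonneg fun f _ => nearBlocked_nonneg _ _ _)
    refine (Finset.sum_le_sum fun x hx => ?_).trans
      (Finset.sum_le_sum_of_subset_of_nonneg (Finset.filter_subset _ _)
        fun x _ _ => Finset.sum_nonneg (h0 x))
    have := (Finset.mem_filter.1 hx).2
    unfold RarelyBlocked at this
    push Not at this
    obtain ⟨k, hk, hk', h⟩ := this
    exact h.le.trans (Finset.single_le_sum (h0 x) (Finset.mem_Icc.2 ⟨hk, hk'⟩))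
  rw [Finset.sum_comm] at h1
  have h2 : ∀ k ∈ Finset.Icc (-w : ℤ) (w + 1), ∑ x ∈ A,
      50 * (w : ℝ) ^ 3 * ∑ f ∈ Ω, nearBlocked Ω E x k f ≤ 50 * (w : ℝ) ^ 3 * Ω.card := by
    intro k _
    rw [← Finset.mul_sum]
    exact mul_le_mul_of_nonneg_left (hS.sum_sum_blocked_le A (skip k)) (by positivity)
  have h3 := h1.trans (Finset.sum_le_sum h2)
  have hcard : (Finset.Icc (-w : ℤ) (w + 1)).card = 2 * w + 2 := by
    rw [Int.card_Icc]; omega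
  rw [Finset.sum_const, Finset.sum_const, nsmul_eq_mul, nsmul_eq_mul, hcard] at h3
  have h4 : ((A.filter fun x => ¬ RarelyBlocked Ω E w x).card : ℝ) ≤
      ((2 * w + 2 : ℕ) : ℝ) * (50 * w ^ 3) := by
    refine le_of_mul_le_mul_right ?_ hN
    linarith
  refine h4.trans ?_
  push_cast
  have : 0 ≤ (w : ℝ) ^ 3 := by positivity
  nlinarith

theorem sq_div_le (hΩ : PairFamily Ω E A B C v) {x : α} (hx : x ∈ A) {c : ℝ} (hc : 0 < c)
    (hC : C = c * A.card) {s : ℕ} (hB : 4 * (s + 1 + 4 * s * c) * (A.card : ℝ) ≤ B.card)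
    (hhalf : (Ω.card : ℝ) / 2 ≤ ∑ f ∈ Ω, aboveInd B x f) : (s : ℝ) ^ 2 / 16 ≤ v x := by
  obtain ⟨n, hS⟩ := hΩ.swapFamily
  obtain ⟨U, hU, hcard⟩ := hΩ.card_le
  obtain ⟨h, hh⟩ := hΩ.sum_sub_sq x hx
  have hA : (1 : ℝ) ≤ A.card := by exact_mod_cast Finset.card_pos.2 ⟨x, hx⟩
  have hB0 : (0 : ℝ) < B.card := lt_of_lt_of_le (by positivity) hB
  have hC0 : 0 < C := by rw [hC]; positivity
  have h1 := Nat.le_ceil (4 * s * C)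
  have h2 := (Nat.ceil_lt_add_one (show 0 ≤ 4 * s * C by positivity)).le
  have key := hS.sq_le_sum_sub_sq (hΩ.notMem x hx) hU hΩ.mem (by exact_mod_cast hB0) hC0 hcard
    (s := s) (T := s + ⌈4 * s * C⌉₊) (by omega) (by
      push_cast
      refine le_trans ?_ hB
      rw [hC] at h2 ⊢
      nlinarith) (by push_cast; linarith) hhalf h
  rw [hh] at key
  exact le_of_mul_le_mul_right key hΩ.card_pos

theorem mul_sq_div_le (hΩ : PairFamily Ω E A B C v) {x : α} (hx : x ∈ A) {c μ : ℝ} (hc : 0 < c)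
    (hμ : 0 < μ) (hC : C = c * A.card) (hB : μ * A.card ≤ B.card) {w : ℕ} (hw : 0 < w)
    (hblocked : RarelyBlocked Ω E w x)
    (hhalf : (Ω.card : ℝ) / 2 ≤ ∑ f ∈ Ω, aboveInd B x f) :
    w * (min (μ / 4) 1 / (2 * (c + 2))) ^ 2 / 4 ≤ v x := by
  obtain ⟨n, hS⟩ := hΩ.swapFamily
  obtain ⟨U, hU, hcard⟩ := hΩ.card_le
  obtain ⟨h, hh⟩ := hΩ.sum_sub_sq x hx
  have hA : (1 : ℝ) ≤ A.card := by exact_mod_cast Finset.card_pos.2 ⟨x, hx⟩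
  have hB0 : (0 : ℝ) < B.card := lt_of_lt_of_le (by positivity) hB
  have hN := hΩ.card_pos
  have hm : 0 < min (μ / 4) 1 := lt_min (by positivity) one_pos
  have h1 := Nat.le_ceil ((c + 1) * (A.card : ℝ))
  have h2 := (Nat.ceil_lt_add_one (show 0 ≤ (c + 1) * (A.card : ℝ) by positivity)).le
  have h3 := hS.min_mul_sum_aboveInd_le_mul_sum_near x hU hΩ.mem (by exact_mod_cast hB0) hcard
    ⌈(c + 1) * (A.card : ℝ)⌉₊
  have h4 : min (μ / 4) 1 * (A.card : ℝ) ≤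
      min ((B.card : ℝ) / 4) (⌈(c + 1) * (A.card : ℝ)⌉₊ - C) := by
    refine le_min ?_ ?_
    · have := mul_le_mul_of_nonneg_right (min_le_left (μ / 4) 1) (zero_le_one.trans hA)
      linarith
    · have := mul_le_mul_of_nonneg_right (min_le_right (μ / 4) 1) (zero_le_one.trans hA)
      rw [hC]
      linarith
  have h5 : min (μ / 4) 1 * (A.card : ℝ) * (Ω.card / 2) ≤
      (c + 2) * A.card * ∑ f ∈ Ω, near E x 1 f := by
    refine (mul_le_mul h4 hhalf (by positivity) ((by positivity : (0 : ℝ) ≤ _).trans h4)).trans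
      (h3.trans ?_)
    refine mul_le_mul_of_nonneg_right (by linarith)
      (Finset.sum_nonneg fun f _ => near_nonneg _ _ _)
  have h6 : min (μ / 4) 1 / (2 * (c + 2)) * Ω.card ≤ ∑ f ∈ Ω, near E x 1 f := by
    rw [div_mul_eq_mul_div, div_le_iff₀ (by positivity)]
    refine le_of_mul_le_mul_right (a := (A.card : ℝ)) ?_ (by linarith)
    linarith
  have key := hS.le_sum_sub_sq (hΩ.notMem x hx) hw hblocked (by positivity) h6 h
  rw [hh] at key
  exact le_of_mul_le_mul_right key hN

/-- Two families such that every `x` in `A` has at least half of `B` above it with probability at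
least one half in one of them. -/
theorem mul_card_le_sum {Ω' : Finset (α → ℤ)} {E' : Set α} (hΩ : PairFamily Ω E A B C v)
    (hΩ' : PairFamily Ω' E' A B C v)
    (hhalf : ∀ x ∈ A, (Ω.card : ℝ) / 2 ≤ ∑ f ∈ Ω, aboveInd B x f ∨
      (Ω'.card : ℝ) / 2 ≤ ∑ f ∈ Ω', aboveInd B x f)
    {c μ L : ℝ} (hc : 0 < c) (hμ : 0 < μ) (hL : 0 ≤ L) (hC : C = c * A.card)
    (hB : μ * A.card ≤ B.card) {s w : ℕ} (hs : 16 * L ≤ s ^ 2) (hw : 0 < w)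
    (hwL : 8 * L ≤ w * (min (μ / 4) 1 / (2 * (c + 2))) ^ 2)
    (hK : 4 * (s + 1 + 4 * s * c) * (800 * (w : ℝ) ^ 4) ≤ B.card) :
    L * A.card ≤ ∑ x ∈ A, v x := by
  classical
  have hv : ∀ x ∈ A, 0 ≤ v x := by
    intro x hx
    obtain ⟨h, hh⟩ := hΩ.sum_sub_sq x hx
    have : 0 ≤ v x * Ω.card := hh ▸ Finset.sum_nonneg fun f _ => sq_nonneg _
    exact nonneg_of_mul_nonneg_left this hΩ.card_pos
  by_cases hAB : 4 * (s + 1 + 4 * s * c) * (A.card : ℝ) ≤ B.card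
  · have : ∀ x ∈ A, L ≤ v x := by
      intro x hx
      have : (s : ℝ) ^ 2 / 16 ≤ v x := (hhalf x hx).elim
        (hΩ.sq_div_le hx hc hC hAB) (hΩ'.sq_div_le hx hc hC hAB)
      linarith
    have := Finset.sum_le_sum this
    rw [Finset.sum_const, nsmul_eq_mul] at this
    linarith
  · have hA : 800 * (w : ℝ) ^ 4 ≤ A.card := by
      refine le_of_mul_le_mul_left (a := 4 * (s + 1 + 4 * s * c)) ?_ (by positivity)
      linarith
    set D := A.filter fun x => ¬ RarelyBlocked Ω E w x
    set D' := A.filter fun x => ¬ RarelyBlocked Ω' E' w x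
    have h1 : (D.card : ℝ) ≤ 200 * w ^ 4 := hΩ.card_not_rarelyBlocked_le hw
    have h2 : (D'.card : ℝ) ≤ 200 * w ^ 4 := hΩ'.card_not_rarelyBlocked_le hw
    have h3 : (A.card : ℝ) ≤ (A \ (D ∪ D')).card + D.card + D'.card := by
      have := Finset.le_card_sdiff (D ∪ D') A
      have := Finset.card_union_le D D'
      have : A.card ≤ (A \ (D ∪ D')).card + D.card + D'.card := by omega
      exact_mod_cast this
    have h4 : ∀ x ∈ A \ (D ∪ D'), 2 * L ≤ v x := by
      intro x hx
      rw [Finset.mem_sdiff, Finset.mem_union, Finset.mem_filter, Finset.mem_filter] at hx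
      obtain ⟨hx, hD⟩ := hx
      have : w * (min (μ / 4) 1 / (2 * (c + 2))) ^ 2 / 4 ≤ v x := (hhalf x hx).elim
        (hΩ.mul_sq_div_le hx hc hμ hC hB hw (by tauto))
        (hΩ'.mul_sq_div_le hx hc hμ hC hB hw (by tauto))
      linarith
    have h5 := Finset.sum_le_sum h4
    rw [Finset.sum_const, nsmul_eq_mul] at h5
    have h6 : ∑ x ∈ A \ (D ∪ D'), v x ≤ ∑ x ∈ A, v x :=
      Finset.sum_le_sum_of_subset_of_nonneg Finset.sdiff_subset fun x hx _ => hv x hx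
    have h7 : (A.card : ℝ) / 2 ≤ (A \ (D ∪ D')).card := by linarith
    nlinarith

end PairFamily

end SwapFamilies

section LinearExtensions

variable {β : Type} [Fintype β] [PartialOrder β]

instance : Nonempty (LinExt β) := by
  let _ : Fintype (LinearExtension β) := ‹Fintype β›
  let e := Fintype.orderIsoFinOfCardEq (LinearExtension β) (k := Fintype.card β) rfl
  refine ⟨⟨e.symm.toEquiv, fun x y h => e.symm.strictMono ?_⟩⟩
  exact lt_of_le_of_ne (toLinearExtension.monotone h.le) h.ne

theorem LinExt.exists_swap (f : LinExt β) {p q : β} (hpq : (f.1 q : ℕ) = f.1 p + 1)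
    (h : ¬ p < q) : ∃ g : LinExt β, g.1 p = f.1 q ∧ g.1 q = f.1 p ∧
      ∀ x, x ≠ p → x ≠ q → g.1 x = f.1 x := by
  have h₁ : ∀ x, x ≠ p → x ≠ q → Equiv.swap (f.1 p) (f.1 q) (f.1 x) = f.1 x := fun x hp hq =>
    Equiv.swap_apply_of_ne_of_ne (f.1.injective.ne hp) (f.1.injective.ne hq)
  refine ⟨⟨f.1.trans (Equiv.swap (f.1 p) (f.1 q)), fun x y hxy => ?_⟩,
    Equiv.swap_apply_left _ _, Equiv.swap_apply_right _ _, h₁⟩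
  simp only [Equiv.trans_apply, Fin.lt_def]
  have hf : (f.1 x : ℕ) < f.1 y := f.2 x y hxy
  have hne : ∀ a b, a ≠ b → (f.1 a : ℕ) ≠ f.1 b := fun a b hab =>
    Fin.val_injective.ne (f.1.injective.ne hab)
  by_cases hxp : x = p
  · subst hxp
    have hyq : y ≠ q := fun hyq => h (hyq ▸ hxy)
    rw [Equiv.swap_apply_left, h₁ y hxy.ne' hyq]
    have := hne y q hyq
    omega
  by_cases hxq : x = q
  · subst hxq
    have hyp : y ≠ p := by rintro rfl; omega
    rw [Equiv.swap_apply_right, h₁ y hyp hxy.ne']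
    omega
  rw [h₁ x hxp hxq]
  by_cases hyp : y = p
  · subst hyp
    rw [Equiv.swap_apply_left]
    omega
  by_cases hyq : y = q
  · subst hyq
    rw [Equiv.swap_apply_right]
    have := hne x p hxp
    omega
  rwa [h₁ y hyp hyq]

/-- The positions of the elements, counted from the bottom. -/
def fromBottom (f : LinExt β) : β → ℤ := fun x => ((f.1 x : ℕ) : ℤ)

/-- The positions of the elements, counted from the top. -/
def fromTop (f : LinExt β) : β → ℤ := fun x => (Fintype.card β : ℤ) - 1 - ((f.1 x : ℕ) : ℤ)

theorem fromBottom_injective : Function.Injective (fromBottom (β := β)) := by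
  intro f g h
  refine Subtype.ext (Equiv.ext fun x => Fin.ext ?_)
  have := congrFun h x
  unfold fromBottom at this
  omega

theorem fromTop_injective : Function.Injective (fromTop (β := β)) := by
  intro f g h
  refine Subtype.ext (Equiv.ext fun x => Fin.ext ?_)
  have := congrFun h x
  unfold fromTop at this
  omega

theorem eq_transpose {α : Type*} {F G : α → ℤ} (hF : Function.Injective F) {c e : α}
    (he : F e = F c + 1) (hc : G c = F e) (he' : G e = F c)
    (h : ∀ x, x ≠ c → x ≠ e → G x = F x) : G = transpose (F c) F := by
  funext x
  unfold transpose
  rw [← he]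
  by_cases hxc : x = c
  · rw [hxc, Equiv.swap_apply_left, hc]
  by_cases hxe : x = e
  · rw [hxe, Equiv.swap_apply_right, he']
  rw [Equiv.swap_apply_of_ne_of_ne (hF.ne hxc) (hF.ne hxe), h x hxc hxe]

open Classical in
theorem swapFamily_fromBottom {E : Set β} (hE : IsLowerSet E) (hn : 0 < Fintype.card β) :
    SwapFamily (Finset.univ.image (fromBottom (β := β))) E (Fintype.card β) where
  pos := by exact_mod_cast hn
  inj F hF := by
    obtain ⟨f, -, rfl⟩ := Finset.mem_image.1 hF
    intro x y h
    unfold fromBottom at h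
    exact f.1.injective (Fin.ext (by omega))
  exists_apply_eq_iff F hF t := by
    obtain ⟨f, -, rfl⟩ := Finset.mem_image.1 hF
    unfold fromBottom
    constructor
    · rintro ⟨x, rfl⟩
      have := (f.1 x).2
      omega
    · intro ht
      exact ⟨f.1.symm ⟨t.toNat, by omega⟩, by simp; omega⟩
  swap F hF c hc e he h := by
    obtain ⟨f, -, rfl⟩ := Finset.mem_image.1 hF
    have h' : (f.1 e : ℕ) = f.1 c + 1 := by
      unfold fromBottom at h
      omega
    obtain ⟨g, h₁, h₂, h₃⟩ := f.exists_swap h' fun hlt => hc (hE hlt.le he)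
    refine Finset.mem_image.2 ⟨g, Finset.mem_univ _, eq_transpose ?_ h ?_ ?_ ?_⟩
    · intro x y h
      unfold fromBottom at h
      exact f.1.injective (Fin.ext (by omega))
    · unfold fromBottom; rw [h₁]
    · unfold fromBottom; rw [h₂]
    · intro x hc he
      unfold fromBottom; rw [h₃ x hc he]

open Classical in
theorem swapFamily_fromTop {E : Set β} (hE : IsUpperSet E) (hn : 0 < Fintype.card β) :
    SwapFamily (Finset.univ.image (fromTop (β := β))) E (Fintype.card β) where
  pos := by exact_mod_cast hn
  inj F hF := by
    obtain ⟨f, -, rfl⟩ := Finset.mem_image.1 hF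
    intro x y h
    unfold fromTop at h
    exact f.1.injective (Fin.ext (by omega))
  exists_apply_eq_iff F hF t := by
    obtain ⟨f, -, rfl⟩ := Finset.mem_image.1 hF
    unfold fromTop
    constructor
    · rintro ⟨x, rfl⟩
      have := (f.1 x).2
      omega
    · intro ht
      exact ⟨f.1.symm ⟨(Fintype.card β - 1 - t).toNat, by omega⟩, by simp; omega⟩
  swap F hF c hc e he h := by
    obtain ⟨f, -, rfl⟩ := Finset.mem_image.1 hF
    have h' : (f.1 c : ℕ) = f.1 e + 1 := by
      unfold fromTop at h
      omega
    obtain ⟨g, h₁, h₂, h₃⟩ := f.exists_swap h' fun hlt => hc (hE hlt.le he)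
    refine Finset.mem_image.2 ⟨g, Finset.mem_univ _, eq_transpose ?_ h ?_ ?_ ?_⟩
    · intro x y h
      unfold fromTop at h
      exact f.1.injective (Fin.ext (by omega))
    · unfold fromTop; rw [h₂]
    · unfold fromTop; rw [h₁]
    · intro x hc he
      unfold fromTop; rw [h₃ x he hc]

theorem sum_val_sub_sq (x : β) :
    ∑ f : LinExt β, ((val f x : ℝ) - expec x) ^ 2 = variance x * Fintype.card (LinExt β) := by
  rw [← Nat.card_eq_fintype_card, variance, div_mul_cancel₀]
  exact_mod_cast Nat.card_pos.ne'

theorem IncompPair.card_mul_le {μ : ℝ} (hμ : 0 < μ) {A B : Finset β} (hB : 0 < B.card)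
    (hmax : ∀ C D : Finset β, IncompPair C D →
      μ * ((C.card : ℝ) * (D.card : ℝ)) ≤ (A.card : ℝ) * (B.card : ℝ))
    {U V : Finset β} (hUV : ∀ u ∈ U, ∀ b ∈ V, ¬ u ≤ b ∧ ¬ b ≤ u)
    (hV : B.card ≤ 4 * V.card) : (U.card : ℝ) ≤ 4 / μ * A.card := by
  have h := hmax U V ⟨Finset.disjoint_left.2 fun x hx hx' => (hUV x hx x hx').1 le_rfl, hUV⟩
  have hV' : (B.card : ℝ) ≤ 4 * V.card := by exact_mod_cast hV
  have hB' : (0 : ℝ) < B.card := by exact_mod_cast hB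
  rw [div_mul_eq_mul_div, le_div_iff₀ hμ]
  refine le_of_mul_le_mul_right (a := (B.card : ℝ)) ?_ hB'
  have : 0 ≤ μ * (U.card : ℝ) := by positivity
  nlinarith

variable {μ : ℝ} {A B : Finset β}

open Classical in
theorem pairFamily_fromBottom (hμ : 0 < μ) (hAB : IncompPair A B) (hB : 0 < B.card)
    (hmax : ∀ C D : Finset β, IncompPair C D →
      μ * ((C.card : ℝ) * (D.card : ℝ)) ≤ (A.card : ℝ) * (B.card : ℝ)) :
    PairFamily (Finset.univ.image (fromBottom (β := β))) {z | ∃ b ∈ B, z ≤ b} A B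
      (4 / μ * A.card) variance where
  nonempty := Finset.univ_nonempty.image _
  swapFamily := ⟨_, swapFamily_fromBottom (fun y z hzy ⟨b, hb, h⟩ => ⟨b, hb, hzy.trans h⟩)
    (hB.trans_le (Finset.card_le_univ B))⟩
  notMem := fun x hx ⟨b, hb, h⟩ => (hAB.2 x hx b hb).1 h
  mem := fun b hb => ⟨b, hb, le_rfl⟩
  card_le := by
    refine ⟨Finset.univ.filter fun c => c ∉ {z | ∃ b ∈ B, z ≤ b}, fun c hc => by simpa using hc,
      fun F hF t ht => IncompPair.card_mul_le hμ hB hmax ?_ ht⟩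
    obtain ⟨f, -, rfl⟩ := Finset.mem_image.1 hF
    intro u hu b hb
    rw [Finset.mem_filter, Finset.mem_filter] at hu
    rw [Finset.mem_filter] at hb
    refine ⟨fun h => hu.1.2 ⟨b, hb.1, h⟩, fun h => ?_⟩
    have : fromBottom f b ≤ fromBottom f u := by
      obtain rfl | h := h.eq_or_lt
      · rfl
      · have : (f.1 b : ℕ) < f.1 u := f.2 b u h
        unfold fromBottom
        omega
    omega
  sum_sub_sq := by
    intro x _
    refine ⟨expec x - 1, ?_⟩
    rw [Finset.sum_image fromBottom_injective.injOn, Finset.card_image_of_injective _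
      fromBottom_injective, Finset.card_univ, ← sum_val_sub_sq]
    refine Finset.sum_congr rfl fun f _ => ?_
    unfold fromBottom _root_.val
    push_cast
    ring

open Classical in
theorem pairFamily_fromTop (hμ : 0 < μ) (hAB : IncompPair A B) (hB : 0 < B.card)
    (hmax : ∀ C D : Finset β, IncompPair C D →
      μ * ((C.card : ℝ) * (D.card : ℝ)) ≤ (A.card : ℝ) * (B.card : ℝ)) :
    PairFamily (Finset.univ.image (fromTop (β := β))) {z | ∃ b ∈ B, b ≤ z} A B
      (4 / μ * A.card) variance where
  nonempty := Finset.univ_nonempty.image _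
  swapFamily := ⟨_, swapFamily_fromTop (fun y z hyz ⟨b, hb, h⟩ => ⟨b, hb, h.trans hyz⟩)
    (hB.trans_le (Finset.card_le_univ B))⟩
  notMem := fun x hx ⟨b, hb, h⟩ => (hAB.2 x hx b hb).2 h
  mem := fun b hb => ⟨b, hb, le_rfl⟩
  card_le := by
    refine ⟨Finset.univ.filter fun c => c ∉ {z | ∃ b ∈ B, b ≤ z}, fun c hc => by simpa using hc,
      fun F hF t ht => IncompPair.card_mul_le hμ hB hmax ?_ ht⟩
    obtain ⟨f, -, rfl⟩ := Finset.mem_image.1 hF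
    intro u hu b hb
    rw [Finset.mem_filter, Finset.mem_filter] at hu
    rw [Finset.mem_filter] at hb
    refine ⟨fun h => ?_, fun h => hu.1.2 ⟨b, hb.1, h⟩⟩
    have : fromTop f b ≤ fromTop f u := by
      obtain rfl | h := h.eq_or_lt
      · rfl
      · have : (f.1 u : ℕ) < f.1 b := f.2 u b h
        unfold fromTop
        omega
    omega
  sum_sub_sq := by
    intro x _
    refine ⟨Fintype.card β - expec x, ?_⟩
    rw [Finset.sum_image fromTop_injective.injOn, Finset.card_image_of_injective _
      fromTop_injective, Finset.card_univ, ← sum_val_sub_sq]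
    refine Finset.sum_congr rfl fun f _ => ?_
    unfold fromTop _root_.val
    push_cast
    ring

theorem one_le_aboveInd_add {x : β} (hx : x ∉ B) (f : LinExt β) :
    1 ≤ aboveInd B x (fromBottom f) + aboveInd B x (fromTop f) := by
  have h : B.card ≤ (B.filter fun b => fromBottom f x < fromBottom f b).card +
      (B.filter fun b => fromTop f x < fromTop f b).card := by
    classical
    refine (Finset.card_le_card fun b hb => ?_).trans (Finset.card_union_le _ _)
    rw [Finset.mem_union, Finset.mem_filter, Finset.mem_filter]
    have : (f.1 b : ℕ) ≠ f.1 x := Fin.val_injective.ne (f.1.injective.ne fun h => hx (h ▸ hb))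
    unfold fromBottom fromTop
    rcases this.lt_or_gt with h | h
    · exact Or.inr ⟨hb, by omega⟩
    · exact Or.inl ⟨hb, by omega⟩
  unfold aboveInd
  split_ifs
  · norm_num
  · norm_num
  · norm_num
  · omega

open Classical in
theorem half_le_sum_aboveInd {x : β} (hx : x ∉ B) :
    ((Finset.univ.image (fromBottom (β := β))).card : ℝ) / 2 ≤
        ∑ f ∈ Finset.univ.image fromBottom, aboveInd B x f ∨
      ((Finset.univ.image (fromTop (β := β))).card : ℝ) / 2 ≤
        ∑ f ∈ Finset.univ.image fromTop, aboveInd B x f := by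
  rw [Finset.sum_image fromTop_injective.injOn, Finset.sum_image fromBottom_injective.injOn,
    Finset.card_image_of_injective _ fromTop_injective,
    Finset.card_image_of_injective _ fromBottom_injective]
  have h := Finset.sum_le_sum fun f (_ : f ∈ Finset.univ) => one_le_aboveInd_add hx f
  rw [Finset.sum_add_distrib, Finset.sum_const, nsmul_eq_mul, mul_one] at h
  by_contra! hc
  linarith

end LinearExtensions

/-- for every `μ > 0` and real `L` there is `K` such that for every finite poset,
if `(A,B)` is a maximal `μ`-pair with `|B| ≥ max{μ|A|, K}`, then `Σ_{x∈A} σ(x)² ≥ L|A|`. -/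
theorem stmt_14 (μ : ℝ) (hμ : 0 < μ) (L : ℝ) :
    ∃ K : ℝ,
      ∀ (β : Type) [Fintype β] [PartialOrder β] (A B : Finset β),
        IncompPair A B →
        (∀ C D : Finset β, IncompPair C D →
          μ * ((C.card : ℝ) * (D.card : ℝ)) ≤ (A.card : ℝ) * (B.card : ℝ)) →
        (¬ ∃ A' B' : Finset β, IncompPair A' B' ∧ A ⊆ A' ∧ B ⊆ B' ∧ (A', B') ≠ (A, B)) →
        μ * (A.card : ℝ) ≤ (B.card : ℝ) → K ≤ (B.card : ℝ) →
        L * (A.card : ℝ) ≤ ∑ x ∈ A, variance x := by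
  have hε : 0 < min (μ / 4) 1 / (2 * (4 / μ + 2)) := by
    have : 0 < min (μ / 4) 1 := lt_min (by positivity) one_pos
    positivity
  obtain ⟨s, hs⟩ := exists_nat_ge (16 * max L 0)
  obtain ⟨w, hw⟩ := exists_nat_ge
    (8 * max L 0 / (min (μ / 4) 1 / (2 * (4 / μ + 2))) ^ 2)
  rw [div_le_iff₀ (by positivity)] at hw
  refine ⟨4 * (s + 1 + 4 * s * (4 / μ)) * (800 * ((w + 1 : ℕ) : ℝ) ^ 4), ?_⟩
  intro β _ _ A B hAB hmax _ hμB hK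
  have hB : 0 < B.card := by
    have : (0 : ℝ) < B.card := lt_of_lt_of_le (by positivity) hK
    exact_mod_cast this
  refine (mul_le_mul_of_nonneg_right (le_max_left L 0) (Nat.cast_nonneg _)).trans ?_
  refine (pairFamily_fromBottom hμ hAB hB hmax).mul_card_le_sum
    (pairFamily_fromTop hμ hAB hB hmax)
    (fun x hx => half_le_sum_aboveInd (Finset.disjoint_left.1 hAB.1 hx)) (by positivity) hμ
    (le_max_right _ _) rfl hμB (s := s) (w := w + 1) (hs.trans ?_) w.succ_pos ?_ hK
  · exact_mod_cast Nat.le_self_pow two_ne_zero s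
  · push_cast
    have := sq_nonneg (min (μ / 4) 1 / (2 * (4 / μ + 2)))
    linarith
end

section
/- For every μ > 0 and every real L there exists K such that: if P is a finite unidirectional poset (the disjoint union of chains X = {x_1 < ⋯ < x_m} and Y = {y_1 < ⋯ < y_n} with no relations x_i > y_j), and (A,B) is a μ-pair in P with A ⊆ X, B ⊆ Y and |B| ≥ max{μ|A|, K}, then Σ_{x∈A} σ(x)² ≥ L·|A|. -/
open Finset

/-- `TwoChains xc yc` says the finite poset `β` is the disjoint union of the chains
`X = {xc 0 < xc 1 < ⋯}` (of size `m`) and `Y = {yc 0 < yc 1 < ⋯}` (of size `n`). -/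
structure TwoChains {β : Type} [Fintype β] [PartialOrder β] {m n : ℕ}
    (xc : Fin m → β) (yc : Fin n → β) : Prop where
  cover : ∀ b : β, (∃ i, b = xc i) ∨ (∃ j, b = yc j)
  disj : ∀ i j, xc i ≠ yc j
  xchain : ∀ i j, xc i ≤ xc j ↔ i ≤ j
  ychain : ∀ i j, yc i ≤ yc j ↔ i ≤ j

/-- the poset is unidirectional: no relations `x_i > y_j` -/
def Unidir {β : Type} [Fintype β] [PartialOrder β] {m n : ℕ}
    (xc : Fin m → β) (yc : Fin n → β) : Prop :=
  ∀ (i : Fin m) (j : Fin n), ¬ yc j ≤ xc i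

/-- the event `Ψ_{i,j} = {y_j ≺ x_i ≺ y_{j+1}}` (indices `1 ≤ i ≤ m`, `0 ≤ j ≤ n`,
with the conventions `Ψ_{i,0} = {x_i ≺ y_1}` and `Ψ_{i,n} = {y_n ≺ x_i}`);
here `xi : β` denotes the element `x_i`. -/
def PsiEvent {β : Type} [Fintype β] [PartialOrder β] {n : ℕ}
    (yc : Fin n → β) (xi : β) (j : ℕ) (f : LinExt β) : Prop :=
  (∀ k : Fin n, (k : ℕ) + 1 = j → val f (yc k) < val f xi) ∧
  (∀ k : Fin n, (k : ℕ) = j → val f xi < val f (yc k))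

namespace BoundedPath

open scoped FinsetFamily

lemma finite_paths (m : ℕ) (h : ℕ → ℕ) :
    {ω : ℕ → ℕ | Monotone ω ∧ (∀ k, ω k ≤ h k) ∧ ∀ k, m < k → ω k = h k}.Finite := by
  refine Set.Finite.of_finite_image (f := fun ω (k : Fin (m + 1)) => ω k)
    ((Set.finite_Icc 0 fun k : Fin (m + 1) => h k).subset ?_) ?_
  · rintro _ ⟨ω, hω, rfl⟩
    exact ⟨fun _ => Nat.zero_le _, fun k => hω.2.1 k⟩
  · intro ω hω ω' hω' he
    funext k
    rcases lt_or_ge m k with hk | hk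
    · rw [hω.2.2 k hk, hω'.2.2 k hk]
    · exact congrFun he ⟨k, by omega⟩

/-- The monotone sequences `ω` lying below `h` and equal to `h` beyond the index `m`. -/
noncomputable def paths (m : ℕ) (h : ℕ → ℕ) : Finset (ℕ → ℕ) := (finite_paths m h).toFinset

lemma mem_paths {m : ℕ} {h ω : ℕ → ℕ} :
    ω ∈ paths m h ↔ Monotone ω ∧ (∀ k, ω k ≤ h k) ∧ ∀ k, m < k → ω k = h k := by
  simp [paths]

lemma self_mem_paths {m : ℕ} {h : ℕ → ℕ} (hh : Monotone h) : h ∈ paths m h :=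
  mem_paths.2 ⟨hh, fun _ => le_rfl, fun _ _ => rfl⟩

lemma card_paths_pos {m : ℕ} {h : ℕ → ℕ} (hh : Monotone h) : (0 : ℝ) < #(paths m h) := by
  exact_mod_cast Finset.card_pos.2 ⟨h, self_mem_paths hh⟩

/-- The mean of `F` over a uniformly random path. -/
noncomputable def mean (m : ℕ) (h : ℕ → ℕ) (F : (ℕ → ℕ) → ℝ) : ℝ :=
  (∑ ω ∈ paths m h, F ω) / #(paths m h)

section mean
variable {m : ℕ} {h : ℕ → ℕ} {F H : (ℕ → ℕ) → ℝ}

lemma mean_add : mean m h (fun ω => F ω + H ω) = mean m h F + mean m h H := by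
  simp only [mean, sum_add_distrib, add_div]

lemma mean_sub : mean m h (fun ω => F ω - H ω) = mean m h F - mean m h H := by
  simp only [mean, sum_sub_distrib, sub_div]

lemma mean_const_mul (c : ℝ) : mean m h (fun ω => c * F ω) = c * mean m h F := by
  simp only [mean, ← mul_sum, mul_div_assoc]

lemma mean_const (hh : Monotone h) (c : ℝ) : mean m h (fun _ => c) = c := by
  have := (card_paths_pos (m := m) hh).ne'
  simp only [mean, sum_const, nsmul_eq_mul]
  field_simp

lemma mean_mono (hFH : ∀ ω ∈ paths m h, F ω ≤ H ω) : mean m h F ≤ mean m h H :=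
  div_le_div_of_nonneg_right (sum_le_sum hFH) (Nat.cast_nonneg _)

lemma mean_congr (hFH : ∀ ω ∈ paths m h, F ω = H ω) : mean m h F = mean m h H := by
  rw [mean, mean, sum_congr rfl hFH]

lemma mean_nonneg (hF : ∀ ω ∈ paths m h, 0 ≤ F ω) : 0 ≤ mean m h F :=
  div_nonneg (sum_nonneg hF) (Nat.cast_nonneg _)

lemma sq_mean_le (hh : Monotone h) : mean m h F ^ 2 ≤ mean m h (fun ω => F ω ^ 2) := by
  have h0 : 0 ≤ mean m h (fun ω => (F ω - mean m h F) ^ 2) := mean_nonneg fun _ _ => sq_nonneg _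
  have h1 : mean m h (fun ω => (F ω - mean m h F) ^ 2) =
      mean m h (fun ω => F ω ^ 2) - 2 * mean m h F * mean m h F + mean m h F ^ 2 := by
    rw [← mean_const_mul, ← mean_sub, ← mean_const (m := m) hh (mean m h F ^ 2), ← mean_add]
    exact mean_congr fun ω _ => by ring
  nlinarith

/-- Positive association of increasing functions. -/
lemma mean_mul_mean_le (hh : Monotone h) (hF0 : 0 ≤ F) (hH0 : 0 ≤ H) (hF : Monotone F)
    (hH : Monotone H) : mean m h F * mean m h H ≤ mean m h (fun ω => F ω * H ω) := by
  classical
  have key := four_functions_theorem F H 1 (fun ω => F ω * H ω) hF0 hH0 zero_le_one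
    (fun ω => mul_nonneg (hF0 ω) (hH0 ω))
    (fun a b => by
      rw [Pi.one_apply, one_mul]
      exact mul_le_mul (hF le_sup_left) (hH le_sup_right) (hH0 _) (hF0 _))
    (paths m h) (paths m h)
  have h1 : ∑ a ∈ paths m h ⊼ paths m h, (1 : (ℕ → ℕ) → ℝ) a ≤ #(paths m h) := by
    simp only [Pi.one_apply, sum_const, nsmul_eq_mul, mul_one, Nat.cast_le]
    refine card_le_card fun ω hω => ?_
    obtain ⟨a, ha, b, hb, rfl⟩ := mem_infs.1 hω
    rw [mem_paths] at *
    exact ⟨ha.1.inf hb.1, fun k => inf_le_left.trans (ha.2.1 k),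
      fun k hk => by simp [ha.2.2 k hk, hb.2.2 k hk]⟩
  have h2 : ∑ a ∈ paths m h ⊻ paths m h, F a * H a ≤ ∑ a ∈ paths m h, F a * H a := by
    refine sum_le_sum_of_subset_of_nonneg (fun ω hω => ?_)
      fun ω _ _ => mul_nonneg (hF0 ω) (hH0 ω)
    obtain ⟨a, ha, b, hb, rfl⟩ := mem_sups.1 hω
    rw [mem_paths] at *
    exact ⟨ha.1.sup hb.1, fun k => sup_le (ha.2.1 k) (hb.2.1 k),
      fun k hk => by simp [ha.2.2 k hk, hb.2.2 k hk]⟩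
  have h3 := key.trans (mul_le_mul h1 h2
    (sum_nonneg fun ω _ => mul_nonneg (hF0 ω) (hH0 ω)) (Nat.cast_nonneg _))
  have hc := card_paths_pos (m := m) hh
  simp only [mean]
  rw [div_mul_div_comm, div_le_div_iff₀ (by positivity) hc]
  nlinarith

/-- The mean of an increasing function grows with the bounding sequence. -/
lemma mean_mono_bound {h' : ℕ → ℕ} (hh : Monotone h) (hh' : Monotone h') (hle : h' ≤ h)
    (hF0 : 0 ≤ F) (hF : Monotone F) : mean m h' F ≤ mean m h F := by
  classical
  have key := four_functions_theorem F 1 1 F hF0 zero_le_one zero_le_one hF0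
    (fun a b => by simpa using hF le_sup_left) (paths m h') (paths m h)
  have h1 : ∑ a ∈ paths m h' ⊼ paths m h, (1 : (ℕ → ℕ) → ℝ) a ≤ #(paths m h') := by
    simp only [Pi.one_apply, sum_const, nsmul_eq_mul, mul_one, Nat.cast_le]
    refine card_le_card fun ω hω => ?_
    obtain ⟨a, ha, b, hb, rfl⟩ := mem_infs.1 hω
    rw [mem_paths] at *
    exact ⟨ha.1.inf hb.1, fun k => inf_le_left.trans (ha.2.1 k),
      fun k hk => by simp [ha.2.2 k hk, hb.2.2 k hk, hle k]⟩
  have h2 : ∑ a ∈ paths m h' ⊻ paths m h, F a ≤ ∑ a ∈ paths m h, F a := by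
    refine sum_le_sum_of_subset_of_nonneg (fun ω hω => ?_) fun ω _ _ => hF0 ω
    obtain ⟨a, ha, b, hb, rfl⟩ := mem_sups.1 hω
    rw [mem_paths] at *
    exact ⟨ha.1.sup hb.1, fun k => sup_le ((ha.2.1 k).trans (hle k)) (hb.2.1 k),
      fun k hk => by simp [ha.2.2 k hk, hb.2.2 k hk, hle k]⟩
  have h3 := key.trans (mul_le_mul h1 h2 (sum_nonneg fun ω _ => hF0 ω) (Nat.cast_nonneg _))
  have hc := card_paths_pos (m := m) hh
  have hc' := card_paths_pos (m := m) hh'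
  simp only [Pi.one_apply, sum_const, nsmul_eq_mul, mul_one] at h3
  simp only [mean]
  rw [div_le_div_iff₀ hc' hc]
  linarith

end mean

/-- Replace the value at `k + 1` by `ψ p q x`, where `x` is the old value and `[p, q]` is the
interval of values allowed there by the remaining ones. -/
def resample (h : ℕ → ℕ) (k : ℕ) (ψ : ℕ → ℕ → ℕ → ℕ) (ω : ℕ → ℕ) : ℕ → ℕ :=
  Function.update ω (k + 1) (ψ (ω k) (min (ω (k + 2)) (h (k + 1))) (ω (k + 1)))

section resample
variable {m k : ℕ} {h : ℕ → ℕ} {ψ : ℕ → ℕ → ℕ → ℕ} {F : (ℕ → ℕ) → ℝ}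

lemma resample_of_ne {ω : ℕ → ℕ} {j : ℕ} (hj : j ≠ k + 1) : resample h k ψ ω j = ω j :=
  Function.update_of_ne hj _ _

@[simp] lemma resample_self {ω : ℕ → ℕ} :
    resample h k ψ ω (k + 1) = ψ (ω k) (min (ω (k + 2)) (h (k + 1))) (ω (k + 1)) :=
  Function.update_self _ _ _

@[simp] lemma resample_left {ω : ℕ → ℕ} : resample h k ψ ω k = ω k :=
  resample_of_ne (by omega)

@[simp] lemma resample_right {ω : ℕ → ℕ} : resample h k ψ ω (k + 2) = ω (k + 2) :=
  resample_of_ne (by omega)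

lemma le_site {ω : ℕ → ℕ} (hω : ω ∈ paths m h) : ω k ≤ ω (k + 1) :=
  (mem_paths.1 hω).1 (by omega)

lemma site_le {ω : ℕ → ℕ} (hω : ω ∈ paths m h) :
    ω (k + 1) ≤ min (ω (k + 2)) (h (k + 1)) :=
  le_min ((mem_paths.1 hω).1 (by omega)) ((mem_paths.1 hω).2.1 _)

lemma resample_mem (hk : k < m) (hψ : ∀ p q x, p ≤ x → x ≤ q → p ≤ ψ p q x ∧ ψ p q x ≤ q)
    {ω : ℕ → ℕ} (hω : ω ∈ paths m h) : resample h k ψ ω ∈ paths m h := by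
  obtain ⟨h1, h2⟩ := hψ _ _ _ (le_site hω (k := k)) (site_le hω)
  obtain ⟨h2, h3⟩ := le_min_iff.1 h2
  rw [mem_paths] at *
  refine ⟨monotone_nat_of_le_succ fun j => ?_, fun j => ?_, fun j hj => ?_⟩
  · by_cases hj : j = k
    · subst hj; simpa using h1
    · by_cases hj' : j = k + 1
      · subst hj'; simpa using h2
      · rw [resample_of_ne hj', resample_of_ne (by omega)]
        exact hω.1 (by omega)
  · by_cases hj' : j = k + 1
    · subst hj'; simpa using h3
    · rw [resample_of_ne hj']
      exact hω.2.1 j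
  · rw [resample_of_ne (by omega)]
    exact hω.2.2 j hj

lemma mean_resample (hk : k < m)
    (hψ : ∀ p q x, p ≤ x → x ≤ q → p ≤ ψ p q x ∧ ψ p q x ≤ q)
    (hinj : ∀ p q x y, p ≤ x → x ≤ q → p ≤ y → y ≤ q → ψ p q x = ψ p q y → x = y) :
    mean m h (fun ω => F (resample h k ψ ω)) = mean m h F := by
  have hmaps : Set.MapsTo (resample h k ψ) (paths m h : Set (ℕ → ℕ)) (paths m h) :=
    fun ω hω => resample_mem hk hψ hω
  have hinjOn : Set.InjOn (resample h k ψ) (paths m h : Set (ℕ → ℕ)) := by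
    intro ω hω ω' hω' he
    have hne : ∀ j, j ≠ k + 1 → ω j = ω' j := fun j hj => by
      rw [← resample_of_ne (h := h) (ψ := ψ) (ω := ω) hj, he, resample_of_ne hj]
    have hs := congrFun he (k + 1)
    rw [resample_self, resample_self, ← hne k (by omega), ← hne (k + 2) (by omega)] at hs
    funext j
    by_cases hj : j = k + 1
    · subst hj
      refine hinj _ _ _ _ (le_site hω) (site_le hω) ?_ ?_ hs
      · rw [hne k (by omega)]; exact le_site hω'
      · rw [hne (k + 2) (by omega)]; exact site_le hω'
    · exact hne j hj
  rw [mean, mean]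
  congr 1
  exact sum_nbij (resample h k ψ) hmaps hinjOn
    (surjOn_of_injOn_of_card_le _ hmaps hinjOn le_rfl) fun _ _ => rfl

lemma mean_reflect (hk : k < m) :
    mean m h (fun ω => F (resample h k (fun p q x => p + q - x) ω)) = mean m h F :=
  mean_resample hk (by intros; omega) (by intros; omega)

/-- The cyclic rotation of `[p, q]` by half its length. -/
def rotate (p q x : ℕ) : ℕ :=
  if x + (q - p + 1) / 2 ≤ q then x + (q - p + 1) / 2
  else x + (q - p + 1) / 2 - (q - p + 1)

lemma mean_rotate (hk : k < m) :
    mean m h (fun ω => F (resample h k rotate ω)) = mean m h F :=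
  mean_resample hk (by intro p q x h1 h2; unfold rotate; split_ifs <;> omega)
    (by intro p q x y h1 h2 h3 h4; unfold rotate; split_ifs <;> omega)

end resample

/-- The mean height of a random path at `k`. -/
noncomputable def height (m : ℕ) (h : ℕ → ℕ) (k : ℕ) : ℝ := mean m h fun ω => ω k

/-- The variance of the height of a random path at `k`. -/
noncomputable def heightVar (m : ℕ) (h : ℕ → ℕ) (k : ℕ) : ℝ :=
  mean m h fun ω => ((ω k : ℝ) - height m h k) ^ 2

/-- The increment of the mean height from `k` to `k + 1`. -/
noncomputable def slope (m : ℕ) (h : ℕ → ℕ) (k : ℕ) : ℝ := height m h (k + 1) - height m h k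

/-- Twice the deviation of `ω (k + 1)` from the midpoint of its allowed interval. -/
def deviation (h : ℕ → ℕ) (k : ℕ) (ω : ℕ → ℕ) : ℝ :=
  2 * ω (k + 1) - (ω k + (min (ω (k + 2)) (h (k + 1)) : ℕ))

/-- The reflection of `ω (k + 1)` in its allowed interval. -/
def reflect (h : ℕ → ℕ) (k : ℕ) (ω : ℕ → ℕ) : ℕ → ℕ := resample h k (fun p q x => p + q - x) ω

section moments
variable {m k : ℕ} {h : ℕ → ℕ}

lemma reflect_self {ω : ℕ → ℕ} (hω : ω ∈ paths m h) :
    (reflect h k ω (k + 1) : ℝ) =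
      ω k + (min (ω (k + 2)) (h (k + 1)) : ℕ) - ω (k + 1) := by
  rw [reflect, resample_self, Nat.cast_sub (by have := site_le hω (k := k); omega), Nat.cast_add]

lemma deviation_eq {ω : ℕ → ℕ} (hω : ω ∈ paths m h) :
    deviation h k ω = ω (k + 1) - reflect h k ω (k + 1) := by
  rw [reflect_self hω, deviation]
  ring

lemma mean_deviation_mul (hk : k < m) (F : (ℕ → ℕ) → ℝ) :
    mean m h (fun ω => deviation h k ω * F ω) =
      1 / 2 * mean m h (fun ω => deviation h k ω * (F ω - F (reflect h k ω))) := by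
  have h1 : mean m h (fun ω => deviation h k ω * F ω) =
      -1 * mean m h (fun ω => deviation h k ω * F (reflect h k ω)) := by
    rw [← mean_reflect hk, ← mean_const_mul]
    refine mean_congr fun ω hω => ?_
    have h2 := reflect_self (k := k) hω
    have h3 : deviation h k (reflect h k ω) = -deviation h k ω := by
      rw [deviation, h2, deviation, reflect, resample_left, resample_right]
      ring
    change deviation h k (reflect h k ω) * F (reflect h k ω) = _
    rw [h3]
    ring
  simp only [mul_sub]
  rw [mean_sub]
  linarith

lemma mean_deviation (hk : k < m) : mean m h (deviation h k) = 0 := by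
  have := mean_deviation_mul (h := h) hk (fun _ => 1)
  simpa [mean] using this

/-- The amount by which `ω (k + 2)` exceeds the bound at `k + 1`. -/
def overflow (h : ℕ → ℕ) (k : ℕ) (ω : ℕ → ℕ) : ℝ := (ω (k + 2) - h (k + 1) : ℕ)

lemma overflow_nonneg (ω : ℕ → ℕ) : 0 ≤ overflow h k ω := Nat.cast_nonneg _

lemma deviation_eq_overflow (ω : ℕ → ℕ) :
    deviation h k ω = 2 * ω (k + 1) - ω k - ω (k + 2) + overflow h k ω := by
  have : min (ω (k + 2)) (h (k + 1)) + (ω (k + 2) - h (k + 1)) = ω (k + 2) := by omega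
  have : ((min (ω (k + 2)) (h (k + 1)) : ℕ) : ℝ) + (ω (k + 2) - h (k + 1) : ℕ) = ω (k + 2) := by
    exact_mod_cast this
  rw [deviation, overflow]
  linarith

lemma mean_overflow (hk : k < m) :
    mean m h (overflow h k) = slope m h (k + 1) - slope m h k := by
  have h1 := mean_deviation (h := h) hk
  have h2 : mean m h (deviation h k) = 2 * height m h (k + 1) - height m h k - height m h (k + 2)
      + mean m h (overflow h k) := by
    simp only [height]
    rw [← mean_const_mul, ← mean_sub, ← mean_sub, ← mean_add]
    exact mean_congr fun ω _ => deviation_eq_overflow ω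
  simp only [slope]
  linarith

lemma slope_le_succ (hk : k < m) : slope m h k ≤ slope m h (k + 1) := by
  have := mean_overflow (h := h) hk
  have : 0 ≤ mean m h (overflow h k) := mean_nonneg fun ω _ => overflow_nonneg ω
  linarith

lemma slope_mono {j : ℕ} (hjk : j ≤ k) (hk : k ≤ m) : slope m h j ≤ slope m h k := by
  induction k, hjk using Nat.le_induction with
  | base => rfl
  | succ k hjk ih => exact (ih (by omega)).trans (slope_le_succ (by omega))

lemma slope_nonneg : 0 ≤ slope m h k := by
  have : height m h k ≤ height m h (k + 1) :=
    mean_mono fun ω hω => by exact_mod_cast le_site hω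
  simp only [slope]
  linarith

lemma height_nonneg : 0 ≤ height m h k := mean_nonneg fun _ _ => Nat.cast_nonneg _

lemma height_le (hh : Monotone h) : height m h k ≤ h k := by
  rw [← mean_const (m := m) hh (h k : ℝ)]
  exact mean_mono fun ω hω => by exact_mod_cast (mem_paths.1 hω).2.1 k

lemma height_add_le {n p : ℕ} (hp : n + p ≤ m) :
    height m h (n + p + 1) ≤ height m h n + (p + 1) * slope m h (n + p) := by
  induction p with
  | zero => simp [slope]
  | succ p ih =>
    have h1 := slope_le_succ (m := m) (h := h) (k := n + p) (by omega)
    have h2 := ih (by omega)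
    have h3 : slope m h (n + p + 1) = height m h (n + p + 1 + 1) - height m h (n + p + 1) := rfl
    rw [show n + (p + 1) = n + p + 1 by ring]
    push_cast
    nlinarith [mul_le_mul_of_nonneg_left h1 (by positivity : (0 : ℝ) ≤ p + 1)]

lemma le_height_add {n p : ℕ} (hp : n + p ≤ m + 1) :
    height m h n + p * slope m h n ≤ height m h (n + p) := by
  induction p with
  | zero => simp
  | succ p ih =>
    have h1 := slope_mono (m := m) (h := h) (j := n) (k := n + p) (by omega) (by omega)
    have h2 := ih (by omega)
    have h3 : slope m h (n + p) = height m h (n + p + 1) - height m h (n + p) := rfl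
    rw [show n + (p + 1) = n + p + 1 by ring]
    push_cast
    linarith

/-- The length of the interval allowed for `ω (k + 1)`. -/
def gap (h : ℕ → ℕ) (k : ℕ) (ω : ℕ → ℕ) : ℝ := (min (ω (k + 2)) (h (k + 1)) - ω k : ℕ)

lemma mean_gap (hk : k < m) : mean m h (gap h k) = 2 * slope m h k := by
  have h1 := mean_deviation (h := h) hk
  have h2 : mean m h (gap h k) =
      2 * height m h (k + 1) - 2 * height m h k - mean m h (deviation h k) := by
    simp only [height]
    rw [← mean_const_mul, ← mean_const_mul, ← mean_sub, ← mean_sub]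
    refine mean_congr fun ω hω => ?_
    rw [gap, Nat.cast_sub ((le_site hω).trans (site_le hω)), deviation]
    ring
  simp only [slope]
  linarith

lemma gap_le_rotate {ω : ℕ → ℕ} (hω : ω ∈ paths m h) :
    gap h k ω ≤ 2 * |(ω (k + 1) : ℝ) - resample h k rotate ω (k + 1)| := by
  have h1 := le_site hω (k := k)
  have h2 := site_le hω (k := k)
  rw [resample_self, gap]
  generalize min (ω (k + 2)) (h (k + 1)) = q at *
  generalize ω k = p at *
  generalize ω (k + 1) = x at *
  have h3 : q - p + 2 * x ≤ 2 * rotate p q x ∨ q - p + 2 * rotate p q x ≤ 2 * x := by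
    unfold rotate
    split_ifs <;> omega
  rcases h3 with h3 | h3
  · have h4 : ((q - p : ℕ) : ℝ) + 2 * x ≤ 2 * rotate p q x := by exact_mod_cast h3
    rw [abs_sub_comm]
    linarith [le_abs_self ((rotate p q x : ℝ) - x)]
  · have h4 : ((q - p : ℕ) : ℝ) + 2 * rotate p q x ≤ 2 * x := by exact_mod_cast h3
    linarith [le_abs_self ((x : ℝ) - rotate p q x)]

lemma mean_gap_sq_le (hk : k < m) :
    mean m h (fun ω => gap h k ω ^ 2) ≤ 16 * heightVar m h (k + 1) := by
  set G := height m h (k + 1) with hG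
  have h1 : mean m h (fun ω => ((resample h k rotate ω (k + 1) : ℝ) - G) ^ 2) =
      heightVar m h (k + 1) :=
    mean_rotate (F := fun ω => ((ω (k + 1) : ℝ) - G) ^ 2) hk
  have h2 : mean m h (fun ω => gap h k ω ^ 2) ≤ mean m h (fun ω =>
      8 * ((ω (k + 1) : ℝ) - G) ^ 2 + 8 * ((resample h k rotate ω (k + 1) : ℝ) - G) ^ 2) := by
    refine mean_mono fun ω hω => ?_
    have h3 := gap_le_rotate (k := k) hω
    have h4 : 0 ≤ gap h k ω := Nat.cast_nonneg _
    have h5 := pow_le_pow_left₀ h4 h3 2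
    rw [mul_pow, sq_abs] at h5
    nlinarith [sq_nonneg (((ω (k + 1) : ℝ) - G) + ((resample h k rotate ω (k + 1) : ℝ) - G))]
  rw [mean_add, mean_const_mul, mean_const_mul, h1] at h2
  rw [heightVar, ← hG] at *
  linarith

lemma slope_sq_le (hh : Monotone h) (hk : k < m) :
    slope m h k ^ 2 ≤ 4 * heightVar m h (k + 1) := by
  have h1 := sq_mean_le (m := m) (F := gap h k) hh
  rw [mean_gap hk] at h1
  nlinarith [mean_gap_sq_le (h := h) hk]

lemma le_mean_deviation_ne (hk : k < m) {B c : ℝ} (hB : 0 < B)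
    (hvar : heightVar m h (k + 1) ≤ B) (hc : 0 < c) (hslope : c ≤ slope m h k) :
    c ^ 2 / (8 * B) ≤ mean m h (fun ω => if deviation h k ω ≠ 0 then 1 else 0) := by
  set I : (ℕ → ℕ) → ℝ := fun ω => if deviation h k ω ≠ 0 then 1 else 0 with hI
  set t := c / (8 * B) with ht
  have ht0 : 0 < t := by positivity
  have h1 : mean m h (fun ω => 2 * t * gap h k ω - t ^ 2 * gap h k ω ^ 2) ≤
      mean m h (fun ω => I ω + I (resample h k rotate ω)) := by
    refine mean_mono fun ω hω => ?_
    have hI0 : ∀ ω, 0 ≤ I ω := fun ω => by simp only [hI]; split_ifs <;> norm_num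
    rcases Nat.eq_zero_or_pos (min (ω (k + 2)) (h (k + 1)) - ω k) with hz | hz
    · rw [gap, hz]
      simpa using add_nonneg (hI0 ω) (hI0 _)
    · have h2 : 1 ≤ I ω + I (resample h k rotate ω) := by
        by_cases hd : deviation h k ω ≠ 0
        · have : I ω = 1 := if_pos hd
          linarith [hI0 (resample h k rotate ω)]
        · have hd' : deviation h k (resample h k rotate ω) ≠ 0 := by
            rw [not_not] at hd
            rw [deviation, sub_eq_zero] at hd
            rw [deviation, Ne, sub_eq_zero, resample_left, resample_right, resample_self]
            have h3 := le_site hω (k := k)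
            have h4 := site_le hω (k := k)
            generalize min (ω (k + 2)) (h (k + 1)) = q at *
            generalize ω k = p at *
            generalize ω (k + 1) = x at *
            have hd2 : 2 * x = p + q := by exact_mod_cast hd
            have h5 : 2 * rotate p q x ≠ p + q := by
              unfold rotate
              split_ifs <;> omega
            exact_mod_cast h5
          have : I (resample h k rotate ω) = 1 := if_pos hd'
          linarith [hI0 ω]
      nlinarith [sq_nonneg (t * gap h k ω - 1)]
  rw [mean_add, mean_rotate hk, mean_sub, mean_const_mul, mean_const_mul, mean_gap hk] at h1
  have h2 : t ^ 2 * mean m h (fun ω => gap h k ω ^ 2) ≤ t ^ 2 * (16 * B) :=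
    mul_le_mul_of_nonneg_left ((mean_gap_sq_le hk).trans (by linarith)) (sq_nonneg t)
  have h3 : t * c ≤ t * slope m h k := mul_le_mul_of_nonneg_left hslope ht0.le
  have h4 : t * c = c ^ 2 / (8 * B) := by rw [ht]; ring
  have h5 : t ^ 2 * (16 * B) = 2 * (c ^ 2 / (8 * B)) := by
    rw [ht]
    field_simp
    norm_num
  linarith

end moments

/-- The truncation of `x` to `[G - M, G + M]`, shifted to take values in `[0, 2 * M]`. -/
noncomputable def clip (G M x : ℝ) : ℝ := max 0 (min (x - (G - M)) (2 * M))

section clip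
variable {G M : ℝ}

lemma clip_nonneg (x : ℝ) : 0 ≤ clip G M x := le_max_left _ _

lemma clip_le (hM : 0 ≤ M) (x : ℝ) : clip G M x ≤ 2 * M := max_le (by linarith) (min_le_right _ _)

lemma clip_mono : Monotone (clip G M) := fun _ _ hxy =>
  max_le_max le_rfl (min_le_min (by linarith) le_rfl)

lemma clip_of_abs_le {x : ℝ} (hx : |x - G| ≤ M) : clip G M x = x - (G - M) := by
  rw [abs_le] at hx
  rw [clip, min_eq_left (by linarith), max_eq_right (by linarith)]

lemma sub_mul_clip_le (hM : 0 ≤ M) (x : ℝ) : (x - G) * (clip G M x - M) ≤ (x - G) ^ 2 := by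
  unfold clip
  rcases max_cases 0 (min (x - (G - M)) (2 * M)) with h1 | h1 <;>
  rcases min_cases (x - (G - M)) (2 * M) with h2 | h2 <;> nlinarith

lemma le_sub_mul_clip_sub (hM : 0 < M) (x y : ℕ) :
    (if (x : ℝ) - y ≠ 0 then 1 else 0) - (((x : ℝ) - G) ^ 2 / M ^ 2 + ((y : ℝ) - G) ^ 2 / M ^ 2) ≤
      ((x : ℝ) - y) * (clip G M x - clip G M y) := by
  have hnn : 0 ≤ ((x : ℝ) - y) * (clip G M x - clip G M y) := by
    rcases le_total (x : ℝ) y with hxy | hxy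
    · exact mul_nonneg_of_nonpos_of_nonpos (by linarith) (by linarith [clip_mono (G := G) (M := M) hxy])
    · exact mul_nonneg (by linarith) (by linarith [clip_mono (G := G) (M := M) hxy])
  have hite : (if (x : ℝ) - y ≠ 0 then (1 : ℝ) else 0) ≤ 1 := by split_ifs <;> norm_num
  have hfar : ∀ z : ℝ, ¬ |z - G| ≤ M → 1 ≤ (z - G) ^ 2 / M ^ 2 := fun z hz => by
    rw [one_le_div (by positivity), ← sq_abs (z - G)]
    exact pow_le_pow_left₀ hM.le (not_le.1 hz).le 2
  have hx0 : 0 ≤ ((x : ℝ) - G) ^ 2 / M ^ 2 := by positivity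
  have hy0 : 0 ≤ ((y : ℝ) - G) ^ 2 / M ^ 2 := by positivity
  by_cases hx : |(x : ℝ) - G| ≤ M
  · by_cases hy : |(y : ℝ) - G| ≤ M
    · rw [clip_of_abs_le hx, clip_of_abs_le hy]
      split_ifs with hxy
      · have h1 : (1 : ℤ) ≤ ((x : ℤ) - y) ^ 2 := by
          have h2 : (x : ℤ) - y ≠ 0 := by exact_mod_cast hxy
          have := sq_nonneg ((x : ℤ) - y)
          have : ((x : ℤ) - y) ^ 2 ≠ 0 := pow_ne_zero 2 h2
          omega
        have h3 : (1 : ℝ) ≤ ((x : ℝ) - y) ^ 2 := by exact_mod_cast h1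
        nlinarith
      · nlinarith [sq_nonneg ((x : ℝ) - y)]
    · linarith [hfar _ hy]
  · linarith [hfar _ hx]

end clip

/-- The covariance of `F` and `H` over a uniformly random path. -/
noncomputable def cov (m : ℕ) (h : ℕ → ℕ) (F H : (ℕ → ℕ) → ℝ) : ℝ :=
  mean m h (fun ω => F ω * H ω) - mean m h F * mean m h H

lemma concave_with_kink {e : ℕ → ℝ} {V : ℝ} {i T : ℕ} (hT : T ≤ i)
    (hkink : ∀ k, k + 1 = i → e k + e (k + 2) ≤ 2 * e (k + 1) - V)
    (hconc : ∀ k, k + 1 ≠ i → k + 1 < i + T → e k + e (k + 2) ≤ 2 * e (k + 1)) :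
    e (i + T) + e (i - T) ≤ 2 * e i - T * V := by
  have step : ∀ t, t < T → e (i + (t + 1)) + e (i - (t + 1)) ≤ e (i + t) + e (i - t) - V := by
    intro t
    induction t with
    | zero =>
      intro ht
      obtain ⟨k, rfl⟩ : ∃ k, i = k + 1 := ⟨i - 1, by omega⟩
      have := hkink k rfl
      simp only [zero_add, add_zero, Nat.sub_zero, Nat.add_sub_cancel]
      rw [show k + 1 + 1 = k + 2 by ring]
      linarith
    | succ t ih =>
      intro ht
      have h1 := hconc (i + t) (by omega) (by omega)
      have h2 := hconc (i - (t + 2)) (by omega) (by omega)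
      rw [show i - (t + 2) + 2 = i - t by omega, show i - (t + 2) + 1 = i - (t + 1) by omega] at h2
      have h3 := ih (by omega)
      rw [show i + (t + 1 + 1) = i + t + 2 by ring, show t + 1 + 1 = t + 2 by ring]
      rw [show i + (t + 1) = i + t + 1 by ring] at *
      linarith
  have total : ∀ t, t ≤ T → e (i + t) + e (i - t) ≤ 2 * e i - t * V := by
    intro t
    induction t with
    | zero => intro _; simp; linarith
    | succ t ih =>
      intro ht
      have h1 := step t (by omega)
      have h2 := ih (by omega)
      push_cast
      linarith
  exact total T le_rfl

section window
variable {m : ℕ} {h : ℕ → ℕ}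

lemma two_mul_cov_succ {k : ℕ} (hk : k < m) (F : (ℕ → ℕ) → ℝ) :
    2 * cov m h (fun ω => ω (k + 1)) F - cov m h (fun ω => ω k) F
      - cov m h (fun ω => ω (k + 2)) F + cov m h (overflow h k) F =
    1 / 2 * mean m h (fun ω => deviation h k ω * (F ω - F (reflect h k ω))) := by
  rw [← mean_deviation_mul hk]
  have h1 : mean m h (fun ω => deviation h k ω * F ω) =
      2 * mean m h (fun ω => ω (k + 1) * F ω) - mean m h (fun ω => ω k * F ω)
      - mean m h (fun ω => ω (k + 2) * F ω) + mean m h (fun ω => overflow h k ω * F ω) := by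
    rw [← mean_const_mul, ← mean_sub, ← mean_sub, ← mean_add]
    refine mean_congr fun ω _ => ?_
    rw [deviation_eq_overflow]
    ring
  have h2 := mean_overflow (h := h) hk
  simp only [slope, height] at h2
  simp only [cov]
  rw [h1, h2, show k + 1 + 1 = k + 2 by ring]
  ring

lemma cov_le_of_bounded {F H : (ℕ → ℕ) → ℝ} {c : ℝ} (hF : ∀ ω, 0 ≤ F ω)
    (hH0 : ∀ ω, 0 ≤ H ω) (hH : ∀ ω, H ω ≤ c) : cov m h F H ≤ c * mean m h F := by
  have h1 : mean m h (fun ω => F ω * H ω) ≤ c * mean m h F := by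
    rw [← mean_const_mul]
    exact mean_mono fun ω _ => by nlinarith [hF ω, hH ω]
  have h2 := mul_nonneg (mean_nonneg (m := m) (h := h) fun ω _ => hF ω)
    (mean_nonneg (m := m) (h := h) fun ω _ => hH0 ω)
  rw [cov]
  linarith

lemma cov_clip_nonneg (hh : Monotone h) (i j : ℕ) (G M : ℝ) :
    0 ≤ cov m h (fun ω => ω j) (fun ω => clip G M (ω i)) :=
  sub_nonneg.2 (mean_mul_mean_le hh (fun _ => Nat.cast_nonneg _) (fun _ => clip_nonneg _)
    (fun _ _ hω => Nat.cast_le.2 (hω j)) fun _ _ hω => clip_mono (Nat.cast_le.2 (hω i)))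

lemma cov_clip_self_le (hh : Monotone h) (i : ℕ) {M : ℝ} (hM : 0 ≤ M) :
    cov m h (fun ω => ω i) (fun ω => clip (height m h i) M (ω i)) ≤ heightVar m h i := by
  set G := height m h i with hG
  have h1 : mean m h (fun ω => ((ω i : ℝ) - G) * (clip G M (ω i) - M)) ≤ heightVar m h i :=
    mean_mono fun ω _ => sub_mul_clip_le hM _
  have h2 : mean m h (fun ω => ((ω i : ℝ) - G) * (clip G M (ω i) - M)) =
      mean m h (fun ω => (ω i : ℝ) * clip G M (ω i)) - G * mean m h (fun ω => clip G M (ω i))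
        - M * mean m h (fun ω => (ω i : ℝ)) + mean m h (fun _ => M * G) := by
    rw [← mean_const_mul, ← mean_const_mul, ← mean_sub, ← mean_sub, ← mean_add]
    exact mean_congr fun ω _ => by ring
  rw [mean_const hh, show mean m h (fun ω => (ω i : ℝ)) = G from rfl] at h2
  rw [cov]
  change _ - G * _ ≤ _
  linarith

/-- A site whose height has bounded variance, in a window where the slope is bounded below, forces
the slope to increase across that window. -/
lemma window_bound (hh : Monotone h) {k T : ℕ} (hk : k < m) (hTk : T ≤ k) (hTm : k + 1 + T ≤ m)
    {B c : ℝ} (hB : 0 < B) (hvar : heightVar m h (k + 1) ≤ B) (hc : 0 < c)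
    (hslope : c ≤ slope m h k) :
    T * (c ^ 2 / (64 * B)) ≤
      B + 8 * B / c * (T * (slope m h (k + 1 + T) - slope m h (k + 1 - T))) := by
  set i := k + 1 with hi
  set G := height m h i with hG
  set M := 8 * B / c with hM
  have hM0 : 0 < M := by positivity
  set φ : (ℕ → ℕ) → ℝ := fun ω => clip G M (ω i) with hφ
  set C : ℕ → ℝ := fun j => cov m h (fun ω => ω j) φ with hC
  have hover : ∀ j, j < m → cov m h (overflow h j) φ ≤
      2 * M * (height m h (j + 2) + height m h j - 2 * height m h (j + 1)) := by
    intro j hj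
    refine (cov_le_of_bounded (fun ω => overflow_nonneg ω) (fun ω => clip_nonneg _)
      fun ω => clip_le hM0.le _).trans_eq ?_
    rw [mean_overflow hj, slope, slope]
    ring
  have hkink : c ^ 2 / (32 * B) ≤
      1 / 2 * mean m h (fun ω => deviation h k ω * (φ ω - φ (reflect h k ω))) := by
    have h1 := le_mean_deviation_ne hk hB hvar hc hslope
    have h2 : mean m h (fun ω => (if deviation h k ω ≠ 0 then 1 else 0) -
        ((1 / M ^ 2) * ((ω i : ℝ) - G) ^ 2 + (1 / M ^ 2) * ((reflect h k ω i : ℝ) - G) ^ 2)) ≤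
        mean m h (fun ω => deviation h k ω * (φ ω - φ (reflect h k ω))) := by
      refine mean_mono fun ω hω => ?_
      rw [deviation_eq hω]
      have := le_sub_mul_clip_sub (G := G) hM0 (ω i) (reflect h k ω i)
      refine le_trans (le_of_eq ?_) this
      ring
    have h3 : mean m h (fun ω => ((reflect h k ω i : ℝ) - G) ^ 2) = heightVar m h i :=
      mean_reflect (F := fun ω => ((ω i : ℝ) - G) ^ 2) hk
    rw [mean_sub, mean_add, mean_const_mul, mean_const_mul, h3] at h2
    change _ - (1 / M ^ 2 * heightVar m h i + _) ≤ _ at h2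
    have h4 : 1 / M ^ 2 * heightVar m h i ≤ c ^ 2 / (64 * B) := by
      refine (mul_le_mul_of_nonneg_left hvar (by positivity)).trans_eq ?_
      rw [hM]
      field_simp
      norm_num
    have h5 : c ^ 2 / (32 * B) = c ^ 2 / B / 32 := by field_simp
    have h6 : c ^ 2 / (64 * B) = c ^ 2 / B / 64 := by field_simp
    have h7 : c ^ 2 / (8 * B) = c ^ 2 / B / 8 := by field_simp
    have h8 : 0 ≤ c ^ 2 / B := by positivity
    rw [h5]
    rw [h6] at h4
    rw [h7] at h1
    linarith
  have hconc := concave_with_kink (e := fun j => C j - 2 * M * height m h j)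
    (V := c ^ 2 / (32 * B)) (i := i) (T := T) (by omega)
    (fun j hj => by
      obtain rfl : j = k := by omega
      have h1 := two_mul_cov_succ (h := h) hk φ
      have h2 := hover j hk
      simp only [hC]
      linarith)
    (fun j hj hjT => by
      have hjm : j < m := by omega
      have h1 := two_mul_cov_succ (h := h) hjm φ
      have h2 := hover j hjm
      have h3 : ∀ ω, φ (reflect h j ω) = φ ω := fun ω => by
        simp only [hφ, reflect]
        rw [resample_of_ne (Ne.symm hj)]
      simp only [h3, sub_self, mul_zero] at h1
      rw [show mean m h (fun _ => (0 : ℝ)) = 0 by simp [mean]] at h1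
      simp only [hC]
      linarith)
  have hCi : C i ≤ B := (cov_clip_self_le hh i hM0.le).trans hvar
  have hCr : 0 ≤ C (i + T) := cov_clip_nonneg hh _ _ _ _
  have hCl : 0 ≤ C (i - T) := cov_clip_nonneg hh _ _ _ _
  have hr : height m h (i + T) ≤ height m h i + T * slope m h (i + T) := by
    rcases T with _ | T
    · simp
    · have h1 := height_add_le (m := m) (h := h) (n := i) (p := T) (by omega)
      have h2 := slope_mono (m := m) (h := h) (j := i + T) (k := i + T + 1) (by omega) (by omega)
      rw [← add_assoc]
      push_cast
      nlinarith [mul_le_mul_of_nonneg_left h2 (by positivity : (0 : ℝ) ≤ T + 1)]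
  have hl := le_height_add (m := m) (h := h) (n := i - T) (p := T) (by omega)
  rw [show i - T + T = i by omega] at hl
  have h9 : c ^ 2 / (32 * B) = 2 * (c ^ 2 / (64 * B)) := by field_simp; norm_num
  rw [h9] at hconc
  nlinarith

end window

section slope_bound
variable {m : ℕ} {h : ℕ → ℕ}

lemma mul_le_mul_height (hh : Monotone h) {k₀ k b : ℕ} (hk₀ : k₀ ≤ k) (hk : k < m)
    (hb : b ≤ h (k₀ + 1)) :
    ((k : ℝ) - k₀ + 1) * b ≤ ((m : ℝ) - k₀ + 1) * height m h (k + 1) := by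
  set h' : ℕ → ℕ := fun j => min (h j) b with hh'
  have hmono : Monotone h' := fun i j hij => min_le_min (hh hij) le_rfl
  have hle : height m h' (k + 1) ≤ height m h (k + 1) :=
    mean_mono_bound hh hmono (fun j => min_le_left _ _) (fun _ => Nat.cast_nonneg _)
      fun _ _ hω => Nat.cast_le.2 (hω _)
  have hb' : ∀ j, k₀ < j → h' j = b := fun j hj => min_eq_right (hb.trans (hh hj))
  have hslope : ∀ p, k₀ + p ≤ m → slope m h' (k₀ + p) = slope m h' k₀ := by
    intro p
    induction p with
    | zero => simp
    | succ p ih =>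
      intro hp
      have h1 := mean_overflow (h := h') (m := m) (k := k₀ + p) (by omega)
      have h2 : mean m h' (overflow h' (k₀ + p)) = 0 := by
        rw [← mean_const (m := m) hmono 0]
        refine mean_congr fun ω hω => ?_
        have h3 := (mem_paths.1 hω).2.1 (k₀ + p + 2)
        rw [hb' _ (by omega)] at h3
        rw [overflow, hb' _ (by omega), Nat.sub_eq_zero_of_le h3, Nat.cast_zero]
      rw [← add_assoc]
      linarith [ih (by omega)]
  have hend : height m h' (m + 1) = b := by
    rw [← mean_const (m := m) hmono (b : ℝ)]
    refine mean_congr fun ω hω => ?_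
    rw [(mem_paths.1 hω).2.2 _ (by omega), hb' _ (by omega)]
  obtain ⟨p, rfl⟩ := Nat.exists_eq_add_of_le hk₀
  obtain ⟨r, rfl⟩ := Nat.exists_eq_add_of_lt hk
  have hup := height_add_le (m := k₀ + p + r + 1) (h := h') (n := k₀) (p := p + r + 1) (by omega)
  rw [hslope _ (by omega), show k₀ + (p + r + 1) + 1 = k₀ + p + r + 1 + 1 by ring, hend] at hup
  have hlow := le_height_add (m := k₀ + p + r + 1) (h := h') (n := k₀) (p := p + 1) (by omega)
  have h0 : 0 ≤ height (k₀ + p + r + 1) h' k₀ := height_nonneg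
  rw [← add_assoc] at hlow
  push_cast at *
  have hp0 : (0 : ℝ) ≤ p := p.cast_nonneg
  have hr0 : (0 : ℝ) ≤ r := r.cast_nonneg
  have h1 := mul_le_mul_of_nonneg_left hup (by positivity : (0 : ℝ) ≤ p + 1)
  have h2 := mul_le_mul_of_nonneg_left (hlow.trans hle) (by positivity : (0 : ℝ) ≤ p + r + 1 + 1)
  have h3 : (0 : ℝ) ≤ (r + 1) * height (k₀ + p + r + 1) h' k₀ := by positivity
  linarith

lemma height_le_mul_slope (hh : Monotone h) (h0 : h 0 = 0) {k p : ℕ} {W : ℝ} (hk : k < m)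
    (hp : 0 < p) (hW : 0 ≤ W) (hbound : p ≤ k → h (k - p + 1) ≤ W) :
    height m h (k + 1) ≤ W + p * slope m h k := by
  rcases le_or_gt p k with hpk | hpk
  · have h1 := height_add_le (m := m) (h := h) (n := k - p + 1) (p := p - 1) (by omega)
    rw [show k - p + 1 + (p - 1) = k by omega, Nat.cast_sub hp] at h1
    have h2 := (height_le (m := m) hh (k := k - p + 1)).trans (hbound hpk)
    push_cast at h1
    linarith
  · have h1 := height_add_le (m := m) (h := h) (n := 0) (p := k) (by omega)
    rw [zero_add] at h1
    have h2 := height_le (m := m) hh (k := 0)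
    rw [h0, Nat.cast_zero] at h2
    have h3 : ((k : ℝ) + 1) * slope m h k ≤ p * slope m h k :=
      mul_le_mul_of_nonneg_right (by exact_mod_cast hpk) slope_nonneg
    linarith

/-- If the bounding sequence lies below a hyperbola, the mean path is not too flat. -/
lemma le_mul_slope (hh : Monotone h) (h0 : h 0 = 0) {μ a : ℝ} {k₀ k b : ℕ} (hμ : 0 < μ)
    (hμ1 : μ ≤ 1) (ha : 1 ≤ a) (hb0 : 0 < b) (hk₀ : k₀ ≤ k) (hk : k < m) (hb : b ≤ h (k₀ + 1))
    (hhyp : ∀ k < m, μ * (((m : ℝ) - k) * h (k + 1)) ≤ a * b)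
    (hak : a ≤ 4 * ((k : ℝ) - k₀ + 1)) :
    μ ^ 3 * b ≤ 272 * a * slope m h k := by
  have hbR : (0 : ℝ) < b := by exact_mod_cast hb0
  have hkR : (k : ℝ) < m := by exact_mod_cast hk
  have hk₀R : (k₀ : ℝ) ≤ k := by exact_mod_cast hk₀
  have hN : μ * ((m : ℝ) - k₀ + 1) ≤ 2 * a := by
    have h1 := hhyp k₀ (by omega)
    have h2 : μ * ((m : ℝ) - k₀) * b ≤ a * b := by
      refine le_trans ?_ h1
      rw [mul_assoc]
      have : (b : ℝ) ≤ h (k₀ + 1) := by exact_mod_cast hb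
      gcongr
      linarith
    have h3 := le_of_mul_le_mul_right h2 hbR
    linarith
  have hH : μ * b ≤ 8 * height m h (k + 1) := by
    have h1 := mul_le_mul_height hh hk₀ hk hb
    have h2 : a / 4 * b ≤ ((k : ℝ) - k₀ + 1) * b := by
      gcongr
      linarith
    have h3 : μ * (((m : ℝ) - k₀ + 1) * height m h (k + 1)) ≤ 2 * a * height m h (k + 1) := by
      rw [← mul_assoc]
      exact mul_le_mul_of_nonneg_right hN height_nonneg
    have h4 := mul_le_mul_of_nonneg_left (h2.trans h1) hμ.le
    have h5 : a * (μ * b) ≤ a * (8 * height m h (k + 1)) := by linarith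
    exact le_of_mul_le_mul_left h5 (by linarith)
  set p := ⌈16 * a / μ ^ 2⌉₊ with hp
  have hp0 : 0 < p := Nat.ceil_pos.2 (by positivity)
  have hple : 16 * a / μ ^ 2 ≤ p := Nat.le_ceil _
  have hple' : (p : ℝ) ≤ 17 * a / μ ^ 2 := by
    have h1 := (Nat.ceil_lt_add_one (a := 16 * a / μ ^ 2) (by positivity)).le
    have h2 : 1 ≤ a / μ ^ 2 := by
      rw [one_le_div (by positivity)]
      exact (pow_le_one₀ hμ.le hμ1).trans ha
    calc (p : ℝ) ≤ 16 * a / μ ^ 2 + 1 := h1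
      _ ≤ 16 * a / μ ^ 2 + a / μ ^ 2 := by linarith
      _ = 17 * a / μ ^ 2 := by ring
  have hmain := height_le_mul_slope (m := m) (p := p) (W := μ * b / 16) hh h0 hk hp0 (by positivity)
    (fun hpk => by
      have h1 := hhyp (k - p) (by omega)
      rw [Nat.cast_sub hpk] at h1
      have h2 : 16 * a / μ ^ 2 ≤ (m : ℝ) - (k - p) := by linarith
      have h3 : μ * (16 * a / μ ^ 2 * h (k - p + 1)) ≤ a * b := by
        refine le_trans ?_ h1
        gcongr
      have h4 : μ * (16 * a / μ ^ 2 * h (k - p + 1)) = a * (16 * h (k - p + 1)) / μ := by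
        field_simp
      rw [h4, div_le_iff₀ hμ, mul_assoc] at h3
      have h5 := le_of_mul_le_mul_left h3 (by linarith)
      linarith)
  have h1 : (p : ℝ) * slope m h k ≤ 17 * a / μ ^ 2 * slope m h k :=
    mul_le_mul_of_nonneg_right hple' slope_nonneg
  have h2 : μ * b ≤ 16 * (17 * a / μ ^ 2 * slope m h k) := by linarith
  have h3 : 16 * (17 * a / μ ^ 2 * slope m h k) = 272 * a * slope m h k / μ ^ 2 := by ring
  rw [h3, le_div_iff₀ (by positivity)] at h2
  linarith

end slope_bound

lemma sum_shift_sub_le {f : ℕ → ℝ} {S : ℝ} {n p : ℕ} (hf : ∀ j, 0 ≤ f j)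
    (hS : ∀ j < n + p, f j ≤ S) : ∑ j ∈ range n, (f (j + p) - f j) ≤ p * S := by
  induction p with
  | zero => simp
  | succ p ih =>
    have h1 := ih fun j hj => hS j (by omega)
    have h2 : ∑ j ∈ range n, (f (j + (p + 1)) - f j) =
        ∑ j ∈ range n, (f (j + p) - f j) + (f (n + p) - f p) := by
      have h3 := sum_range_sub (fun j => f (j + p)) n
      rw [zero_add] at h3
      rw [← h3, ← sum_add_distrib]
      refine sum_congr rfl fun j _ => ?_
      rw [show j + (p + 1) = j + 1 + p by ring]
      ring
    have h3 := hS (n + p) (by omega)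
    have h4 := hf p
    rw [h2]
    push_cast
    linarith

/-- The sum of the height variances along a set of sites. -/
theorem exists_le_sum_heightVar {μ : ℝ} (hμ : 0 < μ) (L : ℝ) : ∃ K : ℝ, ∀ (m : ℕ) (h : ℕ → ℕ),
    Monotone h → h 0 = 0 → ∀ (A : Finset ℕ) (b : ℕ), A ⊆ range m → (∀ k ∈ A, b ≤ h (k + 1)) →
      (∀ k < m, μ * (((m : ℝ) - k) * h (k + 1)) ≤ #A * b) → μ * #A ≤ b → K ≤ b →
      L * #A ≤ ∑ k ∈ A, heightVar m h (k + 1) := by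
  set B : ℝ := 2 * max L 1 with hB
  have hB2 : 2 ≤ B := by linarith [le_max_right L 1]
  set S : ℝ := 4 * B + 1 with hS
  set c : ℝ := μ ^ 4 / 272 with hc
  have hc0 : 0 < c := by positivity
  set q : ℝ := c ^ 2 / (64 * B) with hq
  have hq0 : 0 < q := by positivity
  set T : ℕ := ⌈2 * B / q⌉₊ with hT
  have hT0 : 0 < T := Nat.ceil_pos.2 (by positivity)
  have hTR : (0 : ℝ) < T := by exact_mod_cast hT0
  have hTq : 2 * B ≤ T * q := by
    rw [← div_le_iff₀ hq0]
    exact Nat.le_ceil _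
  set η : ℝ := q * c / (16 * B) with hη
  have hη0 : 0 < η := by positivity
  set Q : ℝ := 4 * (2 * T + 1 + 2 * T * S / η) with hQ
  have hQ0 : 0 < Q := by positivity
  refine ⟨272 * S / μ ^ 3 * Q, fun m h hh h0 A b hA hAb hhyp hab hKb => ?_⟩
  rcases A.eq_empty_or_nonempty with rfl | hne
  · simp
  have hbR : (0 : ℝ) < b := lt_of_lt_of_le (by positivity) hKb
  have hb0 : 0 < b := by exact_mod_cast hbR
  have hcard : 0 < #A := hne.card_pos
  have hcard1 : (1 : ℝ) ≤ #A := by exact_mod_cast hcard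
  set k₀ := A.min' hne with hk₀
  have hk₀A : k₀ ∈ A := A.min'_mem hne
  have hk₀le : ∀ k ∈ A, k₀ ≤ k := fun k hk => A.min'_le k hk
  have hlt : ∀ k ∈ A, k < m := fun k hk => mem_range.1 (hA hk)
  have hμ1 : μ ≤ 1 := by
    have h1 : #A ≤ m - k₀ := by
      rw [← Nat.card_Ico]
      exact card_le_card fun k hk => mem_Ico.2 ⟨hk₀le k hk, hlt k hk⟩
    have h2 : (#A : ℝ) ≤ (m : ℝ) - k₀ := by
      rw [← Nat.cast_sub (hlt _ hk₀A).le]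
      exact_mod_cast h1
    have h3 : μ * (#A * b : ℝ) ≤ 1 * (#A * b) := by
      rw [one_mul]
      refine le_trans ?_ (hhyp k₀ (hlt _ hk₀A))
      have : (b : ℝ) ≤ h (k₀ + 1) := by exact_mod_cast hAb _ hk₀A
      have h4 : (0 : ℝ) ≤ (m : ℝ) - k₀ := by linarith
      gcongr
    exact le_of_mul_le_mul_right h3 (by positivity)
  by_contra! hcon
  set big := A.filter fun k => B < heightVar m h (k + 1) with hbig
  set early := A.filter fun k => 4 * (k - k₀ + 1) < #A with hearly
  set bad := A.filter fun k => heightVar m h (k + 1) ≤ B ∧ #A ≤ 4 * (k - k₀ + 1) with hbad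
  have hbigcard : 2 * #big < #A := by
    have h1 : (#big : ℝ) * B ≤ ∑ k ∈ A, heightVar m h (k + 1) := by
      calc (#big : ℝ) * B = ∑ _k ∈ big, B := by simp
        _ ≤ ∑ k ∈ big, heightVar m h (k + 1) :=
          sum_le_sum fun k hk => (mem_filter.1 hk).2.le
        _ ≤ _ := sum_le_sum_of_subset_of_nonneg (filter_subset _ _)
          fun k _ _ => mean_nonneg fun _ _ => sq_nonneg _
    have h2 : L * #A ≤ B / 2 * #A := by
      gcongr
      linarith [le_max_left L 1]
    have h3 : (2 * #big : ℝ) * (B / 2) < #A * (B / 2) := by linarith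
    have h4 := lt_of_mul_lt_mul_right h3 (by linarith)
    exact_mod_cast h4
  have hearlycard : 4 * #early ≤ #A := by
    have h1 : #early ≤ #A / 4 := by
      calc #early ≤ #(Ico k₀ (k₀ + #A / 4)) := card_le_card fun k hk => by
            obtain ⟨h1, h2⟩ := mem_filter.1 hk
            have := hk₀le k h1
            rw [mem_Ico]
            omega
        _ = #A / 4 := by simp
    omega
  have hbadcard : #A < 4 * #bad := by
    have h1 : #A ≤ #big + #early + #bad := by
      calc #A ≤ #(big ∪ early ∪ bad) := card_le_card fun k hk => by
            simp only [hbig, hearly, hbad, mem_union, mem_filter, hk, true_and]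
            rcases lt_or_ge B (heightVar m h (k + 1)) with h2 | h2
            · simp [h2]
            · rcases lt_or_ge (4 * (k - k₀ + 1)) #A with h3 | h3
              · simp [h3]
              · simp [h2, h3]
        _ ≤ _ := (card_union_le _ _).trans (add_le_add_left (card_union_le _ _) _)
    omega
  have hbadne : bad.Nonempty := card_pos.1 (by omega)
  have hbadslope : ∀ k ∈ bad, μ ^ 3 * b ≤ 272 * #A * slope m h k := by
    intro k hk
    obtain ⟨hkA, -, hk4⟩ := mem_filter.1 hk
    refine le_mul_slope hh h0 hμ hμ1 hcard1 hb0 (hk₀le k hkA) (hlt k hkA) (hAb _ hk₀A) hhyp ?_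
    rw [← Nat.cast_sub (hk₀le k hkA)]
    exact_mod_cast hk4
  have hbadS : ∀ k ∈ bad, slope m h k ≤ S := by
    intro k hk
    obtain ⟨hkA, hkB, -⟩ := mem_filter.1 hk
    have := slope_sq_le hh (hlt k hkA)
    nlinarith [sq_nonneg (slope m h k - 1)]
  have hbadc : ∀ k ∈ bad, c ≤ slope m h k := by
    intro k hk
    have h1 := hbadslope k hk
    have h2 : μ ^ 3 * (μ * #A) ≤ μ ^ 3 * b := by gcongr
    have h3 : (#A : ℝ) * μ ^ 4 ≤ #A * (272 * slope m h k) := by linarith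
    have h4 := le_of_mul_le_mul_left h3 (by linarith)
    rw [hc]
    linarith
  set kmax := bad.max' hbadne with hkmax
  have hkmaxbad : kmax ∈ bad := bad.max'_mem hbadne
  have hkmaxm : kmax < m := hlt _ (mem_filter.1 hkmaxbad).1
  have hQA : Q ≤ #A := by
    have h1 := hbadslope _ hkmaxbad
    have h2 := hbadS _ hkmaxbad
    have h3 : 272 * (#A : ℝ) * slope m h kmax ≤ 272 * #A * S := by gcongr
    have h4 : μ ^ 3 * (272 * S / μ ^ 3 * Q) ≤ μ ^ 3 * b := by gcongr
    have h5 : μ ^ 3 * (272 * S / μ ^ 3 * Q) = 272 * S * Q := by field_simp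
    have h6 : 272 * S * Q ≤ 272 * S * #A := by linarith
    exact le_of_mul_le_mul_left h6 (by positivity)
  set inner := bad.filter fun k => T ≤ k ∧ k + 1 + T ≤ kmax with hinner
  have hinnercard : #bad ≤ #inner + (2 * T + 1) := by
    calc #bad ≤ #(inner ∪ (range T ∪ Icc (kmax - T) kmax)) := card_le_card fun k hk => by
          have := bad.le_max' k hk
          simp only [hinner, mem_union, mem_filter, mem_range, mem_Icc, hk, true_and]
          omega
      _ ≤ #inner + (T + (T + 1)) := by
          refine (card_union_le _ _).trans (add_le_add_right ((card_union_le _ _).trans ?_) _)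
          rw [card_range, Nat.card_Icc]
          omega
      _ = _ := by ring
  have hwindow : ∀ k ∈ inner, η ≤ slope m h (k + 1 + T) - slope m h (k + 1 - T) := by
    intro k hk
    obtain ⟨hkbad, hTk, hkT⟩ := mem_filter.1 hk
    obtain ⟨hkA, hkB, -⟩ := mem_filter.1 hkbad
    have h1 := window_bound hh (hlt k hkA) hTk (by omega) (by linarith) hkB hc0 (hbadc k hkbad)
    rw [← hq] at h1
    set Δ := slope m h (k + 1 + T) - slope m h (k + 1 - T) with hΔ
    have h2 : T * (q / 2) ≤ T * (8 * B / c * Δ) := by linarith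
    have h3 := le_of_mul_le_mul_left h2 hTR
    have h4 : 8 * B / c * Δ = 8 * B * Δ / c := by ring
    rw [h4, le_div_iff₀ hc0] at h3
    rw [hη, div_le_iff₀ (by positivity)]
    linarith
  have hsum : #inner * η ≤ 2 * T * S := by
    rcases inner.eq_empty_or_nonempty with he | ⟨k₁, hk₁⟩
    · rw [he]
      simp only [card_empty, Nat.cast_zero, zero_mul]
      positivity
    obtain ⟨-, hTk₁, hk₁T⟩ := mem_filter.1 hk₁
    calc #inner * η = ∑ _k ∈ inner, η := by simp
      _ ≤ ∑ k ∈ inner, (slope m h (k + 1 + T) - slope m h (k + 1 - T)) := sum_le_sum hwindow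
      _ ≤ ∑ k ∈ Ico T (kmax - T), (slope m h (k + 1 + T) - slope m h (k + 1 - T)) := by
          refine sum_le_sum_of_subset_of_nonneg (fun k hk => ?_) fun k hk _ => ?_
          · obtain ⟨-, h1, h2⟩ := mem_filter.1 hk
            rw [mem_Ico]
            omega
          · rw [mem_Ico] at hk
            exact sub_nonneg.2 (slope_mono (by omega) (by omega))
      _ = ∑ j ∈ range (kmax - T - T), (slope m h (j + 2 * T + 1) - slope m h (j + 1)) := by
          rw [sum_Ico_eq_sum_range]
          refine sum_congr rfl fun j _ => ?_
          rw [show T + j + 1 + T = j + 2 * T + 1 by ring, show T + j + 1 - T = j + 1 by omega]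
      _ ≤ (2 * T : ℕ) * S := by
          refine sum_shift_sub_le (f := fun j => slope m h (j + 1)) (fun _ => slope_nonneg)
            fun j hj => ?_
          exact (slope_mono (by omega) hkmaxm.le).trans (hbadS _ hkmaxbad)
      _ = _ := by push_cast; ring
  have h1 : (#inner : ℝ) ≤ 2 * T * S / η := by rwa [le_div_iff₀ hη0]
  have h2 : (#bad : ℝ) ≤ #inner + (2 * T + 1) := by exact_mod_cast hinnercard
  have h3 : (#A : ℝ) < 4 * #bad := by exact_mod_cast hbadcard
  linarith

lemma lt_card_filter_iff {n : ℕ} {p : Fin n → Prop} [DecidablePred p]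
    (hp : ∀ j j', j ≤ j' → p j' → p j) (j : Fin n) : (j : ℕ) < #{j | p j} ↔ p j := by
  constructor
  · intro hj
    by_contra hpj
    have : #{j | p j} ≤ #(Iio j) := card_le_card fun j' hj' => by
      rw [mem_Iio]
      by_contra! hle
      exact hpj (hp _ _ hle (mem_filter.1 hj').2)
    rw [Fin.card_Iio] at this
    omega
  · intro hpj
    have : #(Iic j) ≤ #{j | p j} := card_le_card fun j' hj' =>
      mem_filter.2 ⟨mem_univ _, hp _ _ (mem_Iic.1 hj') hpj⟩
    rw [Fin.card_Iic] at this
    omega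

lemma card_filter_val_lt {n a : ℕ} (ha : a ≤ n) : #{j : Fin n | (j : ℕ) < a} = a := by
  rw [Fin.card_filter_val_lt, min_eq_right ha]

section crossing
variable {m n : ℕ}

open Classical in
/-- The boundary sequence of a relation between two chains: if `R` is monotone in its first
argument, then its value at `i + 1` is the number of `j` with `R i j`. -/
noncomputable def crossing (R : Fin m → Fin n → Prop) (k : ℕ) : ℕ :=
  #{j | 0 < k ∧ ∀ i : Fin m, k ≤ i + 1 → R i j}

variable {R R' : Fin m → Fin n → Prop}

lemma crossing_zero : crossing R 0 = 0 := by simp [crossing]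

lemma crossing_of_lt {k : ℕ} (hk : m < k) : crossing R k = n := by
  classical
  rw [crossing, filter_true_of_mem, card_univ, Fintype.card_fin]
  exact fun j _ => ⟨by omega, fun i hi => by omega⟩

lemma monotone_crossing : Monotone (crossing R) := fun _ _ hkl =>
  by
  classical
  exact card_le_card <| monotone_filter_right _ fun _ _ ⟨h1, h2⟩ =>
    ⟨h1.trans_le hkl, fun i hi => h2 i (hkl.trans hi)⟩

lemma crossing_mono (hR : ∀ i j, R i j → R' i j) (k : ℕ) : crossing R k ≤ crossing R' k := by
  classical
  exact card_le_card <| monotone_filter_right _ fun j _ ⟨h1, h2⟩ => ⟨h1, fun i hi => hR i j (h2 i hi)⟩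

open Classical in
lemma crossing_succ (hR : ∀ i i' j, i ≤ i' → R i j → R i' j) (i : Fin m) :
    crossing R (i + 1) = #{j | R i j} := by
  rw [crossing]
  congr 1
  ext j
  simp only [mem_filter, mem_univ, true_and]
  exact ⟨fun h => h.2 i le_rfl, fun h => ⟨by omega, fun i' hi => hR _ _ _ (by
    rw [Fin.le_def]; omega) h⟩⟩

lemma lt_crossing_succ_iff (hR : ∀ i i' j, i ≤ i' → R i j → R i' j)
    (hR' : ∀ i j j', j ≤ j' → R i j' → R i j) (i : Fin m) (j : Fin n) :
    (j : ℕ) < crossing R (i + 1) ↔ R i j := by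
  classical
  rw [crossing_succ hR, lt_card_filter_iff (hR' i)]

end crossing

section linExt
variable {β : Type} [Fintype β] [PartialOrder β] {m n : ℕ} {xc : Fin m → β} {yc : Fin n → β}

/-- At `i + 1`, the number of elements of the second chain not above the `i`-th element of the
first chain. -/
noncomputable def bound (xc : Fin m → β) (yc : Fin n → β) : ℕ → ℕ :=
  crossing fun i j => ¬ xc i ≤ yc j

/-- At `i + 1`, the number of elements of the second chain that the linear extension `f` puts
before the `i`-th element of the first chain. -/
noncomputable def pathOf (xc : Fin m → β) (yc : Fin n → β) (f : LinExt β) : ℕ → ℕ :=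
  crossing fun i j => f.1 (yc j) < f.1 (xc i)

lemma pathOf_le (f : LinExt β) (k : ℕ) : pathOf xc yc f k ≤ n := by
  rw [pathOf, crossing]
  exact (card_le_univ _).trans_eq (Fintype.card_fin n)

variable (hP : TwoChains xc yc)
include hP

lemma bijective_sumElim : Function.Bijective (Sum.elim xc yc) := by
  refine ⟨Function.Injective.sumElim (fun i i' h => ?_) (fun j j' h => ?_) hP.disj, fun b => ?_⟩
  · exact le_antisymm ((hP.xchain _ _).1 h.le) ((hP.xchain _ _).1 h.ge)
  · exact le_antisymm ((hP.ychain _ _).1 h.le) ((hP.ychain _ _).1 h.ge)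
  · rcases hP.cover b with ⟨i, rfl⟩ | ⟨j, rfl⟩
    exacts [⟨Sum.inl i, rfl⟩, ⟨Sum.inr j, rfl⟩]

lemma injective_left : Function.Injective xc :=
  (bijective_sumElim hP).1.comp Sum.inl_injective

lemma injective_right : Function.Injective yc :=
  (bijective_sumElim hP).1.comp Sum.inr_injective

lemma card_eq_add : Fintype.card β = m + n := by
  rw [← Fintype.card_of_bijective (bijective_sumElim hP), Fintype.card_sum, Fintype.card_fin,
    Fintype.card_fin]

lemma linExt_lt_left_iff (f : LinExt β) (i i' : Fin m) : f.1 (xc i) < f.1 (xc i') ↔ i < i' := by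
  have hx : StrictMono xc := fun i i' h => lt_of_le_not_ge ((hP.xchain _ _).2 h.le)
    fun h' => h.not_ge ((hP.xchain _ _).1 h')
  have : StrictMono fun i => f.1 (xc i) := fun i i' h => f.2 _ _ (hx h)
  exact this.lt_iff_lt

lemma linExt_lt_right_iff (f : LinExt β) (j j' : Fin n) : f.1 (yc j) < f.1 (yc j') ↔ j < j' := by
  have hy : StrictMono yc := fun i i' h => lt_of_le_not_ge ((hP.ychain _ _).2 h.le)
    fun h' => h.not_ge ((hP.ychain _ _).1 h')
  have : StrictMono fun i => f.1 (yc i) := fun i i' h => f.2 _ _ (hy h)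
  exact this.lt_iff_lt

lemma linExt_le_left {f : LinExt β} {i i' : Fin m} (h : i ≤ i') : f.1 (xc i) ≤ f.1 (xc i') :=
  not_lt.1 fun h' => ((linExt_lt_left_iff hP f _ _).1 h').not_ge h

lemma linExt_le_right {f : LinExt β} {j j' : Fin n} (h : j ≤ j') : f.1 (yc j) ≤ f.1 (yc j') :=
  not_lt.1 fun h' => ((linExt_lt_right_iff hP f _ _).1 h').not_ge h

lemma linExt_right_lt_left_iff (f : LinExt β) (i : Fin m) (j : Fin n) :
    f.1 (yc j) < f.1 (xc i) ↔ (j : ℕ) < pathOf xc yc f (i + 1) :=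
  (lt_crossing_succ_iff (R := fun i j => f.1 (yc j) < f.1 (xc i))
    (fun _ _ _ h h' => h'.trans_le (linExt_le_left hP h))
    (fun _ _ _ h h' => (linExt_le_right hP h).trans_lt h') i j).symm

lemma linExt_left_lt_right_iff (f : LinExt β) (i : Fin m) (j : Fin n) :
    f.1 (xc i) < f.1 (yc j) ↔ pathOf xc yc f (i + 1) ≤ j := by
  rw [← not_lt, ← linExt_right_lt_left_iff hP, not_lt]
  exact ⟨le_of_lt, fun h => h.lt_of_ne fun h' => hP.disj i j (f.1.injective h')⟩

lemma lt_bound_succ_iff (i : Fin m) (j : Fin n) :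
    (j : ℕ) < bound xc yc (i + 1) ↔ ¬ xc i ≤ yc j :=
  lt_crossing_succ_iff (R := fun i j => ¬ xc i ≤ yc j)
    (fun _ _ _ h h' h'' => h' (((hP.xchain _ _).2 h).trans h''))
    (fun _ _ _ h h' h'' => h' (h''.trans ((hP.ychain _ _).2 h))) i j

open Classical in
lemma bound_succ (i : Fin m) : bound xc yc (i + 1) = #{j | ¬ xc i ≤ yc j} := by
  rw [bound, crossing_succ fun _ _ _ h h' h'' => h' (((hP.xchain _ _).2 h).trans h'')]
  congr!

lemma pathOf_mem_paths (f : LinExt β) : pathOf xc yc f ∈ paths m (bound xc yc) := by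
  refine mem_paths.2 ⟨monotone_crossing, crossing_mono fun i j h h' => ?_, fun k hk => ?_⟩
  · exact h.not_gt (f.2 _ _ (h'.lt_of_ne (hP.disj i j)))
  · rw [pathOf, bound, crossing_of_lt hk, crossing_of_lt hk]

lemma linExt_apply (f : LinExt β) (z : β) :
    (f.1 z : ℕ) = #{i | f.1 (xc i) < f.1 z} + #{j | f.1 (yc j) < f.1 z} := by
  have h1 : #{w | f.1 w < f.1 z} = #(Iio (f.1 z)) := card_equiv f.1 (by simp)
  rw [Fin.card_Iio] at h1
  rw [← h1, card_filter, card_filter, card_filter,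
    ← Equiv.sum_comp (Equiv.ofBijective _ (bijective_sumElim hP)), Fintype.sum_sum_type]
  rfl

lemma linExt_left_apply (f : LinExt β) (i : Fin m) :
    (f.1 (xc i) : ℕ) = i + pathOf xc yc f (i + 1) := by
  rw [linExt_apply hP]
  simp_rw [linExt_lt_left_iff hP, linExt_right_lt_left_iff hP]
  rw [card_filter_val_lt (pathOf_le f _), filter_gt_eq_Iio, Fin.card_Iio]

lemma linExt_right_apply (f : LinExt β) (j : Fin n) :
    (f.1 (yc j) : ℕ) = #{i : Fin m | pathOf xc yc f (i + 1) ≤ j} + j := by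
  rw [linExt_apply hP]
  simp_rw [linExt_lt_right_iff hP, linExt_left_lt_right_iff hP]
  rw [filter_gt_eq_Iio, Fin.card_Iio]

lemma injective_pathOf : Function.Injective (pathOf xc yc) := by
  intro f g hfg
  refine Subtype.ext (Equiv.ext fun z => Fin.ext ?_)
  rcases hP.cover z with ⟨i, rfl⟩ | ⟨j, rfl⟩
  · rw [linExt_left_apply hP, linExt_left_apply hP, hfg]
  · rw [linExt_right_apply hP, linExt_right_apply hP, hfg]

lemma exists_pathOf_eq (hU : Unidir xc yc) {ω : ℕ → ℕ} (hω : ω ∈ paths m (bound xc yc)) :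
    ∃ f, pathOf xc yc f = ω := by
  obtain ⟨hmono, hle, heq⟩ := mem_paths.1 hω
  have hωn : ∀ k, ω k ≤ n := fun k => by
    calc ω k ≤ ω (k + m + 1) := hmono (by omega)
      _ = n := by rw [heq _ (by omega), bound, crossing_of_lt (by omega)]
  have hcard : ∀ j : ℕ, #{i : Fin m | ω (i + 1) ≤ j} ≤ m := fun j =>
    (card_filter_le _ _).trans (by simp)
  have hiff : ∀ (i : Fin m) (j : ℕ), (i : ℕ) < #{i : Fin m | ω (i + 1) ≤ j} ↔ ω (i + 1) ≤ j :=
    fun i j => lt_card_filter_iff (p := fun i : Fin m => ω (i + 1) ≤ j)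
      (fun i i' h h' => (hmono (by rw [Fin.le_def] at h; omega)).trans h') i
  let pos : Fin m ⊕ Fin n → Fin (Fintype.card β) := Sum.elim
    (fun i => ⟨i + ω (i + 1), by
      have := hωn (i + 1)
      rw [card_eq_add hP]
      omega⟩)
    (fun j => ⟨#{i : Fin m | ω (i + 1) ≤ j} + j, by
      have := hcard j
      rw [card_eq_add hP]
      omega⟩)
  have hll : ∀ i i' : Fin m, i < i' → pos (.inl i) < pos (.inl i') := fun i i' h => by
    rw [Fin.lt_def] at h
    have := hmono (by omega : (i : ℕ) + 1 ≤ i' + 1)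
    simp only [pos, Sum.elim_inl, Fin.lt_def]
    omega
  have hrr : ∀ j j' : Fin n, j < j' → pos (.inr j) < pos (.inr j') := fun j j' h => by
    rw [Fin.lt_def] at h
    have : #{i : Fin m | ω (i + 1) ≤ j} ≤ #{i : Fin m | ω (i + 1) ≤ j'} :=
      card_le_card <| monotone_filter_right _ fun i _ hi => hi.trans h.le
    simp only [pos, Sum.elim_inr, Fin.lt_def]
    omega
  have hlr : ∀ (i : Fin m) (j : Fin n), ω (i + 1) ≤ j → pos (.inl i) < pos (.inr j) :=
    fun i j h => by
      have := (hiff i j).2 h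
      simp only [pos, Sum.elim_inl, Sum.elim_inr, Fin.lt_def]
      omega
  have hrl : ∀ (i : Fin m) (j : Fin n), j < ω (i + 1) → pos (.inr j) < pos (.inl i) :=
    fun i j h => by
      have := (hiff i j).not.2 (by omega)
      simp only [pos, Sum.elim_inl, Sum.elim_inr, Fin.lt_def]
      omega
  have hinj : Function.Injective pos := by
    refine Function.Injective.sumElim (fun i i' h => ?_) (fun j j' h => ?_) fun i j h => ?_
    · by_contra hne
      rcases lt_or_gt_of_ne hne with h' | h'
      exacts [(hll _ _ h').ne h, (hll _ _ h').ne' h]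
    · by_contra hne
      rcases lt_or_gt_of_ne hne with h' | h'
      exacts [(hrr _ _ h').ne h, (hrr _ _ h').ne' h]
    · rcases le_or_gt (ω (i + 1)) j with h' | h'
      exacts [(hlr _ _ h').ne h, (hrl _ _ h').ne' h]
  have hbij : Function.Bijective pos := (Fintype.bijective_iff_injective_and_card _).2
    ⟨hinj, by simp [card_eq_add hP]⟩
  set e := Equiv.ofBijective _ (bijective_sumElim hP)
  have hex : ∀ i, e.symm (xc i) = .inl i := fun i => e.symm_apply_apply (.inl i)
  have hey : ∀ j, e.symm (yc j) = .inr j := fun j => e.symm_apply_apply (.inr j)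
  have hord : ∀ z w, z < w → e.symm.trans (Equiv.ofBijective pos hbij) z <
      e.symm.trans (Equiv.ofBijective pos hbij) w := fun z w hzw => by
    simp only [Equiv.trans_apply, Equiv.ofBijective_apply]
    rcases hP.cover z with ⟨i, rfl⟩ | ⟨j, rfl⟩ <;> rcases hP.cover w with ⟨i', rfl⟩ | ⟨j', rfl⟩
    · rw [hex, hex]
      exact hll _ _ (lt_of_not_ge fun h => hzw.not_ge ((hP.xchain _ _).2 h))
    · rw [hex, hey]
      refine hlr _ _ ((hle _).trans (not_lt.1 fun h => ?_))
      exact (lt_bound_succ_iff hP _ _).1 h hzw.le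
    · exact absurd hzw.le (hU _ _)
    · rw [hey, hey]
      exact hrr _ _ (lt_of_not_ge fun h => hzw.not_ge ((hP.ychain _ _).2 h))
  set f : LinExt β := ⟨_, hord⟩ with hf
  have hfω : ∀ (i : Fin m) (j : Fin n), f.1 (yc j) < f.1 (xc i) ↔ (j : ℕ) < ω (i + 1) := by
    intro i j
    simp only [hf, Equiv.trans_apply, Equiv.ofBijective_apply, hex, hey]
    exact ⟨fun h => not_le.1 fun h' => h.not_gt (hlr _ _ h'), hrl _ _⟩
  refine ⟨f, funext fun k => ?_⟩
  rcases lt_or_ge m k with hk | hk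
  · rw [heq k hk, pathOf, bound, crossing_of_lt hk, crossing_of_lt hk]
  rcases k with - | k
  · have : ω 0 ≤ 0 := (hle 0).trans crossing_zero.le
    have : pathOf xc yc f 0 = 0 := crossing_zero
    omega
  rw [← card_filter_val_lt (hωn (k + 1)), ← card_filter_val_lt (pathOf_le f (k + 1))]
  simp_rw [← hfω ⟨k, hk⟩, linExt_right_lt_left_iff hP]

lemma sum_linExt (hU : Unidir xc yc) (F : (ℕ → ℕ) → ℝ) :
    ∑ f : LinExt β, F (pathOf xc yc f) = ∑ ω ∈ paths m (bound xc yc), F ω :=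
  sum_bij (fun f _ => pathOf xc yc f) (fun f _ => pathOf_mem_paths hP f)
    (fun _ _ _ _ h => injective_pathOf hP h)
    (fun _ hω => (exists_pathOf_eq hP hU hω).imp fun _ h => ⟨mem_univ _, h⟩) fun _ _ => rfl

lemma mean_linExt (hU : Unidir xc yc) (F : (ℕ → ℕ) → ℝ) :
    (∑ f : LinExt β, F (pathOf xc yc f)) / Nat.card (LinExt β) = mean m (bound xc yc) F := by
  have h := sum_linExt hP hU fun _ => 1
  simp only [sum_const, nsmul_eq_mul, mul_one, card_univ] at h
  rw [sum_linExt hP hU, Nat.card_eq_fintype_card, h, mean]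

lemma val_left (f : LinExt β) (i : Fin m) :
    (val f (xc i) : ℝ) = (i + 1) + (pathOf xc yc f (i + 1) : ℝ) := by
  rw [_root_.val, linExt_left_apply hP]
  push_cast
  ring

lemma expec_left (hU : Unidir xc yc) (i : Fin m) :
    expec (xc i) = (i + 1) + height m (bound xc yc) (i + 1) := by
  rw [expec]
  simp_rw [val_left hP]
  rw [mean_linExt hP hU (fun ω => (i + 1) + (ω (i + 1) : ℝ)), mean_add,
    mean_const (h := bound xc yc) monotone_crossing, height]

lemma variance_left (hU : Unidir xc yc) (i : Fin m) :
    variance (xc i) = heightVar m (bound xc yc) (i + 1) := by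
  rw [variance, expec_left hP hU]
  simp_rw [val_left hP, add_sub_add_left_eq_sub]
  exact mean_linExt hP hU fun ω => ((ω (i + 1) : ℝ) - height m (bound xc yc) (i + 1)) ^ 2

lemma card_le_bound {A : Finset (Fin m)} {B : Finset (Fin n)} [DecidableEq β]
    (hAB : IncompPair (A.image xc) (B.image yc)) {i : Fin m} (hi : i ∈ A) :
    #B ≤ bound xc yc (i + 1) := by
  classical
  rw [bound_succ hP]
  exact card_le_card fun j hj => mem_filter.2 ⟨mem_univ _,
    (hAB.2 _ (mem_image_of_mem _ hi) _ (mem_image_of_mem _ hj)).1⟩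

lemma exists_incompPair (hU : Unidir xc yc) (i : Fin m) :
    ∃ C D : Finset β, IncompPair C D ∧ #C = m - i ∧ #D = bound xc yc (i + 1) := by
  classical
  refine ⟨(Ici i).map ⟨xc, injective_left hP⟩,
    ({j | ¬ xc i ≤ yc j} : Finset (Fin n)).map ⟨yc, injective_right hP⟩, ⟨?_, ?_⟩, ?_, ?_⟩
  · simp only [disjoint_left, mem_map, Function.Embedding.coeFn_mk]
    rintro _ ⟨i', -, rfl⟩ ⟨j, -, h⟩
    exact hP.disj _ _ h.symm
  · simp only [mem_map, Function.Embedding.coeFn_mk, mem_filter, mem_univ, true_and, mem_Ici]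
    rintro _ ⟨i', hi, rfl⟩ _ ⟨j, hj, rfl⟩
    exact ⟨fun h => hj (((hP.xchain _ _).2 hi).trans h), hU _ _⟩
  · rw [card_map, Fin.card_Ici]
  · rw [card_map, bound_succ hP]

end linExt

end BoundedPath

/-- for every `μ > 0` and real `L` there is `K` such that for every finite
unidirectional poset on two chains `X`, `Y` and every `μ`-pair `(A,B)` with `A ⊆ X`, `B ⊆ Y`
and `|B| ≥ max{μ|A|, K}`, one has `Σ_{x∈A} σ(x)² ≥ L|A|`. -/
theorem stmt_15 (μ : ℝ) (hμ : 0 < μ) (L : ℝ) :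
    ∃ K : ℝ,
      ∀ (β : Type) [Fintype β] [DecidableEq β] [PartialOrder β] (m n : ℕ)
        (xc : Fin m → β) (yc : Fin n → β),
        TwoChains xc yc → Unidir xc yc →
        ∀ (A : Finset (Fin m)) (B : Finset (Fin n)),
          IncompPair (A.image xc) (B.image yc) →
          (∀ C D : Finset β, IncompPair C D →
            μ * ((C.card : ℝ) * (D.card : ℝ)) ≤ (A.card : ℝ) * (B.card : ℝ)) →
          μ * (A.card : ℝ) ≤ (B.card : ℝ) → K ≤ (B.card : ℝ) →
          L * (A.card : ℝ) ≤ ∑ i ∈ A, variance (xc i) := by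
  obtain ⟨K, hK⟩ := BoundedPath.exists_le_sum_heightVar hμ L
  refine ⟨K, fun β _ _ _ m n xc yc hP hU A B hAB hmax hBA hKB => ?_⟩
  have := hK m (BoundedPath.bound xc yc) BoundedPath.monotone_crossing
    BoundedPath.crossing_zero (A.map Fin.valEmbedding) #B ?_ ?_ ?_ ?_ hKB
  · simpa only [sum_map, card_map, Fin.valEmbedding_apply, ← BoundedPath.variance_left hP hU]
      using this
  · intro k hk
    obtain ⟨i, -, rfl⟩ := mem_map.1 hk
    exact mem_range.2 i.2
  · intro k hk
    obtain ⟨i, hi, rfl⟩ := mem_map.1 hk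
    exact BoundedPath.card_le_bound hP hAB hi
  · intro k hk
    obtain ⟨C, D, hCD, hC, hD⟩ := BoundedPath.exists_incompPair hP hU ⟨k, hk⟩
    have := hmax C D hCD
    rwa [hC, hD, Nat.cast_sub hk.le, ← card_map Fin.valEmbedding] at this
  · rwa [card_map]
end
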